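/- arXiv:2104.14249 — 3 statements merged into one kernel-verified Lean document; each statement's English description precedes it below -/
import Mathlib

section
/- Let Φ = {φ_a}_{a∈A} be an IFS on ℝ^d satisfying the open set condition, with attractor X, similarity dimension dim_S(Φ), probability vector p_a = r_a^{dim_S(Φ)}, and entropy h_p. Assume h_p < −2·log(Σ_{a∈A} p_a²). Let g : ℕ → [0,∞) be non-increasing with Σ_{n=1}^∞ Σ_{a∈A^n} n·(diam(X_a)·g(n))^{dim_S(Φ)} = ∞, and set Ψ(a) := diam(X_a)·g(|a|). Then for every t ≥ 1, ℋ^{dim_H(X)/t}(W_Φ(Ψ^t)) = ℋ^{dim_H(X)/t}(X), where Ψ^t(a) := Ψ(a)^t and dim_H(X) is the Hausdorff dimension of X. -/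
open MeasureTheory Filter Metric Set
open scoped ENNReal

noncomputable section

/-- The composition `φ_{a_1} ∘ ⋯ ∘ φ_{a_n}` associated to a finite word `a ∈ A^n`. -/
def iterMap {A E : Type*} (φ : A → E → E) : {n : ℕ} → (Fin n → A) → E → E :=
  fun a => (List.ofFn (fun i => φ (a i))).foldr (· ∘ ·) id

/-- The eventually periodic sequence `a_1⋯a_l (a_{l+1}⋯a_n)^∞` with preperiod `a_1⋯a_l`
and period `a_{l+1}⋯a_n`. -/
def evp {A : Type*} {n : ℕ} (a : Fin n → A) (l : ℕ) (h : l < n) : ℕ → A := fun i =>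
  if hi : i < l then a ⟨i, hi.trans h⟩
  else a ⟨l + (i - l) % (n - l), by
    have h1 : (i - l) % (n - l) < n - l := Nat.mod_lt _ (by omega)
    omega⟩

/-- The limsup set `W_Φ(Ψ)`: points `x` such that for infinitely many `n` there are
`a ∈ A^n` and `0 ≤ l ≤ n-1` with `‖x - π(a_1⋯a_l(a_{l+1}⋯a_n)^∞)‖ < Ψ(a)`. -/
def limsupW {A : Type*} {d : ℕ} (π : (ℕ → A) → EuclideanSpace ℝ (Fin d))
    (Ψ : (n : ℕ) → (Fin n → A) → ℝ) : Set (EuclideanSpace ℝ (Fin d)) :=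
  {x | ∃ᶠ n in atTop, ∃ a : Fin n → A, ∃ l : ℕ, ∃ h : l < n,
    ‖x - π (evp a l h)‖ < Ψ n a}

/-- The cylinder set `[a]` of sequences starting with the word `a`. -/
def cyl {A : Type*} {n : ℕ} (a : Fin n → A) : Set (ℕ → A) := {σ | ∀ i : Fin n, σ i = a i}

set_option linter.unusedSectionVars false

section Bernoulli

variable {A : Type*} [Fintype A] [MeasurableSpace A] [MeasurableSingletonClass A]

/-- The event `E` is determined by the coordinates in `S`. -/
def DeterminedBy (E : Set (ℕ → A)) (S : Finset ℕ) : Prop :=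
  ∀ ω ω' : ℕ → A, (∀ i ∈ S, ω i = ω' i) → ω ∈ E → ω' ∈ E

lemma DeterminedBy.mono {E : Set (ℕ → A)} {S T : Finset ℕ} (h : DeterminedBy E S) (hST : S ⊆ T) :
    DeterminedBy E T := fun ω ω' hω => h ω ω' fun i hi => hω i (hST hi)

lemma DeterminedBy.inter {E F : Set (ℕ → A)} {S : Finset ℕ} (hE : DeterminedBy E S)
    (hF : DeterminedBy F S) : DeterminedBy (E ∩ F) S :=
  fun ω ω' hω h => ⟨hE ω ω' hω h.1, hF ω ω' hω h.2⟩

lemma DeterminedBy.eq_preimage {E : Set (ℕ → A)} {S : Finset ℕ} (h : DeterminedBy E S) :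
    E = (fun (ω : ℕ → A) (i : S) => ω i) ⁻¹' ((fun (ω : ℕ → A) (i : S) => ω i) '' E) := by
  ext ω
  constructor
  · intro hω; exact ⟨ω, hω, rfl⟩
  · rintro ⟨ω', hω', he⟩
    exact h ω' ω (fun i hi => congrFun he ⟨i, hi⟩) hω'

lemma DeterminedBy.measurableSet {E : Set (ℕ → A)} {S : Finset ℕ} (h : DeterminedBy E S) :
    MeasurableSet E := by
  rw [h.eq_preimage]
  have : Measurable (fun (ω : ℕ → A) (i : S) => ω i) := by fun_prop
  exact this (Set.toFinite _).measurableSet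

/-- The Bernoulli measure on sequences with marginal `m`. -/
def bernoulliMeasure (m : Measure A) [IsProbabilityMeasure m] : Measure (ℕ → A) :=
  Measure.infinitePi fun _ => m

variable (m : Measure A) [IsProbabilityMeasure m]

instance : IsProbabilityMeasure (bernoulliMeasure m) := by
  unfold bernoulliMeasure; infer_instance

lemma bernoulliMeasure_inter {E F : Set (ℕ → A)} {S T : Finset ℕ} (hE : DeterminedBy E S)
    (hF : DeterminedBy F T) (hST : Disjoint S T) :
    (bernoulliMeasure m).real (E ∩ F) =
      (bernoulliMeasure m).real E * (bernoulliMeasure m).real F := by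
  have h1 : ProbabilityTheory.iIndepFun (fun (i : ℕ) (ω : ℕ → A) => ω i) (bernoulliMeasure m) :=
    ProbabilityTheory.iIndepFun_infinitePi (P := fun _ : ℕ => m) (X := fun _ x => x)
      (fun _ => measurable_id)
  have h2 := h1.indepFun_finset S T hST (fun i => measurable_pi_apply i)
  have h3 := h2.measure_inter_preimage_eq_mul _ _
    (Set.toFinite ((fun (ω : ℕ → A) (i : S) => ω i) '' E)).measurableSet
    (Set.toFinite ((fun (ω : ℕ → A) (i : T) => ω i) '' F)).measurableSet
  rw [← hE.eq_preimage, ← hF.eq_preimage] at h3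
  simp only [Measure.real, h3, ENNReal.toReal_mul]

lemma bernoulliMeasure_box (n k : ℕ) (c : ℕ → A) :
    (bernoulliMeasure m).real {ω | ∀ i < k, ω (n + i) = c i} =
      ∏ i ∈ Finset.range k, m.real {c i} := by
  have : {ω : ℕ → A | ∀ i < k, ω (n + i) = c i} =
      Set.pi (((Finset.range k).image (n + ·) : Finset ℕ) : Set ℕ) (fun i => {c (i - n)}) := by
    ext ω
    simp [Set.mem_pi]
  rw [this, Measure.real, bernoulliMeasure, Measure.infinitePi_pi _ (fun _ _ => .singleton _),
    Finset.prod_image (by intro a _ b _ h; simpa using h), ENNReal.toReal_prod]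
  simp [Measure.real]

lemma determinedBy_box (n k : ℕ) (c : ℕ → A) {S : Finset ℕ} (hS : ∀ i < k, n + i ∈ S) :
    DeterminedBy {ω | ∀ i < k, ω (n + i) = c i} S := by
  intro ω ω' h hω i hi
  rw [← h _ (hS i hi)]; exact hω i hi

lemma sum_bernoulliMeasure_restrict (L : Finset ℕ) :
    ∑ c : L → A, (bernoulliMeasure m).real ((fun (ω : ℕ → A) (i : L) => ω i) ⁻¹' {c}) = 1 := by
  have hm : Measurable (fun (ω : ℕ → A) (i : L) => ω i) := by fun_prop
  have := measureReal_biUnion_finset (μ := bernoulliMeasure m) (s := (Finset.univ : Finset (L → A)))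
    (f := fun c => (fun (ω : ℕ → A) (i : L) => ω i) ⁻¹' {c})
    (fun a _ b _ hab => Disjoint.preimage _ (by simpa using hab))
    (fun c _ => hm (Set.toFinite _).measurableSet)
  rw [← this]
  have h : (⋃ b ∈ (Finset.univ : Finset (L → A)), (fun (ω : ℕ → A) (i : L) => ω i) ⁻¹' {b}) =
      univ := by
    ext ω; simp
  rw [h]; simp

lemma determinedBy_restrict (L : Finset ℕ) (c : L → A) :
    DeterminedBy ((fun (ω : ℕ → A) (i : L) => ω i) ⁻¹' {c}) L := by
  intro ω ω' h hω
  simp only [mem_preimage, mem_singleton_iff] at hω ⊢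
  rw [← hω]; ext i; exact (h i i.2).symm

lemma bernoulliMeasure_le_of_cond (L : Finset ℕ) (E : Set (ℕ → A)) (b : ℝ)
    (h : ∀ c : ℕ → A, ∃ F T, DeterminedBy F T ∧ Disjoint L T ∧
      (∀ ω ∈ E, (∀ i ∈ L, ω i = c i) → ω ∈ F) ∧ (bernoulliMeasure m).real F ≤ b) :
    (bernoulliMeasure m).real E ≤ b := by
  have hne : Nonempty A := by
    by_contra hA
    rw [not_nonempty_iff] at hA
    have := measure_univ (μ := m)
    simp [Set.eq_empty_of_isEmpty] at this
  have hsub : E ⊆ ⋃ c ∈ (Finset.univ : Finset (L → A)),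
      E ∩ (fun (ω : ℕ → A) (i : L) => ω i) ⁻¹' {c} := by
    intro ω hω; simpa using hω
  calc (bernoulliMeasure m).real E
      ≤ ∑ c : L → A, (bernoulliMeasure m).real
          (E ∩ (fun (ω : ℕ → A) (i : L) => ω i) ⁻¹' {c}) :=
        (measureReal_mono hsub (measure_ne_top _ _)).trans (measureReal_biUnion_finset_le _ _)
    _ ≤ ∑ c : L → A, (bernoulliMeasure m).real ((fun (ω : ℕ → A) (i : L) => ω i) ⁻¹' {c}) * b := by
        refine Finset.sum_le_sum fun c _ => ?_
        obtain ⟨F, T, hF, hLT, hEF, hb⟩ :=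
          h (fun i => if hi : i ∈ L then c ⟨i, hi⟩ else hne.some)
        calc _ ≤ (bernoulliMeasure m).real (((fun (ω : ℕ → A) (i : L) => ω i) ⁻¹' {c}) ∩ F) := by
              refine measureReal_mono ?_ (measure_ne_top _ _)
              rintro ω ⟨h1, h2⟩
              refine ⟨h2, hEF ω h1 fun i hi => ?_⟩
              simp only [mem_preimage, mem_singleton_iff] at h2
              simp [hi, ← h2]
          _ = _ := bernoulliMeasure_inter m (determinedBy_restrict L c) hF hLT
          _ ≤ _ := mul_le_mul_of_nonneg_left hb measureReal_nonneg
    _ = b := by rw [← Finset.sum_mul, sum_bernoulliMeasure_restrict, one_mul]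

lemma le_bernoulliMeasure_of_cond (L : Finset ℕ) (E : Set (ℕ → A)) (hE : MeasurableSet E) (b : ℝ)
    (h : ∀ c : ℕ → A, ∃ F T, DeterminedBy F T ∧ Disjoint L T ∧
      (∀ ω ∈ F, (∀ i ∈ L, ω i = c i) → ω ∈ E) ∧ b ≤ (bernoulliMeasure m).real F) :
    b ≤ (bernoulliMeasure m).real E := by
  have := bernoulliMeasure_le_of_cond m L Eᶜ (1 - b) fun c => by
    obtain ⟨F, T, hF, hLT, hFE, hb⟩ := h c
    refine ⟨Fᶜ, T, fun ω ω' hω h1 h2 => h1 (hF ω' ω (fun i hi => (hω i hi).symm) h2), hLT,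
      fun ω hω hc hF' => hω (hFE ω hF' hc), ?_⟩
    rw [probReal_compl_eq_one_sub hF.measurableSet]; linarith
  rw [probReal_compl_eq_one_sub hE] at this; linarith

lemma iIndepSet_bernoulliMeasure {B : ℕ → Set (ℕ → A)} {S : ℕ → Finset ℕ}
    (hB : ∀ j, DeterminedBy (B j) (S j)) (hS : ∀ i j, i ≠ j → Disjoint (S i) (S j)) :
    ProbabilityTheory.iIndepSet B (bernoulliMeasure m) := by
  classical
  rw [ProbabilityTheory.iIndepSet_iff_meas_biInter (fun j => (hB j).measurableSet)]
  intro s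
  have key : DeterminedBy (⋂ i ∈ s, B i) (s.biUnion S) := by
    intro ω ω' h hω
    simp only [mem_iInter] at hω ⊢
    intro i hi
    exact hB i ω ω' (fun k hk => h k (Finset.mem_biUnion.2 ⟨i, hi, hk⟩)) (hω i hi)
  induction s using Finset.induction_on with
  | empty => simp
  | insert a s ha ih =>
    have key' : DeterminedBy (⋂ i ∈ s, B i) (s.biUnion S) := by
      intro ω ω' h hω
      simp only [mem_iInter] at hω ⊢
      intro i hi
      exact hB i ω ω' (fun k hk => h k (Finset.mem_biUnion.2 ⟨i, hi, hk⟩)) (hω i hi)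
    rw [Finset.set_biInter_insert, Finset.prod_insert ha, ← ih key']
    have := bernoulliMeasure_inter m (hB a) key' (by
      rw [Finset.disjoint_biUnion_right]
      intro i hi
      exact hS a i (by rintro rfl; exact ha hi))
    simp only [Measure.real, ← ENNReal.toReal_mul] at this
    exact (ENNReal.toReal_eq_toReal_iff' (measure_ne_top _ _)
      (ENNReal.mul_ne_top (measure_ne_top _ _) (measure_ne_top _ _))).1 this

end Bernoulli

section Matching

variable {A : Type*} [Fintype A] [MeasurableSpace A] [MeasurableSingletonClass A]
variable (m : Measure A) [IsProbabilityMeasure m]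

/-- The words read at positions `l` and `n` agree up to some length at most `K` at which their
probability has dropped below `θ`. -/
def matchSet (K : ℕ) (θ : ℝ) (l n : ℕ) : Set (ℕ → A) :=
  {ω | ∃ k ≤ K, (∀ i < k, ω (n + i) = ω (l + i)) ∧
    ∏ i ∈ Finset.range k, m.real {ω (l + i)} < θ}

/-- The window of length `K` starting at `l`. -/
def window (K l : ℕ) : Finset ℕ := Finset.Ico l (l + K)

lemma mem_window {K l i : ℕ} : i ∈ window K l ↔ l ≤ i ∧ i < l + K := by simp [window]

lemma matchSet_comm (K : ℕ) (θ : ℝ) (l n : ℕ) : matchSet m K θ l n = matchSet m K θ n l := by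
  ext ω
  constructor
  all_goals
    rintro ⟨k, hk, h1, h2⟩
    refine ⟨k, hk, fun i hi => (h1 i hi).symm, ?_⟩
    rwa [Finset.prod_congr rfl fun i hi => by rw [h1 i (Finset.mem_range.1 hi)]]

lemma determinedBy_matchSet (K : ℕ) (θ : ℝ) (l n : ℕ) {S : Finset ℕ} (hl : window K l ⊆ S)
    (hn : window K n ⊆ S) : DeterminedBy (matchSet m K θ l n) S := by
  rintro ω ω' h ⟨k, hk, h1, h2⟩
  have hl' : ∀ i < k, ω (l + i) = ω' (l + i) := fun i hi => h _ (hl (mem_window.2 (by omega)))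
  have hn' : ∀ i < k, ω (n + i) = ω' (n + i) := fun i hi => h _ (hn (mem_window.2 (by omega)))
  refine ⟨k, hk, fun i hi => by rw [← hl' i hi, ← hn' i hi, h1 i hi], ?_⟩
  rwa [Finset.prod_congr rfl fun i hi => by rw [← hl' i (Finset.mem_range.1 hi)]]

variable {m} {ρ : ℝ}

lemma prod_real_le_pow (hm : ∀ a, m.real {a} ≤ ρ) (c : ℕ → A) (k : ℕ) :
    ∏ i ∈ Finset.range k, m.real {c i} ≤ ρ ^ k := by
  simpa using Finset.prod_le_prod (s := Finset.range k) (f := fun i => m.real {c i})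
    (g := fun _ => ρ) (fun _ _ => measureReal_nonneg) (fun i _ => hm (c i))

/-- Stopping length of the word `c` at probability `θ`. -/
lemma exists_stopping (hm : ∀ a, m.real {a} ≤ ρ) {K : ℕ} {θ : ℝ} (hθ1 : θ ≤ 1)
    (hK : ρ ^ K < θ) {p₀ : ℝ} (hp0 : 0 ≤ p₀) (hp : ∀ a, p₀ ≤ m.real {a}) (c : ℕ → A) :
    ∃ k ≤ K, ∏ i ∈ Finset.range k, m.real {c i} < θ ∧
      (∀ k' < k, θ ≤ ∏ i ∈ Finset.range k', m.real {c i}) ∧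
      p₀ * θ ≤ ∏ i ∈ Finset.range k, m.real {c i} := by
  classical
  have hex : ∃ k, ∏ i ∈ Finset.range k, m.real {c i} < θ :=
    ⟨K, (prod_real_le_pow hm c K).trans_lt hK⟩
  have hmin : ∀ k' < Nat.find hex, θ ≤ ∏ i ∈ Finset.range k', m.real {c i} :=
    fun k' hk' => not_lt.1 (Nat.find_min hex hk')
  refine ⟨Nat.find hex, Nat.find_min' hex ((prod_real_le_pow hm c K).trans_lt hK),
    Nat.find_spec hex, hmin, ?_⟩
  rcases hk : Nat.find hex with _ | k
  · have := Nat.find_spec hex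
    rw [hk] at this
    simp at this
    linarith
  · have h1 := hmin k (by omega)
    rw [Finset.prod_range_succ, mul_comm]
    have : 0 ≤ θ := by
      by_contra hneg
      push Not at hneg
      have := Nat.find_spec hex
      have h0 : 0 ≤ ∏ i ∈ Finset.range (Nat.find hex), m.real {c i} :=
        Finset.prod_nonneg fun _ _ => measureReal_nonneg
      linarith
    exact mul_le_mul h1 (hp _) hp0 (this.trans h1)

lemma le_measure_matchSet (hm : ∀ a, m.real {a} ≤ ρ) {K : ℕ} {θ : ℝ} (hθ1 : θ ≤ 1)
    (hK : ρ ^ K < θ) {p₀ : ℝ} (hp0 : 0 ≤ p₀) (hp : ∀ a, p₀ ≤ m.real {a}) {l n : ℕ}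
    (hln : l + K ≤ n) : p₀ * θ ≤ (bernoulliMeasure m).real (matchSet m K θ l n) := by
  refine le_bernoulliMeasure_of_cond m (window K l) _
    (determinedBy_matchSet m K θ l n Finset.subset_union_left
      Finset.subset_union_right).measurableSet _ fun c => ?_
  obtain ⟨k, hkK, hk1, -, hk3⟩ := exists_stopping hm hθ1 hK hp0 hp (fun i => c (l + i))
  refine ⟨{ω | ∀ i < k, ω (n + i) = c (l + i)}, window K n,
    determinedBy_box n k (fun i => c (l + i)) fun i hi => mem_window.2 (by omega), ?_, ?_, ?_⟩
  · rw [Finset.disjoint_left]; intro i; simp only [mem_window]; omega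
  · intro ω hω hc
    have hc' : ∀ i < k, ω (l + i) = c (l + i) := fun i hi => hc _ (mem_window.2 (by omega))
    refine ⟨k, hkK, fun i hi => by rw [hω i hi, hc' i hi], ?_⟩
    rwa [Finset.prod_congr rfl fun i hi => by rw [hc' i (Finset.mem_range.1 hi)]]
  · rw [bernoulliMeasure_box]; exact hk3

lemma measure_matchSet_inter_le_of_le (hm : ∀ a, m.real {a} ≤ ρ) (hρ0 : 0 ≤ ρ)
    {K : ℕ} {θ : ℝ} (hθ1 : θ ≤ 1) (hK : ρ ^ K < θ) {a a' b b' : ℕ}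
    (hbb : b ≤ b')
    (hdisj : Disjoint (window K a ∪ window K a') (window K b ∪ window K b')) :
    (bernoulliMeasure m).real (matchSet m K θ a b ∩ matchSet m K θ a' b') ≤
      θ * (ρ ^ (b' - b) + θ) := by
  have hθ : 0 < θ := (pow_nonneg hρ0 K).trans_lt hK
  refine bernoulliMeasure_le_of_cond m (window K a ∪ window K a') _ _ fun c => ?_
  obtain ⟨k, hkK, hk1, hk2, -⟩ := exists_stopping (p₀ := 0) hm hθ1 hK le_rfl
    (fun _ => measureReal_nonneg) (fun i => c (a + i))
  obtain ⟨k', hkK', hk1', hk2', -⟩ := exists_stopping (p₀ := 0) hm hθ1 hK le_rfl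
    (fun _ => measureReal_nonneg) (fun i => c (a' + i))
  set j := min (b' - b) k
  have hd1 : DeterminedBy {ω : ℕ → A | ∀ i < j, ω (b + i) = c (a + i)} (window j b) :=
    determinedBy_box b j (fun i => c (a + i)) fun i hi => mem_window.2 (by omega)
  have hd2 : DeterminedBy {ω : ℕ → A | ∀ i < k', ω (b' + i) = c (a' + i)} (window K b') :=
    determinedBy_box b' k' (fun i => c (a' + i)) fun i hi => mem_window.2 (by omega)
  have agree_of_stopping : ∀ (ω : ℕ → A) (a b k : ℕ), k ≤ K →
      (∀ k' < k, θ ≤ ∏ i ∈ Finset.range k', m.real {c (a + i)}) →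
      ω ∈ matchSet m K θ a b → (∀ i ∈ window K a, ω i = c i) → ∀ i < k, ω (b + i) = c (a + i) := by
    rintro ω a b k hk h2 ⟨q, hq, h3, h4⟩ h5 i hi
    have hc' : ∀ i < K, ω (a + i) = c (a + i) := fun i hi => h5 _ (mem_window.2 (by omega))
    have hkq : k ≤ q := by
      by_contra hlt
      push Not at hlt
      have := h2 q hlt
      rw [Finset.prod_congr rfl fun i hi => by
        rw [hc' i ((Finset.mem_range.1 hi).trans_le hq)]] at h4
      linarith
    rw [h3 i (by omega), hc' i (by omega)]
  refine ⟨_, window K b ∪ window K b', (hd1.mono ?_).inter (hd2.mono Finset.subset_union_right),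
    hdisj, ?_, ?_⟩
  · refine Finset.Subset.trans (fun i => ?_) Finset.subset_union_left
    simp only [mem_window]; omega
  · rintro ω ⟨h1, h2⟩ hc
    refine ⟨fun i hi => agree_of_stopping ω a b k hkK hk2 h1
      (fun i hi => hc i (Finset.mem_union_left _ hi)) i (by omega),
      agree_of_stopping ω a' b' k' hkK' hk2' h2 (fun i hi => hc i (Finset.mem_union_right _ hi))⟩
  · rw [bernoulliMeasure_inter m hd1 hd2
      (by rw [Finset.disjoint_left]; intro i; simp only [mem_window]; omega),
      bernoulliMeasure_box m b j (fun i => c (a + i)),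
      bernoulliMeasure_box m b' k' (fun i => c (a' + i)),
      mul_comm]
    refine mul_le_mul hk1'.le ?_ (Finset.prod_nonneg fun _ _ => measureReal_nonneg) hθ.le
    rcases min_choice (b' - b) k with h | h
    · have := prod_real_le_pow hm (fun i => c (a + i)) j
      rw [show j = b' - b from h] at this ⊢
      linarith
    · rw [show j = k from h]
      have := pow_nonneg hρ0 (b' - b)
      linarith

lemma measure_matchSet_inter_le (hm : ∀ a, m.real {a} ≤ ρ) (hρ0 : 0 ≤ ρ)
    {K : ℕ} {θ : ℝ} (hθ1 : θ ≤ 1) (hK : ρ ^ K < θ) {a a' b b' : ℕ}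
    (hdisj : Disjoint (window K a ∪ window K a') (window K b ∪ window K b')) :
    (bernoulliMeasure m).real (matchSet m K θ a b ∩ matchSet m K θ a' b') ≤
      θ * (ρ ^ Nat.dist b b' + θ) := by
  rcases le_total b b' with h | h
  · rw [Nat.dist_eq_sub_of_le h]
    exact measure_matchSet_inter_le_of_le hm hρ0 hθ1 hK h hdisj
  · rw [Nat.dist_eq_sub_of_le_right h, inter_comm]
    refine measure_matchSet_inter_le_of_le hm hρ0 hθ1 hK h ?_
    rwa [Finset.union_comm, Finset.union_comm (window K b')]

lemma measure_matchSet_inter_le_mul (hm : ∀ a, m.real {a} ≤ ρ) (hρ0 : 0 ≤ ρ)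
    {K : ℕ} {θ : ℝ} (hθ1 : θ ≤ 1) (hK : ρ ^ K < θ) {a a' b b' : ℕ}
    (hdisj : Disjoint (window K a ∪ window K a') (window K b ∪ window K b')) :
    (bernoulliMeasure m).real (matchSet m K θ a b ∩ matchSet m K θ a' b') ≤
      θ * (√ρ ^ Nat.dist a a' * √ρ ^ Nat.dist b b' + θ) := by
  have hθ : 0 < θ := (pow_nonneg hρ0 K).trans_lt hK
  have h1 := measure_matchSet_inter_le hm hρ0 hθ1 hK hdisj
  have h2 := measure_matchSet_inter_le hm hρ0 hθ1 hK hdisj.symm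
  rw [matchSet_comm m K θ b a, matchSet_comm m K θ b' a'] at h2
  set u := √ρ ^ Nat.dist a a'
  set v := √ρ ^ Nat.dist b b'
  have hu : ρ ^ Nat.dist a a' = u ^ 2 := by
    rw [← pow_mul, mul_comm, pow_mul, Real.sq_sqrt hρ0]
  have hv : ρ ^ Nat.dist b b' = v ^ 2 := by
    rw [← pow_mul, mul_comm, pow_mul, Real.sq_sqrt hρ0]
  have hu0 : 0 ≤ u := pow_nonneg (Real.sqrt_nonneg _) _
  have hv0 : 0 ≤ v := pow_nonneg (Real.sqrt_nonneg _) _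
  rw [hv] at h1
  rw [hu] at h2
  rcases le_total u v with h | h
  · exact h2.trans (mul_le_mul_of_nonneg_left (by nlinarith) hθ.le)
  · exact h1.trans (mul_le_mul_of_nonneg_left (by nlinarith) hθ.le)

lemma sum_pow_dist_le {κ : ℝ} (h0 : 0 ≤ κ) (h1 : κ < 1) (l : ℕ) (S : Finset ℕ) :
    ∑ l' ∈ S, κ ^ Nat.dist l l' ≤ 2 / (1 - κ) := by
  have hs := summable_geometric_of_lt_one h0 h1
  have hinj : ∀ (T : Finset ℕ) (f : ℕ → ℕ), Set.InjOn f T →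
      ∑ i ∈ T, κ ^ f i ≤ (1 - κ)⁻¹ := by
    intro T f hf
    rw [← Finset.sum_image (f := fun i => κ ^ i) hf, ← tsum_geometric_of_lt_one h0 h1]
    exact hs.sum_le_tsum _ fun i _ => pow_nonneg h0 i
  rw [← Finset.sum_filter_add_sum_filter_not S (fun l' => l' ≤ l)]
  have e1 := hinj (S.filter (fun l' => l' ≤ l)) (Nat.dist l) (by
    intro x hx y hy hxy
    simp only [Finset.coe_filter, mem_ofPred_eq] at hx hy
    simp only [Nat.dist] at hxy; omega)
  have e2 := hinj (S.filter (fun l' => ¬ l' ≤ l)) (Nat.dist l) (by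
    intro x hx y hy hxy
    simp only [Finset.coe_filter, mem_ofPred_eq] at hx hy
    simp only [Nat.dist] at hxy; omega)
  rw [div_eq_mul_inv]; linarith

/-- A second moment lower bound for the probability of a finite union. -/
lemma second_moment_le_measure_biUnion {Ω ι : Type*} [MeasurableSpace Ω] (μ : Measure Ω)
    [IsProbabilityMeasure μ] (D : Finset ι) (E : ι → Set Ω) (hE : ∀ i, MeasurableSet (E i))
    (c : ℝ) :
    2 * c * ∑ i ∈ D, μ.real (E i) - c ^ 2 * ∑ i ∈ D, ∑ j ∈ D, μ.real (E i ∩ E j) ≤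
      μ.real (⋃ i ∈ D, E i) := by
  classical
  set Z : Ω → ℝ := fun ω => ∑ i ∈ D, (E i).indicator 1 ω with hZ
  have hi : ∀ S : Set Ω, MeasurableSet S → Integrable (S.indicator (1 : Ω → ℝ)) μ :=
    fun S hS => (integrable_const (1 : ℝ)).indicator hS
  have hZ2 : ∀ ω, Z ω ^ 2 = ∑ i ∈ D, ∑ j ∈ D, (E i ∩ E j).indicator 1 ω := by
    intro ω
    rw [sq, hZ, Finset.sum_mul_sum]
    refine Finset.sum_congr rfl fun i _ => Finset.sum_congr rfl fun j _ => ?_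
    rw [Set.inter_indicator_one]; rfl
  have hU : MeasurableSet (⋃ i ∈ D, E i) := Finset.measurableSet_biUnion _ fun i _ => hE i
  have e1 : ∫ ω, Z ω ∂μ = ∑ i ∈ D, μ.real (E i) := by
    rw [integral_finsetSum _ fun i _ => hi _ (hE i)]
    exact Finset.sum_congr rfl fun i _ => integral_indicator_one (hE i)
  have e2 : ∫ ω, Z ω ^ 2 ∂μ = ∑ i ∈ D, ∑ j ∈ D, μ.real (E i ∩ E j) := by
    simp only [hZ2]
    rw [integral_finsetSum _ fun i _ =>
      integrable_finsetSum _ fun j _ => hi _ ((hE i).inter (hE j))]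
    refine Finset.sum_congr rfl fun i _ => ?_
    rw [integral_finsetSum _ fun j _ => hi _ ((hE i).inter (hE j))]
    exact Finset.sum_congr rfl fun j _ => integral_indicator_one ((hE i).inter (hE j))
  have i1 : Integrable Z μ := integrable_finsetSum _ fun i _ => hi _ (hE i)
  have i2 : Integrable (fun ω => Z ω ^ 2) μ := by
    simp only [hZ2]
    exact integrable_finsetSum _ fun i _ =>
      integrable_finsetSum _ fun j _ => hi _ ((hE i).inter (hE j))
  rw [← e1, ← e2, ← integral_const_mul, ← integral_const_mul,
    ← integral_sub (i1.const_mul _) (i2.const_mul _), ← integral_indicator_one hU]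
  refine integral_mono ((i1.const_mul _).sub (i2.const_mul _)) (hi _ hU) fun ω => ?_
  by_cases hω : ω ∈ ⋃ i ∈ D, E i
  · simp only [Set.indicator_of_mem hω, Pi.one_apply]
    nlinarith [sq_nonneg (1 - c * Z ω)]
  · have : Z ω = 0 := by
      refine Finset.sum_eq_zero fun i hi => Set.indicator_of_notMem (fun h => hω ?_) _
      exact mem_biUnion hi h
    simp [this, Set.indicator_of_notMem hω]

/-- The union of the match events over positions `l ∈ [N, 2N)`, `n ∈ [3N, 4N)`. -/
def blockSet (m : Measure A) (N : ℕ) (θ : ℝ) : Set (ℕ → A) :=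
  ⋃ q ∈ Finset.Ico N (2 * N) ×ˢ Finset.Ico (3 * N) (4 * N), matchSet m N θ q.1 q.2

lemma determinedBy_blockSet (N : ℕ) (θ : ℝ) :
    DeterminedBy (blockSet m N θ) (Finset.Ico N (5 * N)) := by
  intro ω ω' h hω
  simp only [blockSet, mem_iUnion, exists_prop] at hω ⊢
  obtain ⟨q, hq, hω⟩ := hω
  refine ⟨q, hq, determinedBy_matchSet m N θ q.1 q.2 ?_ ?_ ω ω' h hω⟩
  all_goals
    intro i
    simp only [Finset.mem_product, Finset.mem_Ico, mem_window] at hq ⊢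
    omega

lemma le_measure_blockSet (hm : ∀ a, m.real {a} ≤ ρ) (hρ0 : 0 ≤ ρ) (hρ1 : ρ < 1)
    {N : ℕ} {θ : ℝ} (hθ1 : θ ≤ 1) (hK : ρ ^ N < θ)
    {p₀ : ℝ} (hp0 : 0 ≤ p₀) (hp : ∀ a, p₀ ≤ m.real {a}) :
    p₀ ^ 2 * ((N : ℝ) ^ 2 * θ) / ((2 / (1 - √ρ)) ^ 2 + (N : ℝ) ^ 2 * θ) ≤
      (bernoulliMeasure m).real (blockSet m N θ) := by
  have hθ : 0 < θ := (pow_nonneg hρ0 N).trans_lt hK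
  have hκ0 : 0 ≤ √ρ := Real.sqrt_nonneg _
  have hκ1 : √ρ < 1 := by rw [Real.sqrt_lt' one_pos]; simpa using hρ1
  set C := 2 / (1 - √ρ) with hC
  have hC0 : 0 < C := div_pos two_pos (by linarith)
  set lam := (N : ℝ) ^ 2 * θ with hlam
  have hlam0 : 0 ≤ lam := by positivity
  set I := Finset.Ico N (2 * N)
  set J := Finset.Ico (3 * N) (4 * N)
  have hI : (I.card : ℝ) = N := by simp [I]; omega
  have hJ : (J.card : ℝ) = N := by simp [J]; omega
  have hfirst : p₀ * lam ≤ ∑ q ∈ I ×ˢ J, (bernoulliMeasure m).real (matchSet m N θ q.1 q.2) := by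
    have := Finset.card_nsmul_le_sum (I ×ˢ J)
      (fun q => (bernoulliMeasure m).real (matchSet m N θ q.1 q.2)) (p₀ * θ) fun q hq => by
        simp only [I, J, Finset.mem_product, Finset.mem_Ico] at hq
        exact le_measure_matchSet hm hθ1 hK hp0 hp (by omega)
    refine le_trans (le_of_eq ?_) this
    rw [nsmul_eq_mul, Finset.card_product, Nat.cast_mul, hI, hJ]; ring
  have hsum : ∀ S : Finset ℕ, ∑ l ∈ S, ∑ l' ∈ S, √ρ ^ Nat.dist l l' ≤ S.card * C := by
    intro S
    have := Finset.sum_le_card_nsmul S (fun l => ∑ l' ∈ S, √ρ ^ Nat.dist l l') C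
      fun l _ => sum_pow_dist_le hκ0 hκ1 l S
    simpa using this
  have hsecond : ∑ q ∈ I ×ˢ J, ∑ q' ∈ I ×ˢ J, (bernoulliMeasure m).real
      (matchSet m N θ q.1 q.2 ∩ matchSet m N θ q'.1 q'.2) ≤ C ^ 2 * lam + lam ^ 2 := by
    calc _ ≤ ∑ q ∈ I ×ˢ J, ∑ q' ∈ I ×ˢ J,
          θ * (√ρ ^ Nat.dist q.1 q'.1 * √ρ ^ Nat.dist q.2 q'.2 + θ) := by
          refine Finset.sum_le_sum fun q hq => Finset.sum_le_sum fun q' hq' => ?_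
          refine measure_matchSet_inter_le_mul hm hρ0 hθ1 hK ?_
          rw [Finset.disjoint_left]
          intro i
          simp only [I, J, Finset.mem_product, Finset.mem_Ico, mem_window,
            Finset.mem_union] at hq hq' ⊢
          omega
      _ = θ * ((∑ l ∈ I, ∑ l' ∈ I, √ρ ^ Nat.dist l l') *
            ∑ l ∈ J, ∑ l' ∈ J, √ρ ^ Nat.dist l l') + (I.card * J.card * θ) ^ 2 := by
          simp only [mul_add, Finset.sum_add_distrib]
          congr 1
          · simp only [← Finset.mul_sum]
            congr 1
            rw [Finset.sum_product, Finset.sum_mul]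
            refine Finset.sum_congr rfl fun l _ => ?_
            rw [Finset.mul_sum]
            refine Finset.sum_congr rfl fun n _ => ?_
            rw [Finset.sum_product, Finset.sum_mul]
            exact Finset.sum_congr rfl fun l' _ => by rw [Finset.mul_sum]
          · simp only [Finset.sum_const, Finset.card_product, nsmul_eq_mul]
            push_cast; ring
      _ ≤ θ * ((I.card * C) * (J.card * C)) + (I.card * J.card * θ) ^ 2 := by
          gcongr
          · exact hsum I
          · exact hsum J
      _ = _ := by rw [hI, hJ, hlam]; ring
  have hpos : 0 < C ^ 2 + lam := by positivity
  have := second_moment_le_measure_biUnion (bernoulliMeasure m) (I ×ˢ J)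
    (fun q => matchSet m N θ q.1 q.2) (fun q => (determinedBy_matchSet m N θ q.1 q.2
      Finset.subset_union_left Finset.subset_union_right).measurableSet) (p₀ / (C ^ 2 + lam))
  refine le_trans ?_ this
  have e : p₀ ^ 2 * lam / (C ^ 2 + lam) = 2 * (p₀ / (C ^ 2 + lam)) * (p₀ * lam) -
      (p₀ / (C ^ 2 + lam)) ^ 2 * (C ^ 2 * lam + lam ^ 2) := by
    field_simp; ring
  rw [e]
  gcongr

end Matching

section Recurrence

variable {A : Type*} [Fintype A] [MeasurableSpace A] [MeasurableSingletonClass A]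
variable {m : Measure A} [IsProbabilityMeasure m] {ρ : ℝ}

lemma blockSet_mono {N : ℕ} {θ θ' : ℝ} (h : θ ≤ θ') : blockSet m N θ ⊆ blockSet m N θ' := by
  refine iUnion₂_mono fun q _ => ?_
  rintro ω ⟨k, hk, h1, h2⟩
  exact ⟨k, hk, h1, h2.trans_le h⟩

lemma not_summable_div_const_add {f : ℕ → ℝ} (hf : ∀ j, 0 ≤ f j) (h : ¬ Summable f) {C : ℝ}
    (hC : 0 < C) : ¬ Summable fun j => f j / (C + f j) := by
  intro hs
  have h0 := hs.tendsto_atTop_zero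
  have hev : ∀ᶠ j in atTop, f j / (C + f j) < 1 / 2 :=
    h0.eventually (gt_mem_nhds (by norm_num))
  refine h (((hs.mul_left (2 * C))).of_norm_bounded_eventually_nat ?_)
  filter_upwards [hev] with j hj
  have hp : 0 < C + f j := by linarith [hf j]
  rw [div_lt_iff₀ hp] at hj
  rw [Real.norm_of_nonneg (hf j), ← mul_div_assoc, le_div_iff₀ hp]
  nlinarith [hf j]

lemma not_summable_pow_mul_min_one {θ : ℕ → ℝ} (h0 : ∀ j, 0 ≤ θ j)
    (h : ¬ Summable fun j => (25 : ℝ) ^ j * θ j) :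
    ¬ Summable fun j => (25 : ℝ) ^ j * min (θ j) 1 := by
  intro hs
  have hev : ∀ᶠ j in atTop, (25 : ℝ) ^ j * min (θ j) 1 < 1 :=
    hs.tendsto_atTop_zero.eventually (gt_mem_nhds one_pos)
  refine h (hs.of_norm_bounded_eventually_nat ?_)
  filter_upwards [hev] with j hj
  have h25 : (1 : ℝ) ≤ 25 ^ j := one_le_pow₀ (by norm_num)
  have hnn := mul_nonneg (zero_le_one.trans h25) (h0 j)
  rw [Real.norm_of_nonneg hnn]
  rcases le_total (θ j) 1 with hθ | hθ
  · rw [min_eq_left hθ]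
  · rw [min_eq_right hθ] at hj; linarith

/-- Almost every sequence lies in infinitely many of the sets `blockSet`, if the thresholds
decay slowly enough. -/
theorem ae_frequently_mem_blockSet (hm : ∀ a, m.real {a} ≤ ρ) (hρ0 : 0 ≤ ρ) (hρ1 : ρ < 1)
    {p₀ : ℝ} (hp0 : 0 < p₀) (hp : ∀ a, p₀ ≤ m.real {a}) {θ : ℕ → ℝ} (hθ : ∀ j, 0 ≤ θ j)
    (hdiv : ¬ Summable fun j => (25 : ℝ) ^ j * θ j) :
    ∀ᵐ ω ∂bernoulliMeasure m, ∃ᶠ j in atTop, ω ∈ blockSet m (5 ^ j) (θ j) := by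
  classical
  set θ' : ℕ → ℝ := fun j => min (θ j) 1 with hθ'
  have hθ'0 : ∀ j, 0 ≤ θ' j := fun j => le_min (hθ j) zero_le_one
  set B : ℕ → Set (ℕ → A) := fun j =>
    if ρ ^ (5 ^ j) < θ' j then blockSet m (5 ^ j) (θ' j) else ∅ with hB
  set lam : ℕ → ℝ := fun j => if ρ ^ (5 ^ j) < θ' j then (25 : ℝ) ^ j * θ' j else 0 with hlam
  have hdet : ∀ j, DeterminedBy (B j) (Finset.Ico (5 ^ j) (5 * 5 ^ j)) := by
    intro j
    simp only [hB]
    split_ifs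
    · exact determinedBy_blockSet _ _
    · intro ω ω' _ h; exact h
  have hdisj : ∀ i j : ℕ, i ≠ j →
      Disjoint (Finset.Ico (5 ^ i) (5 * 5 ^ i)) (Finset.Ico (5 ^ j) (5 * 5 ^ j)) := by
    have key : ∀ i j : ℕ, i < j → 5 * 5 ^ i ≤ 5 ^ j := fun i j hij => by
      rw [mul_comm, ← pow_succ]; exact Nat.pow_le_pow_right (by norm_num) hij
    intro i j hij
    rw [Finset.disjoint_left]
    intro x
    simp only [Finset.mem_Ico]
    rcases lt_or_gt_of_ne hij with h | h <;> have := key _ _ h <;> omega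
  have hind := iIndepSet_bernoulliMeasure m hdet hdisj
  have hlam0 : ∀ j, 0 ≤ lam j := by
    intro j
    simp only [hlam]
    split_ifs
    · exact mul_nonneg (by positivity) (hθ'0 j)
    · exact le_rfl
  have hlamdiv : ¬ Summable lam := by
    intro hs
    have h2 : Summable fun j : ℕ => ((5 ^ j : ℕ) : ℝ) ^ 2 * ρ ^ (5 ^ j) :=
      (summable_pow_mul_geometric_of_norm_lt_one (r := ρ) 2
        (by rwa [Real.norm_of_nonneg hρ0])).comp_injective
        (Nat.pow_right_injective (by norm_num : 2 ≤ 5))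
    refine not_summable_pow_mul_min_one hθ hdiv ((hs.add h2).of_nonneg_of_le
      (fun j => mul_nonneg (by positivity) (hθ'0 j)) fun j => ?_)
    have e : ((5 ^ j : ℕ) : ℝ) ^ 2 = 25 ^ j := by
      push_cast; rw [← pow_mul, mul_comm, pow_mul]; norm_num
    rw [e]
    simp only [hlam]
    split_ifs with hg
    · have : (0 : ℝ) ≤ 25 ^ j * ρ ^ 5 ^ j := by positivity
      linarith
    · rw [zero_add]; gcongr; exact not_lt.1 hg
  have hC : (0 : ℝ) < (2 / (1 - √ρ)) ^ 2 := by
    have : √ρ < 1 := by rw [Real.sqrt_lt' one_pos]; simpa using hρ1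
    have : 0 < 1 - √ρ := by linarith
    positivity
  have hPB : ∀ j, p₀ ^ 2 * (lam j / ((2 / (1 - √ρ)) ^ 2 + lam j)) ≤
      (bernoulliMeasure m).real (B j) := by
    intro j
    simp only [hB, hlam]
    split_ifs with hg
    · have := le_measure_blockSet hm hρ0 hρ1 (min_le_right _ _) hg hp0.le hp
      have e : ((5 ^ j : ℕ) : ℝ) ^ 2 = 25 ^ j := by
        push_cast; rw [← pow_mul, mul_comm, pow_mul]; norm_num
      rwa [e, mul_div_assoc] at this
    · simp
  have hinf : ∑' j, bernoulliMeasure m (B j) = ∞ := by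
    by_contra hne
    have hs := ENNReal.summable_toReal hne
    have h1 : Summable fun j => p₀ ^ 2 * (lam j / ((2 / (1 - √ρ)) ^ 2 + lam j)) :=
      hs.of_nonneg_of_le (fun j => by have := hlam0 j; positivity) hPB
    have h2 := (summable_mul_left_iff (by positivity : p₀ ^ 2 ≠ 0)).1 h1
    exact not_summable_div_const_add hlam0 hlamdiv hC h2
  have hone := ProbabilityTheory.measure_limsup_eq_one (fun j => (hdet j).measurableSet) hind hinf
  have hae : limsup B atTop ∈ ae (bernoulliMeasure m) :=
    (mem_ae_iff_prob_eq_one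
      (MeasurableSet.measurableSet_limsup fun j => (hdet j).measurableSet)).2 hone
  filter_upwards [hae] with ω hω
  rw [mem_limsup_iff_frequently_mem] at hω
  refine hω.mono fun j hj => ?_
  simp only [hB] at hj
  split_ifs at hj with hg
  · exact blockSet_mono (min_le_left _ _) hj
  · exact hj.elim

end Recurrence

section Condensation

lemma summable_nat_mul_of_summable_condensed {h : ℕ → ℝ} (h0 : ∀ n, 0 ≤ h n)
    (hanti : ∀ n, 1 ≤ n → h (n + 1) ≤ h n)
    (hs : Summable fun j : ℕ => (25 : ℝ) ^ j * h (5 ^ (j + 1))) :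
    Summable fun n : ℕ => (n : ℝ) * h n := by
  have hmono : ∀ n k, 1 ≤ n → n ≤ k → h k ≤ h n := by
    intro n k hn hk
    induction k, hk using Nat.le_induction with
    | base => exact le_rfl
    | succ k hk ih => exact (hanti k (hn.trans hk)).trans ih
  have hs' : Summable fun j : ℕ => 20 * ((25 : ℝ) ^ j * h (5 ^ j)) := by
    refine Summable.mul_left 20 ((summable_nat_add_iff 1).1 ?_)
    refine (hs.mul_left 25).congr fun j => ?_
    rw [pow_succ]; ring
  have hblock : ∀ j : ℕ, ∑ n ∈ (Finset.Ico (5 ^ j) (5 ^ (j + 1)) : Finset ℕ), (n : ℝ) * h n ≤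
      20 * ((25 : ℝ) ^ j * h (5 ^ j)) := by
    intro j
    have h5 : 1 ≤ 5 ^ j := Nat.one_le_pow _ _ (by norm_num)
    have := Finset.sum_le_card_nsmul (Finset.Ico (5 ^ j) (5 ^ (j + 1)) : Finset ℕ) (fun n => (n : ℝ) * h n)
      (5 ^ (j + 1) * h (5 ^ j)) fun n hn => by
        rw [Finset.mem_Ico] at hn
        have : (n : ℝ) ≤ 5 ^ (j + 1) := by exact_mod_cast hn.2.le
        exact mul_le_mul this (hmono _ _ h5 hn.1) (h0 _) (by positivity)
    refine this.trans (le_of_eq ?_)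
    have hc : 5 ^ (j + 1) - 5 ^ j = 4 * 5 ^ j := by rw [pow_succ]; omega
    rw [Nat.card_Ico, hc, nsmul_eq_mul, show (25 : ℝ) = 5 * 5 by norm_num, mul_pow]
    push_cast; ring
  have hpart : ∀ J : ℕ, ∑ n ∈ Finset.range (5 ^ J), (n : ℝ) * h n ≤
      ∑ j ∈ Finset.range J, 20 * ((25 : ℝ) ^ j * h (5 ^ j)) := by
    intro J
    induction J with
    | zero => simp
    | succ J ih =>
      rw [Finset.sum_range_succ, ← Finset.sum_range_add_sum_Ico _
        (Nat.pow_le_pow_right (by norm_num) (Nat.le_succ J) : 5 ^ J ≤ 5 ^ (J + 1))]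
      exact add_le_add ih (hblock J)
  refine summable_of_sum_range_le (c := ∑' j, 20 * ((25 : ℝ) ^ j * h (5 ^ j)))
    (fun n => mul_nonneg n.cast_nonneg (h0 n)) fun n => ?_
  calc _ ≤ ∑ i ∈ Finset.range (5 ^ n), (i : ℝ) * h i :=
        Finset.sum_le_sum_of_subset_of_nonneg
          (Finset.range_subset_range.2 (Nat.lt_pow_self (by norm_num)).le)
          fun i _ _ => mul_nonneg i.cast_nonneg (h0 i)
    _ ≤ _ := hpart n
    _ ≤ _ := hs'.sum_le_tsum _ fun j _ => by have := h0 (5 ^ j); positivity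

end Condensation

section CodedIFS

/-- The map `φ_{σ_0} ∘ ⋯ ∘ φ_{σ_{n-1}}`. -/
def prefixMap {A E : Type*} (φ : A → E → E) (σ : ℕ → A) (n : ℕ) : E → E :=
  iterMap φ (fun i : Fin n => σ i)

/-- The contraction ratio of `prefixMap φ σ n`. -/
def prefixRatio {A : Type*} (r : A → ℝ) (σ : ℕ → A) (n : ℕ) : ℝ :=
  ∏ i ∈ Finset.range n, r (σ i)

lemma prefixMap_zero {A E : Type*} (φ : A → E → E) (σ : ℕ → A) : prefixMap φ σ 0 = id := by
  simp [prefixMap, iterMap]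

lemma prefixMap_succ {A E : Type*} (φ : A → E → E) (σ : ℕ → A) (n : ℕ) :
    prefixMap φ σ (n + 1) = prefixMap φ σ n ∘ φ (σ n) := by
  have key : ∀ (l : List (E → E)) (h : E → E),
      l.foldr (· ∘ ·) h = l.foldr (· ∘ ·) id ∘ h := by
    intro l h
    induction l with
    | nil => rfl
    | cons a l ih => simp only [List.foldr_cons]; rw [ih, Function.comp_assoc]
  simp only [prefixMap, iterMap]
  rw [List.ofFn_succ', List.concat_eq_append, List.foldr_append, List.foldr_cons, List.foldr_nil,
    key]
  simp

lemma prefixMap_congr {A E : Type*} (φ : A → E → E) {σ τ : ℕ → A} {n : ℕ}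
    (h : τ ∈ PiNat.cylinder σ n) : prefixMap φ τ n = prefixMap φ σ n := by
  unfold prefixMap
  congr 1
  funext i
  exact h i i.2

lemma prefixRatio_congr {A : Type*} (r : A → ℝ) {σ τ : ℕ → A} {n : ℕ}
    (h : τ ∈ PiNat.cylinder σ n) : prefixRatio r τ n = prefixRatio r σ n :=
  Finset.prod_congr rfl fun i hi => by rw [h i (Finset.mem_range.1 hi)]

lemma prefixRatio_zero {A : Type*} (r : A → ℝ) (σ : ℕ → A) : prefixRatio r σ 0 = 1 := by
  simp [prefixRatio]

lemma prefixRatio_succ {A : Type*} (r : A → ℝ) (σ : ℕ → A) (n : ℕ) :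
    prefixRatio r σ (n + 1) = prefixRatio r σ n * r (σ n) := Finset.prod_range_succ _ _

lemma prefixRatio_add {A : Type*} (r : A → ℝ) (σ : ℕ → A) (n k : ℕ) :
    prefixRatio r σ (n + k) = prefixRatio r σ n * ∏ i ∈ Finset.range k, r (σ (n + i)) :=
  Finset.prod_range_add _ _ _

/-- An iterated function system of similarities `φ` with ratios `r`, attractor `X`, coding map `π`,
similarity dimension `s` and the associated probability `m` on the alphabet. -/
structure CodedIFS {d : ℕ} {A : Type*} [Fintype A] [MeasurableSpace A]
    (φ : A → EuclideanSpace ℝ (Fin d) → EuclideanSpace ℝ (Fin d)) (r : A → ℝ)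
    (X : Set (EuclideanSpace ℝ (Fin d))) (π : (ℕ → A) → EuclideanSpace ℝ (Fin d)) (s : ℝ)
    (m : Measure A) : Prop where
  ratio_pos : ∀ a, 0 < r a
  ratio_lt_one : ∀ a, r a < 1
  norm_sub : ∀ a x y, ‖φ a x - φ a y‖ = r a * ‖x - y‖
  isCompact : IsCompact X
  eq_iUnion : X = ⋃ a, φ a '' X
  coding : ∀ (σ : ℕ → A) (n : ℕ), π σ ∈ iterMap φ (fun i : Fin n => σ i) '' X
  dim_pos : 0 < s
  sum_rpow : ∑ a, r a ^ s = 1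
  diam_pos : 0 < Metric.diam X
  measureReal_singleton : ∀ a, m.real {a} = r a ^ s

namespace CodedIFS

variable {d : ℕ} {A : Type*} [Fintype A] [MeasurableSpace A] [MeasurableSingletonClass A]
  [TopologicalSpace A] [DiscreteTopology A]
  {φ : A → EuclideanSpace ℝ (Fin d) → EuclideanSpace ℝ (Fin d)} {r : A → ℝ}
  {X : Set (EuclideanSpace ℝ (Fin d))} {π : (ℕ → A) → EuclideanSpace ℝ (Fin d)} {s : ℝ}
  {m : Measure A} [IsProbabilityMeasure m] (h : CodedIFS φ r X π s m)

include h

lemma nonempty_attractor : X.Nonempty := by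
  by_contra hX
  rw [Set.not_nonempty_iff_eq_empty] at hX
  have := h.diam_pos
  simp [hX] at this

lemma nonempty_alphabet : Nonempty A := by
  obtain ⟨x, hx⟩ := h.nonempty_attractor
  rw [h.eq_iUnion, mem_iUnion] at hx
  exact ⟨hx.choose⟩

lemma exists_ratio_bounds : ∃ r₀ r₁ : ℝ, 0 < r₀ ∧ r₁ < 1 ∧ ∀ a, r₀ ≤ r a ∧ r a ≤ r₁ := by
  have := h.nonempty_alphabet
  obtain ⟨a, ha⟩ := Finite.exists_min r
  obtain ⟨b, hb⟩ := Finite.exists_max r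
  exact ⟨r a, r b, h.ratio_pos a, h.ratio_lt_one b, fun c => ⟨ha c, hb c⟩⟩

lemma prefixRatio_pos (σ : ℕ → A) (n : ℕ) : 0 < prefixRatio r σ n :=
  Finset.prod_pos fun _ _ => h.ratio_pos _

lemma prefixRatio_succ_lt (σ : ℕ → A) (n : ℕ) : prefixRatio r σ (n + 1) < prefixRatio r σ n := by
  rw [prefixRatio_succ]
  exact mul_lt_of_lt_one_right (h.prefixRatio_pos σ n) (h.ratio_lt_one _)

lemma prefixRatio_antitone (σ : ℕ → A) : Antitone (prefixRatio r σ) :=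
  antitone_nat_of_succ_le fun n => (h.prefixRatio_succ_lt σ n).le

lemma prefixRatio_le_pow {r₁ : ℝ} (hr₁ : ∀ a, r a ≤ r₁) (σ : ℕ → A) (n : ℕ) :
    prefixRatio r σ n ≤ r₁ ^ n := by
  simpa [prefixRatio] using Finset.prod_le_prod (s := Finset.range n) (f := fun i => r (σ i))
    (g := fun _ => r₁) (fun _ _ => (h.ratio_pos _).le) (fun i _ => hr₁ (σ i))

lemma pow_le_prefixRatio {r₀ : ℝ} (h₀ : 0 ≤ r₀) (hr₀ : ∀ a, r₀ ≤ r a) (σ : ℕ → A) (n : ℕ) :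
    r₀ ^ n ≤ prefixRatio r σ n := by
  simpa [prefixRatio] using Finset.prod_le_prod (s := Finset.range n) (f := fun _ => r₀)
    (g := fun i => r (σ i)) (fun _ _ => h₀) (fun i _ => hr₀ (σ i))

/-- Prefix ratios tend to zero uniformly. -/
lemma exists_prefixRatio_lt {ε : ℝ} (hε : 0 < ε) :
    ∃ N, ∀ n, N ≤ n → ∀ σ : ℕ → A, prefixRatio r σ n < ε := by
  obtain ⟨r₀, r₁, h0, h1, hr⟩ := h.exists_ratio_bounds
  have hnn : 0 ≤ r₁ := by
    obtain ⟨a⟩ := h.nonempty_alphabet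
    linarith [(hr a).1, (hr a).2]
  obtain ⟨N, hN⟩ := exists_pow_lt_of_lt_one hε h1
  exact ⟨N, fun n hn σ => ((h.prefixRatio_antitone σ hn).trans
    (h.prefixRatio_le_pow (fun a => (hr a).2) σ N)).trans_lt hN⟩

lemma norm_prefixMap_sub (σ : ℕ → A) (n : ℕ) (x y : EuclideanSpace ℝ (Fin d)) :
    ‖prefixMap φ σ n x - prefixMap φ σ n y‖ = prefixRatio r σ n * ‖x - y‖ := by
  induction n generalizing x y with
  | zero => simp [prefixMap_zero, prefixRatio_zero]
  | succ n ih =>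
    rw [prefixMap_succ, prefixRatio_succ, Function.comp_apply, Function.comp_apply, ih,
      h.norm_sub, mul_assoc]

lemma continuous_prefixMap (σ : ℕ → A) (n : ℕ) : Continuous (prefixMap φ σ n) := by
  refine (LipschitzWith.of_dist_le_mul (K := (prefixRatio r σ n).toNNReal) fun x y => ?_).continuous
  rw [dist_eq_norm, dist_eq_norm, h.norm_prefixMap_sub,
    Real.coe_toNNReal _ (h.prefixRatio_pos σ n).le]

lemma diam_prefixMap_image (σ : ℕ → A) (n : ℕ) :
    Metric.diam (prefixMap φ σ n '' X) = prefixRatio r σ n * Metric.diam X := by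
  have hR := h.prefixRatio_pos σ n
  apply le_antisymm
  · refine Metric.diam_le_of_forall_dist_le (mul_nonneg hR.le Metric.diam_nonneg) ?_
    rintro _ ⟨x, hx, rfl⟩ _ ⟨y, hy, rfl⟩
    rw [dist_eq_norm, h.norm_prefixMap_sub, ← dist_eq_norm]
    exact mul_le_mul_of_nonneg_left (dist_le_diam_of_mem h.isCompact.isBounded hx hy) hR.le
  · rw [mul_comm, ← le_div_iff₀ hR]
    refine Metric.diam_le_of_forall_dist_le (div_nonneg Metric.diam_nonneg hR.le) ?_
    intro x hx y hy
    rw [le_div_iff₀ hR, mul_comm, dist_eq_norm, ← h.norm_prefixMap_sub, ← dist_eq_norm]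
    exact dist_le_diam_of_mem (h.isCompact.image (h.continuous_prefixMap σ n)).isBounded
      (mem_image_of_mem _ hx) (mem_image_of_mem _ hy)

lemma exists_extension {n : ℕ} (a : Fin n → A) :
    ∃ σ : ℕ → A, a = fun i : Fin n => σ i := by
  obtain ⟨b⟩ := h.nonempty_alphabet
  exact ⟨fun i => if hi : i < n then a ⟨i, hi⟩ else b, by ext i; simp⟩

lemma diam_iterMap_image {n : ℕ} (a : Fin n → A) :
    Metric.diam (iterMap φ a '' X) = (∏ i, r (a i)) * Metric.diam X := by
  obtain ⟨σ, rfl⟩ := h.exists_extension a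
  rw [Fin.prod_univ_eq_prod_range (fun i => r (σ i)) n]
  exact h.diam_prefixMap_image σ n

lemma sum_prod_rpow (n : ℕ) : ∑ a : Fin n → A, (∏ i, r (a i)) ^ s = 1 := by
  have : ∀ a : Fin n → A, (∏ i, r (a i)) ^ s = ∏ i, r (a i) ^ s := fun a =>
    (Real.finsetProd_rpow _ _ (fun i _ => (h.ratio_pos _).le) _).symm
  simp only [this]
  rw [← Fintype.sum_pow (fun a => r a ^ s), h.sum_rpow, one_pow]

lemma sum_mul_diam_rpow {n : ℕ} {x : ℝ} (hx : 0 ≤ x) :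
    ∑ a : Fin n → A, (n : ℝ) * (Metric.diam (iterMap φ a '' X) * x) ^ s =
      Metric.diam X ^ s * (n * x ^ s) := by
  have : ∀ a : Fin n → A, (n : ℝ) * (Metric.diam (iterMap φ a '' X) * x) ^ s =
      (∏ i, r (a i)) ^ s * (Metric.diam X ^ s * (n * x ^ s)) := by
    intro a
    have hp : 0 ≤ ∏ i, r (a i) := Finset.prod_nonneg fun _ _ => (h.ratio_pos _).le
    rw [h.diam_iterMap_image, Real.mul_rpow (mul_nonneg hp Metric.diam_nonneg) hx,
      Real.mul_rpow hp Metric.diam_nonneg]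
    ring
  simp only [this]
  rw [← Finset.sum_mul, h.sum_prod_rpow, one_mul]

lemma norm_coding_sub_le {σ τ : ℕ → A} {n : ℕ} (hτ : τ ∈ PiNat.cylinder σ n) :
    ‖π σ - π τ‖ ≤ prefixRatio r σ n * Metric.diam X := by
  obtain ⟨x, hx, hx'⟩ := h.coding σ n
  obtain ⟨y, hy, hy'⟩ := h.coding τ n
  change prefixMap φ σ n x = _ at hx'
  change prefixMap φ τ n y = _ at hy'
  rw [prefixMap_congr φ hτ] at hy'
  rw [← hx', ← hy', h.norm_prefixMap_sub, ← dist_eq_norm]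
  exact mul_le_mul_of_nonneg_left (dist_le_diam_of_mem h.isCompact.isBounded hx hy)
    (h.prefixRatio_pos σ n).le

lemma continuous_coding : Continuous π := by
  rw [continuous_iff_continuousAt]
  intro σ
  rw [ContinuousAt, Metric.tendsto_nhds]
  intro ε hε
  obtain ⟨N, hN⟩ := h.exists_prefixRatio_lt (div_pos hε h.diam_pos)
  have : PiNat.cylinder σ N ∈ nhds σ :=
    (PiNat.isOpen_cylinder (fun _ : ℕ => A) σ N).mem_nhds (PiNat.self_mem_cylinder σ N)
  filter_upwards [this] with τ hτ
  rw [dist_comm, dist_eq_norm]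
  exact (h.norm_coding_sub_le hτ).trans_lt ((lt_div_iff₀ h.diam_pos).1 (hN N le_rfl σ))

lemma coding_mem (σ : ℕ → A) : π σ ∈ X := by
  obtain ⟨x, hx, hx'⟩ := h.coding σ 0
  change prefixMap φ σ 0 x = _ at hx'
  rw [prefixMap_zero] at hx'
  rwa [← hx']

lemma range_coding : range π = X := by
  refine Subset.antisymm (range_subset_iff.2 h.coding_mem) fun x hx => ?_
  have hstep : ∀ y : X, ∃ a : A, ∃ z : X, φ a z = y := by
    rintro ⟨y, hy⟩
    have hy' := hy
    rw [h.eq_iUnion] at hy'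
    obtain ⟨a, z, hz, e⟩ := mem_iUnion.1 hy'
    exact ⟨a, ⟨z, hz⟩, e⟩
  choose ca cz hc using hstep
  set pts : ℕ → X := fun n => cz^[n] ⟨x, hx⟩ with hpts
  set σ : ℕ → A := fun n => ca (pts n) with hσ
  have hx_eq : ∀ n, prefixMap φ σ n (pts n) = x := by
    intro n
    induction n with
    | zero => simp [prefixMap_zero, hpts]
    | succ n ih =>
      have : φ (σ n) (pts (n + 1)) = pts n := by
        simp only [hpts, Function.iterate_succ_apply']; exact hc _
      rw [prefixMap_succ, Function.comp_apply, this, ih]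
  refine ⟨σ, ?_⟩
  by_contra hne
  have hpos : 0 < ‖π σ - x‖ := norm_pos_iff.2 (sub_ne_zero.2 hne)
  obtain ⟨N, hN⟩ := h.exists_prefixRatio_lt (div_pos hpos h.diam_pos)
  have h1 := (lt_div_iff₀ h.diam_pos).1 (hN N le_rfl σ)
  obtain ⟨y, hy, hy'⟩ := h.coding σ N
  change prefixMap φ σ N y = _ at hy'
  have h2 : ‖π σ - x‖ ≤ prefixRatio r σ N * Metric.diam X := by
    rw [← hy', ← hx_eq N, h.norm_prefixMap_sub, ← dist_eq_norm]
    exact mul_le_mul_of_nonneg_left (dist_le_diam_of_mem h.isCompact.isBounded hy (pts N).2)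
      (h.prefixRatio_pos σ N).le
  linarith

lemma measure_cylinder (σ : ℕ → A) (n : ℕ) :
    bernoulliMeasure m (PiNat.cylinder σ n) = ENNReal.ofReal (prefixRatio r σ n ^ s) := by
  have h1 := bernoulliMeasure_box m 0 n σ
  simp only [zero_add] at h1
  change (bernoulliMeasure m).real (PiNat.cylinder σ n) = _ at h1
  rw [← ofReal_measureReal (measure_ne_top _ _), h1, prefixRatio,
    ← Real.finsetProd_rpow _ _ (fun i _ => (h.ratio_pos _).le)]
  simp only [h.measureReal_singleton]

end CodedIFS

lemma evp_mem_cylinder {A : Type*} {ω : ℕ → A} {n l k : ℕ} (hl : l < n) (hk : k ≤ n - l)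
    (heq : ∀ i < k, ω (n + i) = ω (l + i)) :
    evp (fun i : Fin n => ω i) l hl ∈ PiNat.cylinder ω (n + k) := by
  intro i hi
  simp only [evp]
  split_ifs with hil
  · rfl
  · rcases lt_or_ge i n with hin | hin
    · rw [Nat.mod_eq_of_lt (by omega), Nat.add_sub_cancel' (not_lt.1 hil)]
    · have e : (i - l) % (n - l) = (i - n) % (n - l) := by
        rw [show i - l = (i - n) + (n - l) by omega, Nat.add_mod_right]
      rw [e]
      rcases lt_or_ge (i - n) (n - l) with h2 | h2
      · rw [Nat.mod_eq_of_lt h2, ← heq (i - n) (by omega), Nat.add_sub_cancel' hin]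
      · omega

namespace CodedIFS

variable {d : ℕ} {A : Type*} [Fintype A] [MeasurableSpace A] [MeasurableSingletonClass A]
  [TopologicalSpace A] [DiscreteTopology A]
  {φ : A → EuclideanSpace ℝ (Fin d) → EuclideanSpace ℝ (Fin d)} {r : A → ℝ}
  {X : Set (EuclideanSpace ℝ (Fin d))} {π : (ℕ → A) → EuclideanSpace ℝ (Fin d)} {s : ℝ}
  {m : Measure A} [IsProbabilityMeasure m]

/-- For almost every sequence `ω` there are infinitely many `n` such that some eventually periodic
extension of `ω|_n` agrees with `ω` on a long word. -/
theorem ae_frequently_evp_mem_cylinder (h : CodedIFS φ r X π s m) {g : ℕ → ℝ} (hg0 : ∀ n, 0 ≤ g n)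
    (hanti : ∀ n, 1 ≤ n → g (n + 1) ≤ g n) (hdiv : ¬ Summable fun n : ℕ => (n : ℝ) * g n ^ s) :
    ∀ᵐ ω ∂bernoulliMeasure m, ∀ δ : ℝ, 0 < δ → ∃ᶠ n in atTop, ∃ l, ∃ hl : l < n, ∃ k,
      evp (fun i : Fin n => ω i) l hl ∈ PiNat.cylinder ω (n + k) ∧
      prefixRatio r ω (n + k) < prefixRatio r ω n * (δ * g n) := by
  obtain ⟨r₀, r₁, hr0, hr1, hr⟩ := h.exists_ratio_bounds
  obtain ⟨a₀⟩ := h.nonempty_alphabet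
  have hr1' : 0 ≤ r₁ := by linarith [(hr a₀).1, (hr a₀).2]
  have hs := h.dim_pos
  have hmono : ∀ n k, 1 ≤ n → n ≤ k → g k ≤ g n := by
    intro n k hn hk
    induction k, hk using Nat.le_induction with
    | base => exact le_rfl
    | succ k hk ih => exact (hanti k (hn.trans hk)).trans ih
  have hcond : ∀ δ : ℝ, 0 < δ →
      ¬ Summable fun j : ℕ => (25 : ℝ) ^ j * (δ * g (5 ^ (j + 1))) ^ s := by
    intro δ hδ hsum
    refine hdiv (summable_nat_mul_of_summable_condensed (fun n => Real.rpow_nonneg (hg0 n) _)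
      (fun n hn => Real.rpow_le_rpow (hg0 _) (hanti n hn) hs.le) ?_)
    have hδs : δ ^ s ≠ 0 := (Real.rpow_pos_of_pos hδ s).ne'
    refine (summable_mul_left_iff hδs).1 (hsum.congr fun j => ?_)
    rw [Real.mul_rpow hδ.le (hg0 _)]; ring
  have hae : ∀ q : ℕ, ∀ᵐ ω ∂bernoulliMeasure m, ∃ᶠ j in atTop,
      ω ∈ blockSet m (5 ^ j) ((1 / (q + 1 : ℝ) * g (5 ^ (j + 1))) ^ s) := fun q =>
    ae_frequently_mem_blockSet (ρ := r₁ ^ s) (p₀ := r₀ ^ s)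
      (fun a => by
        rw [h.measureReal_singleton]
        exact Real.rpow_le_rpow (h.ratio_pos a).le (hr a).2 hs.le)
      (Real.rpow_nonneg hr1' _) (Real.rpow_lt_one hr1' hr1 hs) (Real.rpow_pos_of_pos hr0 _)
      (fun a => by
        rw [h.measureReal_singleton]
        exact Real.rpow_le_rpow hr0.le (hr a).1 hs.le)
      (fun j => Real.rpow_nonneg (mul_nonneg (by positivity) (hg0 _)) _)
      (hcond _ (by positivity))
  filter_upwards [ae_all_iff.2 hae] with ω hω δ hδ
  obtain ⟨q, hq⟩ := exists_nat_one_div_lt hδ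
  rw [frequently_atTop]
  intro N
  obtain ⟨j, hjN, hj⟩ := frequently_atTop.1 (hω q) N
  simp only [blockSet, mem_iUnion, exists_prop] at hj
  obtain ⟨⟨l, n⟩, hln, k, hk, heq, hprod⟩ := hj
  simp only [Finset.mem_product, Finset.mem_Ico] at hln
  have hjlt : j < 5 ^ j := Nat.lt_pow_self (by norm_num)
  have hn : n ≤ 5 ^ (j + 1) := by rw [pow_succ]; omega
  dsimp only at heq hprod hln
  refine ⟨n, by omega, l, by omega, k, evp_mem_cylinder _ (by omega) heq, ?_⟩
  rw [prefixRatio_add]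
  refine mul_lt_mul_of_pos_left ?_ (h.prefixRatio_pos ω n)
  simp only [h.measureReal_singleton] at hprod
  rw [Real.finsetProd_rpow _ _ (fun i _ => (h.ratio_pos _).le),
    Real.rpow_lt_rpow_iff (Finset.prod_nonneg fun _ _ => (h.ratio_pos _).le)
      (mul_nonneg (by positivity) (hg0 _)) hs] at hprod
  rw [Finset.prod_congr rfl fun i hi => by rw [heq i (Finset.mem_range.1 hi)]]
  refine hprod.trans_le ?_
  exact mul_le_mul hq.le (hmono _ _ (by omega) hn) (hg0 _) hδ.le

end CodedIFS

end CodedIFS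

section OpenSetCondition

/-- The open set condition for `φ`. -/
def OpenSetCondition {A E : Type*} [PseudoMetricSpace E] (φ : A → E → E) : Prop :=
  ∃ O : Set E, O.Nonempty ∧ IsOpen O ∧ Bornology.IsBounded O ∧ (∀ a, φ a '' O ⊆ O) ∧
    ∀ a b, a ≠ b → Disjoint (φ a '' O) (φ b '' O)

namespace CodedIFS

variable {d : ℕ} {A : Type*} [Fintype A] [MeasurableSpace A] [MeasurableSingletonClass A]
  [TopologicalSpace A] [DiscreteTopology A]
  {φ : A → EuclideanSpace ℝ (Fin d) → EuclideanSpace ℝ (Fin d)} {r : A → ℝ}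
  {X : Set (EuclideanSpace ℝ (Fin d))} {π : (ℕ → A) → EuclideanSpace ℝ (Fin d)} {s : ℝ}
  {m : Measure A} [IsProbabilityMeasure m] (h : CodedIFS φ r X π s m)

lemma prefixMap_image_subset {O : Set (EuclideanSpace ℝ (Fin d))} (hO : ∀ a, φ a '' O ⊆ O)
    (σ : ℕ → A) {k n : ℕ} (hkn : k ≤ n) : prefixMap φ σ n '' O ⊆ prefixMap φ σ k '' O := by
  induction n, hkn using Nat.le_induction with
  | base => exact Subset.rfl
  | succ n hn ih =>
    rw [prefixMap_succ, image_comp]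
    exact (image_mono (hO _)).trans ih

include h

lemma exists_cut {r₀ : ℝ} (hr₀ : ∀ a, r₀ ≤ r a) (h₀ : r₀ ≤ 1) {ρ : ℝ} (hρ : 0 < ρ) (hρ1 : ρ ≤ 1)
    (σ : ℕ → A) :
    ∃ n, prefixRatio r σ n ≤ ρ ∧ r₀ * ρ ≤ prefixRatio r σ n ∧
      ∀ k < n, ρ < prefixRatio r σ k := by
  classical
  have hex : ∃ n, prefixRatio r σ n ≤ ρ :=
    (h.exists_prefixRatio_lt hρ).imp fun N hN => (hN N le_rfl σ).le
  have hmin : ∀ k < Nat.find hex, ρ < prefixRatio r σ k :=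
    fun k hk => not_le.1 (Nat.find_min hex hk)
  refine ⟨Nat.find hex, Nat.find_spec hex, ?_, hmin⟩
  rcases hk : Nat.find hex with _ | k
  · rw [prefixRatio_zero]; nlinarith
  · rw [prefixRatio_succ, mul_comm]
    nlinarith [hmin k (by omega), hr₀ (σ k), h.ratio_pos (σ k)]

lemma prefixMap_injective (σ : ℕ → A) (n : ℕ) : Function.Injective (prefixMap φ σ n) := by
  intro x y hxy
  have := h.norm_prefixMap_sub σ n x y
  rw [hxy, sub_self, norm_zero, zero_eq_mul] at this
  exact sub_eq_zero.1 (norm_eq_zero.1 (this.resolve_left (h.prefixRatio_pos σ n).ne'))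

lemma disjoint_prefixMap_image {O : Set (EuclideanSpace ℝ (Fin d))} (hO : ∀ a, φ a '' O ⊆ O)
    (hO' : ∀ a b, a ≠ b → Disjoint (φ a '' O) (φ b '' O)) {σ τ : ℕ → A} {n k : ℕ}
    (h1 : τ ∉ PiNat.cylinder σ n) (h2 : σ ∉ PiNat.cylinder τ k) :
    Disjoint (prefixMap φ σ n '' O) (prefixMap φ τ k '' O) := by
  classical
  have hne : σ ≠ τ := by rintro rfl; exact h1 (PiNat.self_mem_cylinder _ _)
  set i := PiNat.firstDiff σ τ with hi
  have hin : i < n := by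
    by_contra hlt
    refine h1 fun j hj => (PiNat.apply_eq_of_lt_firstDiff (x := σ) (y := τ) (by omega)).symm
  have hik : i < k := by
    by_contra hlt
    refine h2 fun j hj => PiNat.apply_eq_of_lt_firstDiff (x := σ) (y := τ) (by omega)
  refine Disjoint.mono (prefixMap_image_subset hO σ hin) (prefixMap_image_subset hO τ hik) ?_
  have hmem : τ ∈ PiNat.cylinder σ i :=
    fun j hj => (PiNat.apply_eq_of_lt_firstDiff (x := σ) (y := τ) hj).symm
  rw [prefixMap_succ, prefixMap_succ, prefixMap_congr φ hmem, image_comp, image_comp]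
  exact (Set.disjoint_image_iff (h.prefixMap_injective σ i)).2
    (hO' _ _ (PiNat.apply_firstDiff_ne hne))

/-- The codes of a set of diameter at most `ρ` are covered by boundedly many cylinders of ratio
comparable to `ρ`. -/
lemma exists_cover_cylinders (hosc : OpenSetCondition φ) :
    ∃ N : ℕ, ∀ ρ : ℝ, 0 < ρ → ρ ≤ 1 → ∀ U : Set (EuclideanSpace ℝ (Fin d)),
      (∀ x ∈ U, ∀ y ∈ U, dist x y ≤ ρ) → ∃ 𝒞 : Finset (Set (ℕ → A)), 𝒞.card ≤ N ∧
        π ⁻¹' U ⊆ ⋃ C ∈ 𝒞, C ∧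
        ∀ C ∈ 𝒞, ∃ σ n, C = PiNat.cylinder σ n ∧ prefixRatio r σ n ≤ ρ := by
  classical
  obtain ⟨O, ⟨o₀, ho₀⟩, hOo, hOb, hO, hO'⟩ := hosc
  obtain ⟨r₀, r₁, hr0, hr1, hr⟩ := h.exists_ratio_bounds
  have hr01 : r₀ ≤ 1 := by
    obtain ⟨a⟩ := h.nonempty_alphabet
    linarith [(hr a).1, (hr a).2]
  obtain ⟨D₀, hD₀⟩ := (hOb.union h.isCompact.isBounded).exists_norm_le
  have hD0 : 0 ≤ D₀ := (norm_nonneg _).trans (hD₀ o₀ (Or.inl ho₀))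

  set D := Module.finrank ℝ (EuclideanSpace ℝ (Fin d))
  set μ : Measure (EuclideanSpace ℝ (Fin d)) := μH[(D : ℝ)] with hμ
  have hOpos : μ O ≠ 0 := (hOo.measure_pos μ ⟨o₀, ho₀⟩).ne'
  set Q : ℝ≥0∞ := ENNReal.ofReal ((r₀⁻¹ * (1 + 2 * D₀)) ^ D) * μ (ball 0 1) with hQ
  have hQtop : Q ≠ ∞ := ENNReal.mul_ne_top ENNReal.ofReal_ne_top measure_ball_lt_top.ne
  obtain ⟨N, hN⟩ := ENNReal.exists_nat_mul_gt hOpos hQtop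
  refine ⟨N, fun ρ hρ hρ1 U hU => ?_⟩
  choose cut hcut1 hcut2 hcut3 using h.exists_cut (fun a => (hr a).1) hr01 hρ hρ1
  have hcut_le : ∀ σ τ, τ ∈ PiNat.cylinder σ (cut σ) → cut τ ≤ cut σ := by
    intro σ τ hτ
    by_contra hlt
    have := hcut3 τ (cut σ) (not_le.1 hlt)
    rw [prefixRatio_congr r hτ] at this
    linarith [hcut1 σ]
  have hcyl : ∀ σ τ, τ ∈ PiNat.cylinder σ (cut σ) →
      PiNat.cylinder σ (cut σ) = PiNat.cylinder τ (cut τ) := by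
    intro σ τ hτ
    have h1 := hcut_le σ τ hτ
    have h2 : σ ∈ PiNat.cylinder τ (cut τ) := by
      rw [PiNat.mem_cylinder_comm]; exact fun i hi => hτ i (hi.trans_le h1)
    have h3 := hcut_le τ σ h2
    rw [le_antisymm h1 h3]
    exact (PiNat.mem_cylinder_iff_eq.1 hτ).symm
  set 𝒞 : Set (Set (ℕ → A)) := (fun σ => PiNat.cylinder σ (cut σ)) '' (π ⁻¹' U) with h𝒞
  have hcard : ∀ t : Finset (Set (ℕ → A)), (t : Set (Set (ℕ → A))) ⊆ 𝒞 → t.card < N := by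
    intro t ht
    have hrep : ∀ C : t, ∃ σ, π σ ∈ U ∧ PiNat.cylinder σ (cut σ) = C := fun C => ht C.2
    choose rep hrepU hrepC using hrep
    rcases t.eq_empty_or_nonempty with rfl | ⟨C₀, hC₀⟩
    · rw [Finset.card_empty]
      rcases Nat.eq_zero_or_pos N with rfl | h
      · simp at hN
      · exact h
    set x₀ := π (rep ⟨C₀, hC₀⟩)
    have hdisj : Pairwise (Function.onFun Disjoint fun C : t =>
        prefixMap φ (rep C) (cut (rep C)) '' O) := by
      intro C C' hne
      refine h.disjoint_prefixMap_image hO hO' ?_ ?_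
      · intro hmem
        exact hne (Subtype.ext (by rw [← hrepC C, ← hrepC C']; exact hcyl _ _ hmem))
      · intro hmem
        exact hne (Subtype.ext (by rw [← hrepC C, ← hrepC C']; exact (hcyl _ _ hmem).symm))
    have hmeas : ∀ C : t, MeasurableSet (prefixMap φ (rep C) (cut (rep C)) '' O) := fun C =>
      hOo.measurableSet.image_of_continuousOn_injOn (h.continuous_prefixMap _ _).continuousOn
        (h.prefixMap_injective _ _).injOn
    have hsub : (⋃ C : t, prefixMap φ (rep C) (cut (rep C)) '' O) ⊆
        closedBall x₀ ((1 + 2 * D₀) * ρ) := by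
      refine iUnion_subset fun C => ?_
      rintro _ ⟨o, ho, rfl⟩
      obtain ⟨y, hy, hy'⟩ := h.coding (rep C) (cut (rep C))
      change prefixMap φ (rep C) (cut (rep C)) y = _ at hy'
      have e1 : dist (prefixMap φ (rep C) (cut (rep C)) o) (π (rep C)) ≤ ρ * (2 * D₀) := by
        rw [← hy', dist_eq_norm, h.norm_prefixMap_sub]
        refine mul_le_mul (hcut1 _) ?_ (norm_nonneg _) hρ.le
        linarith [norm_sub_le o y, hD₀ o (Or.inl ho), hD₀ y (Or.inr hy)]
      have e2 := hU _ (hrepU C) _ (hrepU ⟨C₀, hC₀⟩)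
      rw [mem_closedBall]
      linarith [dist_triangle (prefixMap φ (rep C) (cut (rep C)) o) (π (rep C)) x₀]
    have hrρ : 0 < r₀ * ρ := mul_pos hr0 hρ
    have hlow : ∀ C : t, μ O ≤ ENNReal.ofReal ((r₀ * ρ)⁻¹ ^ D) *
        μ (prefixMap φ (rep C) (cut (rep C)) '' O) := by
      intro C
      have hanti : AntilipschitzWith (Real.toNNReal (r₀ * ρ)⁻¹)
          (prefixMap φ (rep C) (cut (rep C))) := by
        refine AntilipschitzWith.of_le_mul_dist fun x y => ?_
        rw [Real.coe_toNNReal _ (inv_nonneg.2 hrρ.le), dist_eq_norm, dist_eq_norm,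
          h.norm_prefixMap_sub, inv_mul_eq_div, le_div_iff₀ hrρ, mul_comm]
        exact mul_le_mul_of_nonneg_right (hcut2 _) (norm_nonneg _)
      have := hanti.le_hausdorffMeasure_image (Nat.cast_nonneg D) O
      rw [ENNReal.rpow_natCast] at this
      rwa [ENNReal.ofReal_pow (inv_nonneg.2 hrρ.le)]
    have hfinal : (t.card : ℝ≥0∞) * μ O ≤ Q := by
      calc (t.card : ℝ≥0∞) * μ O = ∑ C : t, μ O := by simp
        _ ≤ ∑ C : t, ENNReal.ofReal ((r₀ * ρ)⁻¹ ^ D) *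
              μ (prefixMap φ (rep C) (cut (rep C)) '' O) := Finset.sum_le_sum fun C _ => hlow C
        _ = ENNReal.ofReal ((r₀ * ρ)⁻¹ ^ D) *
              μ (⋃ C : t, prefixMap φ (rep C) (cut (rep C)) '' O) := by
            rw [← Finset.mul_sum, measure_iUnion hdisj hmeas, tsum_fintype]
        _ ≤ ENNReal.ofReal ((r₀ * ρ)⁻¹ ^ D) * μ (closedBall x₀ ((1 + 2 * D₀) * ρ)) := by
            gcongr
        _ = Q := by
            rw [Measure.addHaar_closedBall _ _ (by positivity), ← mul_assoc,
              ← ENNReal.ofReal_mul (by positivity), hQ, ← mul_pow]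
            congr 3
            field_simp
    by_contra hle
    have : (N : ℝ≥0∞) * μ O ≤ t.card * μ O := by
      gcongr; exact not_lt.1 hle
    exact absurd (this.trans hfinal) (not_le.2 hN)
  have hfin : 𝒞.Finite := by
    by_contra hinf
    obtain ⟨t, ht, htc⟩ := Set.Infinite.exists_subset_card_eq hinf N
    exact absurd (hcard t ht) (by omega)
  refine ⟨hfin.toFinset, (hcard _ (by simp)).le, ?_, ?_⟩
  · intro σ hσ
    exact mem_biUnion (hfin.mem_toFinset.2 (mem_image_of_mem _ hσ)) (PiNat.self_mem_cylinder _ _)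
  · intro C hC
    obtain ⟨σ, -, rfl⟩ := hfin.mem_toFinset.1 hC
    exact ⟨σ, cut σ, rfl, hcut1 σ⟩

end CodedIFS

end OpenSetCondition

section MassDistribution

namespace CodedIFS

variable {d : ℕ} {A : Type*} [Fintype A] [MeasurableSpace A] [MeasurableSingletonClass A]
  [TopologicalSpace A] [DiscreteTopology A]
  {φ : A → EuclideanSpace ℝ (Fin d) → EuclideanSpace ℝ (Fin d)} {r : A → ℝ}
  {X : Set (EuclideanSpace ℝ (Fin d))} {π : (ℕ → A) → EuclideanSpace ℝ (Fin d)} {s : ℝ}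
  {m : Measure A} [IsProbabilityMeasure m] (h : CodedIFS φ r X π s m)

include h

lemma exists_forall_measure_preimage_le (hosc : OpenSetCondition φ) :
    ∃ N : ℕ, ∀ τ : ℝ, 0 < τ → ∀ m₀ : ℕ, ∃ ρ₀ : ℝ, 0 < ρ₀ ∧ ∀ ν : Measure (ℕ → A),
      (∀ σ q, m₀ ≤ q → ν (PiNat.cylinder σ q) ≤ ENNReal.ofReal (prefixRatio r σ q ^ τ)) →
      ∀ ρ, 0 < ρ → ρ ≤ ρ₀ → ∀ U : Set (EuclideanSpace ℝ (Fin d)),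
        (∀ x ∈ U, ∀ y ∈ U, dist x y ≤ ρ) → ν (π ⁻¹' U) ≤ N * ENNReal.ofReal (ρ ^ τ) := by
  obtain ⟨N, hN⟩ := h.exists_cover_cylinders hosc
  obtain ⟨r₀, r₁, hr0, hr1, hr⟩ := h.exists_ratio_bounds
  have hr01 : r₀ ≤ 1 := by
    obtain ⟨a⟩ := h.nonempty_alphabet
    linarith [(hr a).1, (hr a).2]
  refine ⟨N, fun τ hτ m₀ => ⟨r₀ ^ (m₀ + 1) / 2, by positivity, fun ν hν ρ hρ hρ0 U hU => ?_⟩⟩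
  have hp0 : 0 < r₀ ^ (m₀ + 1) := by positivity
  have hp1 : r₀ ^ (m₀ + 1) ≤ 1 := pow_le_one₀ hr0.le hr01
  obtain ⟨𝒞, hcard, hcov, h𝒞⟩ := hN ρ hρ (by linarith) U hU
  calc ν (π ⁻¹' U) ≤ ∑ C ∈ 𝒞, ν C := (measure_mono hcov).trans (measure_biUnion_finset_le _ _)
    _ ≤ ∑ C ∈ 𝒞, ENNReal.ofReal (ρ ^ τ) := by
        refine Finset.sum_le_sum fun C hC => ?_
        obtain ⟨σ, n, rfl, hn⟩ := h𝒞 C hC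
        refine (hν σ n ?_).trans (ENNReal.ofReal_le_ofReal
          (Real.rpow_le_rpow (h.prefixRatio_pos σ n).le hn hτ.le))
        by_contra hlt
        have h1 := h.pow_le_prefixRatio hr0.le (fun a => (hr a).1) σ n
        have h2 : r₀ ^ (m₀ + 1) ≤ r₀ ^ n := pow_le_pow_of_le_one hr0.le hr01 (by omega)
        linarith
    _ ≤ N * ENNReal.ofReal (ρ ^ τ) := by
        rw [Finset.sum_const, nsmul_eq_mul]
        gcongr

/-- A set of small diameter has an open neighbourhood with controlled mass. -/
lemma exists_open_measure_preimage_le (hosc : OpenSetCondition φ) :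
    ∃ N : ℕ, ∀ τ : ℝ, 0 < τ → ∀ m₀ : ℕ, ∃ ρ₀ : ℝ, 0 < ρ₀ ∧
      ∀ S : Set (EuclideanSpace ℝ (Fin d)), ediam S ≤ ENNReal.ofReal ρ₀ →
      ∀ ε : ℝ, 0 < ε → ∃ U, IsOpen U ∧ S ⊆ U ∧ ∀ ν : Measure (ℕ → A),
      (∀ σ q, m₀ ≤ q → ν (PiNat.cylinder σ q) ≤ ENNReal.ofReal (prefixRatio r σ q ^ τ)) →
        ν (π ⁻¹' U) ≤ N * ((⨆ _ : S.Nonempty, ediam S ^ τ) + ENNReal.ofReal ε) := by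
  obtain ⟨N, hN⟩ := h.exists_forall_measure_preimage_le hosc
  refine ⟨N, fun τ hτ m₀ => ?_⟩
  obtain ⟨ρ₀, hρ0, hν⟩ := hN τ hτ m₀
  refine ⟨ρ₀ / 2, by positivity, fun S hS ε hε => ?_⟩
  rcases S.eq_empty_or_nonempty with rfl | hne
  · exact ⟨∅, isOpen_empty, Subset.rfl, fun ν _ => by simp⟩
  have hSfin : ediam S ≠ ∞ := ne_top_of_le_ne_top ENNReal.ofReal_ne_top hS
  have hdle : Metric.diam S ≤ ρ₀ / 2 := ENNReal.toReal_le_of_le_ofReal (by positivity) hS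
  have hcont : ContinuousAt (fun x : ℝ => x ^ τ) (Metric.diam S) :=
    Real.continuousAt_rpow_const _ _ (Or.inr hτ.le)
  obtain ⟨η, hη, hη'⟩ := Metric.continuousAt_iff.1 hcont ε hε
  set η₁ := min (η / 4) (ρ₀ / 4) with hη₁
  have hη₁pos : 0 < η₁ := by positivity
  have hη₁a : η₁ ≤ η / 4 := min_le_left _ _
  have hη₁b : η₁ ≤ ρ₀ / 4 := min_le_right _ _
  refine ⟨Metric.thickening η₁ S, Metric.isOpen_thickening,
    Metric.self_subset_thickening hη₁pos S, fun ν hνc => ?_⟩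
  have hd0 : 0 ≤ Metric.diam S := Metric.diam_nonneg
  refine (hν ν hνc (Metric.diam S + 2 * η₁) (by linarith) (by linarith) _ ?_).trans ?_
  · intro x hx y hy
    rw [Metric.mem_thickening_iff] at hx hy
    obtain ⟨x', hx', hxx⟩ := hx
    obtain ⟨y', hy', hyy⟩ := hy
    have := Metric.dist_le_diam_of_mem (Metric.isBounded_iff_ediam_ne_top.2 hSfin) hx' hy'
    have t1 := dist_triangle4 x x' y' y
    rw [dist_comm y' y] at t1
    linarith
  · gcongr
    have h1 : (Metric.diam S + 2 * η₁) ^ τ ≤ Metric.diam S ^ τ + ε := by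
      have := hη' (x := Metric.diam S + 2 * η₁) (by
        rw [Real.dist_eq, add_sub_cancel_left, abs_of_pos (by linarith)]; linarith)
      rw [Real.dist_eq] at this
      linarith [le_abs_self ((Metric.diam S + 2 * η₁) ^ τ - Metric.diam S ^ τ)]
    rw [ciSup_pos hne]
    refine (ENNReal.ofReal_le_ofReal h1).trans ?_
    rw [ENNReal.ofReal_add (Real.rpow_nonneg hd0 _) hε.le,
      ← ENNReal.ofReal_rpow_of_nonneg hd0 hτ.le, Metric.diam, ENNReal.ofReal_toReal hSfin]

/-- A mass distribution principle for decreasing intersections of closed sets of codes, each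
carrying a measure with Frostman-type bounds on cylinders. -/
theorem exists_le_mul_hausdorffMeasure (hosc : OpenSetCondition φ) :
    ∃ N : ℕ, ∀ τ : ℝ, 0 < τ → ∀ m₀ : ℕ, ∀ K : ℕ → Set (ℕ → A), (∀ j, IsClosed (K j)) →
      Antitone K → ∀ (ν : ℕ → Measure (ℕ → A)) (c : ℝ≥0∞), (∀ j, c ≤ ν j (K j)) →
      (∀ j σ q, m₀ ≤ q → ν j (PiNat.cylinder σ q) ≤ ENNReal.ofReal (prefixRatio r σ q ^ τ)) →
      ∀ E : Set (EuclideanSpace ℝ (Fin d)), (∀ σ ∈ ⋂ j, K j, π σ ∈ E) →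
        c ≤ N * μH[τ] E := by
  obtain ⟨N, hN⟩ := h.exists_open_measure_preimage_le hosc
  refine ⟨N + 1, fun τ hτ m₀ K hK hKanti ν c hc hν E hE => ?_⟩
  obtain ⟨ρ₀, hρ0, hU⟩ := hN τ hτ m₀
  rw [Measure.hausdorffMeasure_apply, mul_comm, ← ENNReal.div_le_iff_le_mul (by simp) (by simp)]
  refine le_trans ?_ (le_iSup₂ (ENNReal.ofReal ρ₀) (ENNReal.ofReal_pos.2 hρ0))
  refine le_iInf₂ fun t ht => le_iInf fun htd => ?_
  rw [ENNReal.div_le_iff_le_mul (by simp) (by simp), mul_comm]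
  refine ENNReal.le_of_forall_pos_le_add fun ε hε _ => ?_
  obtain ⟨ε', hε'pos, hε'sum⟩ := ENNReal.exists_pos_sum_of_countable' (ε := (ε : ℝ≥0∞) / (N + 1))
    (by simpa using hε.ne') ℕ
  have hε'fin : ∀ i, ε' i ≠ ∞ := fun i => ((ENNReal.le_tsum i).trans_lt
    (hε'sum.trans_le le_top)).ne
  choose U hUo hUs hUν using fun i => hU (t i) (htd i) (ε' i).toReal
    (ENNReal.toReal_pos (hε'pos i).ne' (hε'fin i))
  have hopen : IsOpen (π ⁻¹' ⋃ i, U i) := (isOpen_iUnion hUo).preimage h.continuous_coding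
  obtain ⟨j, hj⟩ : ∃ j, K j ⊆ π ⁻¹' ⋃ i, U i := by
    refine exists_subset_nhds_of_isCompact (V := K) (directed_of_isDirected_le hKanti)
      (fun j => (hK j).isCompact) fun σ hσ => hopen.mem_nhds ?_
    obtain ⟨i, hi⟩ := mem_iUnion.1 (ht (hE σ hσ))
    exact mem_iUnion.2 ⟨i, hUs i hi⟩
  calc c ≤ ν j (K j) := hc j
    _ ≤ ν j (⋃ i, π ⁻¹' U i) := by rw [← preimage_iUnion]; exact measure_mono hj
    _ ≤ ∑' i, ν j (π ⁻¹' U i) := measure_iUnion_le _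
    _ ≤ ∑' i, ((N + 1 : ℕ) : ℝ≥0∞) * ((⨆ _ : (t i).Nonempty, ediam (t i) ^ τ) + ε' i) := by
        refine ENNReal.tsum_le_tsum fun i => (hUν i (ν j) (hν j)).trans ?_
        rw [ENNReal.ofReal_toReal (hε'fin i)]
        gcongr
        simp
    _ = (N + 1 : ℕ) * ∑' i, (⨆ _ : (t i).Nonempty, ediam (t i) ^ τ) +
          (N + 1 : ℕ) * ∑' i, ε' i := by
        rw [ENNReal.tsum_mul_left, ENNReal.tsum_add, mul_add]
    _ ≤ _ := by
        gcongr
        refine (mul_le_mul_right hε'sum.le _).trans ?_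
        push_cast
        exact ENNReal.mul_div_le

end CodedIFS

end MassDistribution

section Dimension

namespace CodedIFS

variable {d : ℕ} {A : Type*} [Fintype A] [MeasurableSpace A] [MeasurableSingletonClass A]
  [TopologicalSpace A] [DiscreteTopology A]
  {φ : A → EuclideanSpace ℝ (Fin d) → EuclideanSpace ℝ (Fin d)} {r : A → ℝ}
  {X : Set (EuclideanSpace ℝ (Fin d))} {π : (ℕ → A) → EuclideanSpace ℝ (Fin d)} {s : ℝ}
  {m : Measure A} [IsProbabilityMeasure m] (h : CodedIFS φ r X π s m)

include h

lemma hausdorffMeasure_ne_zero (hosc : OpenSetCondition φ) : μH[s] X ≠ 0 := by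
  obtain ⟨N, hN⟩ := h.exists_le_mul_hausdorffMeasure hosc
  have := hN s h.dim_pos 0 (fun _ => univ) (fun _ => isClosed_univ) antitone_const
    (fun _ => bernoulliMeasure m) 1 (fun _ => by simp)
    (fun _ σ q _ => (h.measure_cylinder σ q).le) X (fun σ _ => h.coding_mem σ)
  intro h0
  simp [h0] at this

lemma subset_iUnion_iterMap (n : ℕ) : X ⊆ ⋃ a : Fin n → A, iterMap φ a '' X := by
  intro x hx
  rw [← h.range_coding] at hx
  obtain ⟨σ, rfl⟩ := hx
  exact mem_iUnion.2 ⟨_, h.coding σ n⟩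

lemma ediam_iterMap_image {n : ℕ} (a : Fin n → A) :
    ediam (iterMap φ a '' X) = ENNReal.ofReal ((∏ i, r (a i)) * Metric.diam X) := by
  rw [← h.diam_iterMap_image, Metric.diam, ENNReal.ofReal_toReal]
  obtain ⟨σ, rfl⟩ := h.exists_extension a
  exact (h.isCompact.image (h.continuous_prefixMap σ n)).isBounded.ediam_ne_top

lemma hausdorffMeasure_ne_top : μH[s] X ≠ ∞ := by
  obtain ⟨r₀, r₁, hr0, hr1, hr⟩ := h.exists_ratio_bounds
  have hr1' : 0 ≤ r₁ := by
    obtain ⟨a⟩ := h.nonempty_alphabet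
    linarith [(hr a).1, (hr a).2]
  have hlim : Tendsto (fun n : ℕ => ENNReal.ofReal (r₁ ^ n * Metric.diam X)) atTop (nhds 0) := by
    rw [← ENNReal.ofReal_zero]
    refine ENNReal.tendsto_ofReal ?_
    simpa using (tendsto_pow_atTop_nhds_zero_of_lt_one hr1' hr1).mul_const (Metric.diam X)
  have := Measure.hausdorffMeasure_le_liminf_sum s X _ hlim
    (fun (n : ℕ) (a : Fin n → A) => iterMap φ a '' X)
    (Eventually.of_forall fun n a => by
      rw [h.ediam_iterMap_image]
      refine ENNReal.ofReal_le_ofReal (mul_le_mul_of_nonneg_right ?_ Metric.diam_nonneg)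
      simpa using Finset.prod_le_prod (s := Finset.univ) (f := fun i => r (a i))
        (g := fun _ => r₁) (fun _ _ => (h.ratio_pos _).le) (fun i _ => (hr _).2))
    (Eventually.of_forall fun n => h.subset_iUnion_iterMap n)
  refine ne_top_of_le_ne_top (b := ENNReal.ofReal (Metric.diam X ^ s)) ENNReal.ofReal_ne_top
    (this.trans (le_of_eq ?_))
  have hsum : ∀ n : ℕ, ∑ a : Fin n → A, ediam (iterMap φ a '' X) ^ s =
      ENNReal.ofReal (Metric.diam X ^ s) := by
    intro n
    have hp : ∀ a : Fin n → A, 0 ≤ ∏ i, r (a i) :=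
      fun a => Finset.prod_nonneg fun _ _ => (h.ratio_pos _).le
    have : ∀ a : Fin n → A, ediam (iterMap φ a '' X) ^ s =
        ENNReal.ofReal ((∏ i, r (a i)) ^ s * Metric.diam X ^ s) := fun a => by
      rw [h.ediam_iterMap_image, ENNReal.ofReal_rpow_of_nonneg
        (mul_nonneg (hp a) Metric.diam_nonneg) h.dim_pos.le,
        Real.mul_rpow (hp a) Metric.diam_nonneg]
    simp only [this]
    rw [← ENNReal.ofReal_sum_of_nonneg fun a _ => mul_nonneg (Real.rpow_nonneg (hp a) _)
      (Real.rpow_nonneg Metric.diam_nonneg _), ← Finset.sum_mul, h.sum_prod_rpow, one_mul]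
  simp only [hsum]
  exact liminf_const _

theorem dimH_eq (hosc : OpenSetCondition φ) : (dimH X).toReal = s := by
  have := dimH_of_hausdorffMeasure_ne_zero_ne_top (d := s.toNNReal) (s := X)
    (by rw [Real.coe_toNNReal _ h.dim_pos.le]; exact h.hausdorffMeasure_ne_zero hosc)
    (by rw [Real.coe_toNNReal _ h.dim_pos.le]; exact h.hausdorffMeasure_ne_top)
  rw [this, ENNReal.coe_toReal, Real.coe_toNNReal _ h.dim_pos.le]

lemma hausdorffMeasure_prefixMap_image_le (σ : ℕ → A) (n : ℕ) :
    μH[s] (prefixMap φ σ n '' X) ≤ bernoulliMeasure m (PiNat.cylinder σ n) * μH[s] X := by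
  have hR := h.prefixRatio_pos σ n
  have hL : LipschitzWith (prefixRatio r σ n).toNNReal (prefixMap φ σ n) :=
    LipschitzWith.of_dist_le_mul fun x y => by
      rw [dist_eq_norm, dist_eq_norm, h.norm_prefixMap_sub, Real.coe_toNNReal _ hR.le]
  refine (hL.hausdorffMeasure_image_le h.dim_pos.le X).trans (le_of_eq ?_)
  rw [h.measure_cylinder, ← ENNReal.ofReal_rpow_of_nonneg hR.le h.dim_pos.le, ENNReal.ofReal]

/-- The coding map sends an open set of codes to a set of comparable Hausdorff measure. -/
lemma hausdorffMeasure_image_le_of_isOpen {V : Set (ℕ → A)} (hV : IsOpen V) :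
    μH[s] (π '' V) ≤ bernoulliMeasure m V * μH[s] X := by
  classical
  set Vn : ℕ → Set (ℕ → A) := fun n => {σ | PiNat.cylinder σ n ⊆ V} with hVn
  have hmono : Monotone Vn := fun n k hnk σ hσ => (PiNat.cylinder_anti σ hnk).trans hσ
  have hU : V = ⋃ n, Vn n := by
    refine Subset.antisymm (fun σ hσ => ?_) (iUnion_subset fun n σ hσ =>
      hσ (PiNat.self_mem_cylinder _ _))
    obtain ⟨_, ⟨⟨τ, n, rfl⟩, hτ, hsub⟩⟩ :=
      (PiNat.isTopologicalBasis_cylinders (fun _ : ℕ => A)).exists_subset_of_mem_open hσ hV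
    refine mem_iUnion.2 ⟨n, ?_⟩
    change PiNat.cylinder σ n ⊆ V
    rwa [PiNat.mem_cylinder_iff_eq.1 hτ]
  have hn : ∀ n, μH[s] (π '' Vn n) ≤ bernoulliMeasure m V * μH[s] X := by
    intro n
    choose ext hext using fun a : Fin n → A => h.exists_extension a
    set T : Finset (Fin n → A) := Finset.univ.filter fun a => PiNat.cylinder (ext a) n ⊆ V with hT
    have hcov : π '' Vn n ⊆ ⋃ a ∈ T, prefixMap φ (ext a) n '' X := by
      rintro _ ⟨σ, hσ, rfl⟩
      have hmem : σ ∈ PiNat.cylinder (ext fun i : Fin n => σ i) n :=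
        fun i hi => congrFun (hext fun i : Fin n => σ i) ⟨i, hi⟩
      refine mem_biUnion (x := fun i : Fin n => σ i) ?_ ?_
      · simp only [hT, Finset.coe_filter, Finset.mem_univ, true_and, mem_ofPred_eq]
        rw [← PiNat.mem_cylinder_iff_eq.1 hmem]
        exact hσ
      · rw [← prefixMap_congr φ hmem]
        exact h.coding σ n
    have hdisj : (T : Set (Fin n → A)).PairwiseDisjoint fun a => PiNat.cylinder (ext a) n := by
      intro a _ b _ hab
      rw [Function.onFun, Set.disjoint_left]
      intro τ h1 h2
      refine hab ?_
      rw [hext a, hext b]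
      ext i
      rw [← h1 i i.2, h2 i i.2]
    calc μH[s] (π '' Vn n) ≤ ∑ a ∈ T, μH[s] (prefixMap φ (ext a) n '' X) :=
          (measure_mono hcov).trans (measure_biUnion_finset_le _ _)
      _ ≤ ∑ a ∈ T, bernoulliMeasure m (PiNat.cylinder (ext a) n) * μH[s] X :=
          Finset.sum_le_sum fun a _ => h.hausdorffMeasure_prefixMap_image_le _ _
      _ = bernoulliMeasure m (⋃ a ∈ T, PiNat.cylinder (ext a) n) * μH[s] X := by
          rw [measure_biUnion_finset hdisj fun a _ =>
            (PiNat.isOpen_cylinder (fun _ : ℕ => A) _ _).measurableSet, Finset.sum_mul]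
      _ ≤ bernoulliMeasure m V * μH[s] X := by
          gcongr
          exact iUnion₂_subset fun a ha => (Finset.mem_filter.1 ha).2
  have hunion : π '' V = ⋃ n, π '' Vn n := by rw [← image_iUnion, ← hU]
  rw [hunion, Monotone.measure_iUnion fun n k hnk => image_mono (hmono hnk)]
  exact iSup_le hn

lemma hausdorffMeasure_image_eq_zero {G : Set (ℕ → A)} (hG : bernoulliMeasure m G = 0) :
    μH[s] (π '' G) = 0 := by
  refine le_antisymm (ENNReal.le_of_forall_pos_le_add fun ε hε _ => ?_) zero_le
  have hX := h.hausdorffMeasure_ne_top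
  obtain ⟨V, hGV, hV, hlt⟩ := Set.exists_isOpen_lt_of_lt G (ε / (μH[s] X + 1))
    (μ := bernoulliMeasure m) (by
      rw [hG]
      exact ENNReal.div_pos (by simpa using hε.ne') (by simp [hX]))
  rw [zero_add]
  calc μH[s] (π '' G) ≤ bernoulliMeasure m V * μH[s] X :=
        (measure_mono (image_mono hGV)).trans (h.hausdorffMeasure_image_le_of_isOpen hV)
    _ ≤ ε / (μH[s] X + 1) * (μH[s] X + 1) := by
        gcongr
        exact le_self_add
    _ ≤ ε := by rw [mul_comm]; exact ENNReal.mul_div_le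

lemma hausdorffMeasure_eq_of_ae {W : Set (EuclideanSpace ℝ (Fin d))} (hW : W ⊆ X)
    (hae : ∀ᵐ ω ∂bernoulliMeasure m, π ω ∈ W) : μH[s] W = μH[s] X := by
  refine le_antisymm (measure_mono hW) ?_
  have h0 := h.hausdorffMeasure_image_eq_zero (ae_iff.1 hae)
  have hsub : X ⊆ W ∪ π '' {ω | π ω ∉ W} := by
    intro x hx
    by_cases hxW : x ∈ W
    · exact Or.inl hxW
    · rw [← h.range_coding] at hx
      obtain ⟨σ, rfl⟩ := hx
      exact Or.inr ⟨σ, hxW, rfl⟩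
  calc μH[s] X ≤ μH[s] W + μH[s] (π '' {ω | π ω ∉ W}) :=
        (measure_mono hsub).trans (measure_union_le _ _)
    _ = μH[s] W := by rw [h0, add_zero]

end CodedIFS

end Dimension

section MassTransference

lemma cylinder_subset_or_disjoint {A : Type*} {σ τ : ℕ → A} {n k : ℕ} (hnk : n ≤ k) :
    PiNat.cylinder τ k ⊆ PiNat.cylinder σ n ∨
      Disjoint (PiNat.cylinder τ k) (PiNat.cylinder σ n) := by
  by_cases hd : Disjoint (PiNat.cylinder τ k) (PiNat.cylinder σ n)
  · exact Or.inr hd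
  · left
    obtain ⟨x, hx1, hx2⟩ := Set.not_disjoint_iff.1 hd
    rw [← PiNat.mem_cylinder_iff_eq.1 hx1, ← PiNat.mem_cylinder_iff_eq.1 hx2]
    exact PiNat.cylinder_anti x hnk

lemma finite_setOf_cylinder {A : Type*} [Finite A] (L : ℕ) :
    {C : Set (ℕ → A) | ∃ σ k, k ≤ L ∧ C = PiNat.cylinder σ k}.Finite := by
  refine (Set.finite_range fun p : Fin (L + 1) × (Fin L → A) =>
    {τ : ℕ → A | ∀ i : Fin L, (i : ℕ) < p.1 → τ i = p.2 i}).subset ?_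
  rintro _ ⟨σ, k, hk, rfl⟩
  refine ⟨(⟨k, by omega⟩, fun i => σ i), ?_⟩
  ext τ
  exact ⟨fun hτ i hi => hτ ⟨i, by omega⟩ hi, fun hτ i hi => hτ i hi⟩

lemma exists_rpow_le_mul_rpow {τ s : ℝ} (hτs : τ < s) {δ : ℝ} (hδ : 0 < δ) :
    ∃ η : ℝ, 0 < η ∧ ∀ x, 0 < x → x < η → x ^ s ≤ δ * x ^ τ := by
  refine ⟨δ ^ (1 / (s - τ)), Real.rpow_pos_of_pos hδ _, fun x hx hxη => ?_⟩
  have hpos : 0 < s - τ := sub_pos.2 hτs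
  have h1 : x ^ (s - τ) ≤ δ := by
    have := Real.rpow_le_rpow hx.le hxη.le hpos.le
    rwa [← Real.rpow_mul hδ.le, one_div_mul_cancel hpos.ne', Real.rpow_one] at this
  calc x ^ s = x ^ (s - τ) * x ^ τ := by rw [← Real.rpow_add hx]; ring_nf
    _ ≤ δ * x ^ τ := by gcongr

/-- A measure on codes carried by a finite union of cylinders, absolutely continuous with bounded
density, with mass greater than `c`, and with Frostman bounds of exponent `τ` on cylinders. -/
structure FrostmanMeasure {A : Type*} [MeasurableSpace A] (r : A → ℝ) (P : Measure (ℕ → A))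
    (τ : ℝ) (m₀ : ℕ) (c : ℝ≥0∞) (K : Set (ℕ → A)) (ν : Measure (ℕ → A)) : Prop where
  exists_level : ∃ k, ∀ ω ∈ K, PiNat.cylinder ω k ⊆ K
  exists_density : ∃ D : ℝ≥0∞, D ≠ ∞ ∧ ∀ S, ν S ≤ D * P S
  compl_null : ν Kᶜ = 0
  lt_mass : c < ν univ
  frostman : ∀ σ q, m₀ ≤ q → ν (PiNat.cylinder σ q) ≤ ENNReal.ofReal (prefixRatio r σ q ^ τ)

namespace CodedIFS

variable {d : ℕ} {A : Type*} [Fintype A] [MeasurableSpace A] [MeasurableSingletonClass A]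
  [TopologicalSpace A] [DiscreteTopology A]
  {φ : A → EuclideanSpace ℝ (Fin d) → EuclideanSpace ℝ (Fin d)} {r : A → ℝ}
  {X : Set (EuclideanSpace ℝ (Fin d))} {π : (ℕ → A) → EuclideanSpace ℝ (Fin d)} {s : ℝ}
  {m : Measure A} [IsProbabilityMeasure m] (h : CodedIFS φ r X π s m)

include h

lemma measure_cylinder_ne_zero (σ : ℕ → A) (n : ℕ) :
    bernoulliMeasure m (PiNat.cylinder σ n) ≠ 0 := by
  rw [h.measure_cylinder]
  exact (ENNReal.ofReal_pos.2 (Real.rpow_pos_of_pos (h.prefixRatio_pos σ n) _)).ne'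

lemma prefixRatio_le_of_cylinder_subset {σ τ : ℕ → A} {n k : ℕ}
    (hsub : PiNat.cylinder σ n ⊆ PiNat.cylinder τ k) : prefixRatio r σ n ≤ prefixRatio r τ k := by
  have := measure_mono (μ := bernoulliMeasure m) hsub
  rw [h.measure_cylinder, h.measure_cylinder, ENNReal.ofReal_le_ofReal_iff
    (Real.rpow_nonneg (h.prefixRatio_pos τ k).le _)] at this
  exact (Real.rpow_le_rpow_iff (h.prefixRatio_pos σ n).le (h.prefixRatio_pos τ k).le h.dim_pos).1
    this

/-- Redistributing the mass of a cylinder of small measure over a subcylinder preserves Frostman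
bounds. -/
lemma div_mul_measure_inter_le {τ : ℝ} (hτ0 : 0 < τ) (hτ : τ < s) {σ ω : ℕ → A} {q n : ℕ}
    {M : ℝ≥0∞} (hM : M ≤ ENNReal.ofReal (prefixRatio r ω n ^ τ)) :
    M / bernoulliMeasure m (PiNat.cylinder ω n) *
      bernoulliMeasure m (PiNat.cylinder σ q ∩ PiNat.cylinder ω n) ≤
      ENNReal.ofReal (prefixRatio r σ q ^ τ) := by
  have hRω := h.prefixRatio_pos ω n
  have hRσ := h.prefixRatio_pos σ q
  have h1 : PiNat.cylinder ω n ⊆ PiNat.cylinder σ q ∨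
      PiNat.cylinder σ q ⊆ PiNat.cylinder ω n ∨
      Disjoint (PiNat.cylinder σ q) (PiNat.cylinder ω n) := by
    rcases le_total n q with hnq | hnq
    · exact Or.inr (cylinder_subset_or_disjoint hnq)
    · rcases cylinder_subset_or_disjoint (σ := σ) (τ := ω) hnq with h | h
      · exact Or.inl h
      · exact Or.inr (Or.inr h.symm)
  rcases h1 with h1 | h1 | h1
  · rw [inter_eq_self_of_subset_right h1, ENNReal.div_mul_cancel
      (h.measure_cylinder_ne_zero _ _) (measure_ne_top _ _)]
    exact hM.trans (ENNReal.ofReal_le_ofReal (Real.rpow_le_rpow hRω.le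
      (h.prefixRatio_le_of_cylinder_subset h1) hτ0.le))
  · have hle := h.prefixRatio_le_of_cylinder_subset h1
    rw [inter_eq_self_of_subset_left h1, h.measure_cylinder, h.measure_cylinder]
    calc M / ENNReal.ofReal (prefixRatio r ω n ^ s) * ENNReal.ofReal (prefixRatio r σ q ^ s)
        ≤ ENNReal.ofReal (prefixRatio r ω n ^ τ) / ENNReal.ofReal (prefixRatio r ω n ^ s) *
            ENNReal.ofReal (prefixRatio r σ q ^ s) := by gcongr
      _ = ENNReal.ofReal (prefixRatio r ω n ^ (τ - s) * prefixRatio r σ q ^ s) := by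
          rw [← ENNReal.ofReal_div_of_pos (Real.rpow_pos_of_pos hRω _),
            ← ENNReal.ofReal_mul (by positivity), Real.rpow_sub hRω]
      _ ≤ ENNReal.ofReal (prefixRatio r σ q ^ τ) := by
          refine ENNReal.ofReal_le_ofReal ?_
          calc prefixRatio r ω n ^ (τ - s) * prefixRatio r σ q ^ s
              ≤ prefixRatio r σ q ^ (τ - s) * prefixRatio r σ q ^ s :=
                mul_le_mul_of_nonneg_right
                  (Real.rpow_le_rpow_of_nonpos hRσ hle (by linarith)) (by positivity)
            _ = prefixRatio r σ q ^ τ := by rw [← Real.rpow_add hRσ, sub_add_cancel]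
  · rw [h1.inter_eq, measure_empty, mul_zero]
    exact zero_le

end CodedIFS

end MassTransference

section CantorConstruction

namespace CodedIFS

variable {d : ℕ} {A : Type*} [Fintype A] [MeasurableSpace A] [MeasurableSingletonClass A]
  [TopologicalSpace A] [DiscreteTopology A]
  {φ : A → EuclideanSpace ℝ (Fin d) → EuclideanSpace ℝ (Fin d)} {r : A → ℝ}
  {X : Set (EuclideanSpace ℝ (Fin d))} {π : (ℕ → A) → EuclideanSpace ℝ (Fin d)} {s : ℝ}
  {m : Measure A} [IsProbabilityMeasure m] (h : CodedIFS φ r X π s m)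

lemma measurableSet_cylinder (σ : ℕ → A) (n : ℕ) : MeasurableSet (PiNat.cylinder σ n) :=
  (PiNat.isOpen_cylinder (fun _ : ℕ => A) σ n).measurableSet

include h

/-- Concentrating a Frostman measure on subcylinders of finitely many disjoint cylinders. -/
lemma exists_frostmanMeasure_of_finset {τ : ℝ} (hτ0 : 0 < τ) (hτ : τ < s) {m₀ : ℕ} {c D : ℝ≥0∞}
    {K U : Set (ℕ → A)} {ν : Measure (ℕ → A)}
    (hD : ∀ S, ν S ≤ D * bernoulliMeasure m S) {δ : ℝ} (hδ : 0 ≤ δ)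
    (hDδ : D * ENNReal.ofReal δ ≤ 1) (hν : FrostmanMeasure r (bernoulliMeasure m) τ m₀ c K ν)
    (F : Finset (Set (ℕ → A))) (hdisj : (F : Set (Set (ℕ → A))).PairwiseDisjoint id)
    (hF : ∀ C ∈ F, C ⊆ K ∧ ∃ ω k, C = PiNat.cylinder ω k ∧ ∃ ω' q,
      PiNat.cylinder ω' q ⊆ C ∧ PiNat.cylinder ω' q ⊆ U ∧
        prefixRatio r ω k ^ s ≤ δ * prefixRatio r ω' q ^ τ)
    (hc : c < ∑ C ∈ F, ν C) :
    ∃ K' ν', FrostmanMeasure r (bernoulliMeasure m) τ m₀ c K' ν' ∧ K' ⊆ K ∧ K' ⊆ U := by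
  classical
  have hF' : ∀ C : Set (ℕ → A), ∃ ω : ℕ → A, ∃ k, ∃ ω' : ℕ → A, ∃ q : ℕ, C ∈ F →
      C ⊆ K ∧ C = PiNat.cylinder ω k ∧ PiNat.cylinder ω' q ⊆ C ∧ PiNat.cylinder ω' q ⊆ U ∧
        prefixRatio r ω k ^ s ≤ δ * prefixRatio r ω' q ^ τ := by
    intro C
    by_cases hC : C ∈ F
    · obtain ⟨h1, ω, k, h2, ω', q, h3⟩ := hF C hC
      exact ⟨ω, k, ω', q, fun _ => ⟨h1, h2, h3⟩⟩
    · obtain ⟨a⟩ := h.nonempty_alphabet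
      exact ⟨fun _ => a, 0, fun _ => a, 0, fun h => absurd h hC⟩
  choose ω k ω' q hFK hCeq hsub hU hratio using hF'
  set P := bernoulliMeasure m with hP
  set C' : Set (ℕ → A) → Set (ℕ → A) := fun C => PiNat.cylinder (ω' C) (q C) with hC'
  have hC'0 : ∀ C, P (C' C) ≠ 0 := fun C => h.measure_cylinder_ne_zero _ _
  have hC'm : ∀ C, MeasurableSet (C' C) := fun C => measurableSet_cylinder _ _
  have hνC : ∀ C ∈ F, ν C ≤ ENNReal.ofReal (prefixRatio r (ω' C) (q C) ^ τ) := by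
    intro C hC
    calc ν C ≤ D * P C := hD C
      _ = D * ENNReal.ofReal (prefixRatio r (ω C) (k C) ^ s) := by
          conv_lhs => rw [hCeq C hC]
          rw [hP, h.measure_cylinder]
      _ ≤ D * ENNReal.ofReal (δ * prefixRatio r (ω' C) (q C) ^ τ) := by
          gcongr
          exact hratio C hC
      _ = D * ENNReal.ofReal δ * ENNReal.ofReal (prefixRatio r (ω' C) (q C) ^ τ) := by
          rw [ENNReal.ofReal_mul hδ, mul_assoc]
      _ ≤ _ := by simpa using mul_le_mul_left hDδ _
  set ν' : Measure (ℕ → A) := ∑ C ∈ F, (ν C / P (C' C)) • P.restrict (C' C) with hν'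
  have happ : ∀ S, MeasurableSet S → ν' S = ∑ C ∈ F, ν C / P (C' C) * P (S ∩ C' C) := by
    intro S hS
    simp [hν', Measure.finsetSum_apply, Measure.restrict_apply hS]
  have hcancel : ∀ C, ν C / P (C' C) * P (C' C) = ν C := fun C =>
    ENNReal.div_mul_cancel (hC'0 C) (measure_ne_top _ _)
  have hKm : MeasurableSet (⋃ C ∈ F, C' C) := Finset.measurableSet_biUnion _ fun C _ => hC'm C
  refine ⟨⋃ C ∈ F, C' C, ν', ⟨⟨F.sup q, ?_⟩, ⟨∑ C ∈ F, ν C / P (C' C), ?_, ?_⟩, ?_, ?_, ?_⟩,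
    iUnion₂_subset fun C hC => (hsub C hC).trans (hFK C hC), iUnion₂_subset fun C hC => hU C hC⟩
  · intro x hx
    obtain ⟨C, hC, hxC⟩ := mem_iUnion₂.1 hx
    refine Subset.trans ?_ (subset_biUnion_of_mem (u := C') hC)
    change _ ⊆ PiNat.cylinder (ω' C) (q C)
    rw [← PiNat.mem_cylinder_iff_eq.1 hxC]
    exact PiNat.cylinder_anti x (Finset.le_sup hC)
  · refine ENNReal.sum_ne_top.2 fun C hC => ENNReal.div_ne_top ?_ (hC'0 C)
    exact ne_top_of_le_ne_top ENNReal.ofReal_ne_top (hνC C hC)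
  · intro S
    rw [hν', Measure.finsetSum_apply, Finset.sum_mul]
    refine Finset.sum_le_sum fun C _ => ?_
    rw [Measure.smul_apply, smul_eq_mul]
    gcongr
    exact Measure.restrict_le_self
  · rw [happ _ hKm.compl]
    refine Finset.sum_eq_zero fun C hC => ?_
    have : (⋃ C ∈ F, C' C)ᶜ ∩ C' C = ∅ := by
      rw [← disjoint_iff_inter_eq_empty]
      exact disjoint_compl_left.mono_right (subset_biUnion_of_mem (u := C') hC)
    rw [this, measure_empty, mul_zero]
  · rw [happ _ .univ]
    simpa [hcancel] using hc
  · intro σ q₀ hq₀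
    rw [happ _ (measurableSet_cylinder _ _)]
    by_cases hex : ∃ C ∈ F, PiNat.cylinder σ q₀ ⊆ C
    · obtain ⟨C, hC, hwC⟩ := hex
      rw [Finset.sum_eq_single_of_mem C hC]
      · exact h.div_mul_measure_inter_le hτ0 hτ (hνC C hC)
      · intro B hB hBC
        have : Disjoint (PiNat.cylinder σ q₀) (C' B) :=
          (hdisj hC hB hBC.symm).mono hwC (hsub B hB)
        rw [this.inter_eq, measure_empty, mul_zero]
    · push Not at hex
      refine le_trans ?_ (hν.frostman σ q₀ hq₀)
      have hCm : ∀ C ∈ F, MeasurableSet (C ∩ PiNat.cylinder σ q₀) := fun C hC => by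
        rw [hCeq C hC]
        exact (measurableSet_cylinder _ _).inter (measurableSet_cylinder _ _)
      calc ∑ C ∈ F, ν C / P (C' C) * P (PiNat.cylinder σ q₀ ∩ C' C)
          ≤ ∑ C ∈ F, ν (C ∩ PiNat.cylinder σ q₀) := by
            refine Finset.sum_le_sum fun C hC => ?_
            have hcases : C ⊆ PiNat.cylinder σ q₀ ∨ Disjoint C (PiNat.cylinder σ q₀) := by
              rcases le_total q₀ (k C) with hle | hle
              · rw [hCeq C hC]
                exact cylinder_subset_or_disjoint hle
              · rcases cylinder_subset_or_disjoint (σ := ω C) (τ := σ) hle with h1 | h1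
                · rw [← hCeq C hC] at h1
                  exact absurd h1 (hex C hC)
                · rw [← hCeq C hC] at h1
                  exact Or.inr h1.symm
            rcases hcases with h1 | h1
            · rw [inter_eq_self_of_subset_left h1,
                inter_eq_self_of_subset_right ((hsub C hC).trans h1), hcancel]
            · have : Disjoint (PiNat.cylinder σ q₀) (C' C) := h1.symm.mono_right (hsub C hC)
              rw [this.inter_eq, measure_empty, mul_zero]
              exact zero_le
        _ = ν (⋃ C ∈ F, C ∩ PiNat.cylinder σ q₀) :=
            (measure_biUnion_finset (fun B hB C hC hBC =>
              (hdisj hB hC hBC).mono inter_subset_left inter_subset_left) hCm).symm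
        _ ≤ ν (PiNat.cylinder σ q₀) := measure_mono (iUnion₂_subset fun _ _ => inter_subset_right)

/-- One step of the Cantor construction: a Frostman measure can be concentrated on a limsup
family along which almost every code has large subcylinders. -/
lemma exists_frostmanMeasure_subset {τ : ℝ} (hτ0 : 0 < τ) (hτ : τ < s) {V : ℕ → Set (ℕ → A)}
    (hV : ∀ᵐ ω ∂bernoulliMeasure m, ∀ δ > 0, ∀ n₀ : ℕ, ∃ k ≥ n₀, ∃ n ≥ n₀,
      ∃ ω' ∈ PiNat.cylinder ω k, ∃ q ≥ k, PiNat.cylinder ω' q ⊆ V n ∧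
        prefixRatio r ω k ^ s ≤ δ * prefixRatio r ω' q ^ τ)
    {m₀ : ℕ} {c : ℝ≥0∞} {K : Set (ℕ → A)} {ν : Measure (ℕ → A)}
    (hν : FrostmanMeasure r (bernoulliMeasure m) τ m₀ c K ν) (n₀ : ℕ) :
    ∃ K' ν', FrostmanMeasure r (bernoulliMeasure m) τ m₀ c K' ν' ∧ K' ⊆ K ∧
      K' ⊆ ⋃ n ≥ n₀, V n := by
  classical
  obtain ⟨k₀, hk₀⟩ := hν.exists_level
  obtain ⟨D, hDtop, hD⟩ := hν.exists_density
  set δ : ℝ := 1 / (D.toReal + 1) with hδdef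
  have hδ : 0 < δ := by positivity
  have hDδ : D * ENNReal.ofReal δ ≤ 1 := by
    rw [← ENNReal.ofReal_toReal hDtop, ← ENNReal.ofReal_mul ENNReal.toReal_nonneg,
      ENNReal.ofReal_le_one, hδdef, mul_one_div, div_le_one (by positivity)]
    linarith
  set Q : (ℕ → A) → ℕ → Prop := fun ω k => max n₀ k₀ ≤ k ∧ ∃ n ≥ n₀,
      ∃ ω' ∈ PiNat.cylinder ω k, ∃ q ≥ k, PiNat.cylinder ω' q ⊆ V n ∧
        prefixRatio r ω k ^ s ≤ δ * prefixRatio r ω' q ^ τ with hQdef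
  have hQcongr : ∀ {ω ω₁ : ℕ → A} {k : ℕ}, ω₁ ∈ PiNat.cylinder ω k → Q ω k → Q ω₁ k := by
    intro ω ω₁ k hω₁ hQ
    simp only [hQdef] at hQ ⊢
    rwa [PiNat.mem_cylinder_iff_eq.1 hω₁, prefixRatio_congr r hω₁]
  set G : ℕ → Set (ℕ → A) := fun L => {ω | ∃ k ≤ L, Q ω k} with hG
  have hGmono : Monotone G := fun L L' hL ω ⟨k, hk, hQ⟩ => ⟨k, hk.trans hL, hQ⟩
  have hPG : bernoulliMeasure m (⋃ L, G L)ᶜ = 0 := by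
    refine measure_mono_null ?_ (ae_iff.1 hV)
    intro ω hω hgood
    obtain ⟨k, hk, n, hn, ω', hω', q, hq, h1, h2⟩ := hgood δ hδ (max n₀ k₀)
    exact hω (mem_iUnion.2 ⟨k, k, le_rfl, hk, n, (le_max_left _ _).trans hn, ω', hω', q, hq,
      h1, h2⟩)
  have hnull : ν (⋃ L, G L ∩ K)ᶜ = 0 := by
    rw [← iUnion_inter, compl_inter]
    refine measure_union_null (le_antisymm ((hD _).trans ?_) zero_le) hν.compl_null
    rw [hPG, mul_zero]
  have hmass : c < ν (⋃ L, G L ∩ K) := by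
    refine hν.lt_mass.trans_le ?_
    rw [← union_compl_self (⋃ L, G L ∩ K)]
    exact (measure_union_le _ _).trans_eq (by rw [hnull, add_zero])
  rw [Monotone.measure_iUnion fun L L' hL => inter_subset_inter_left K (hGmono hL)] at hmass
  obtain ⟨L, hL⟩ := lt_iSup_iff.1 hmass
  set T : Set (Set (ℕ → A)) :=
    {C | ∃ ω ∈ K, ∃ k ≤ L, C = PiNat.cylinder ω k ∧ Q ω k ∧ ∀ j < k, ¬ Q ω j} with hT
  have hTfin : T.Finite := (finite_setOf_cylinder L).subset
    fun C ⟨ω, _, k, hk, hC, _⟩ => ⟨ω, k, hk, hC⟩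
  have hTdisj : T.PairwiseDisjoint id := by
    have key : ∀ {ω₁ ω₂ : ℕ → A} {k₁ k₂ : ℕ}, k₁ ≤ k₂ → Q ω₁ k₁ → (∀ j < k₂, ¬ Q ω₂ j) →
        PiNat.cylinder ω₂ k₂ ⊆ PiNat.cylinder ω₁ k₁ →
        PiNat.cylinder ω₂ k₂ = PiNat.cylinder ω₁ k₁ := by
      intro ω₁ ω₂ k₁ k₂ hk hQ₁ hmin hsub
      have hmem := hsub (PiNat.self_mem_cylinder ω₂ k₂)
      obtain rfl : k₁ = k₂ := by
        by_contra hne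
        exact hmin k₁ (by omega) (hQcongr hmem hQ₁)
      exact PiNat.mem_cylinder_iff_eq.1 hmem
    rintro _ ⟨ω₁, _, k₁, _, rfl, hQ₁, hm₁⟩ _ ⟨ω₂, _, k₂, _, rfl, hQ₂, hm₂⟩ hne
    rcases le_total k₁ k₂ with hk | hk
    · rcases cylinder_subset_or_disjoint (σ := ω₁) (τ := ω₂) hk with h1 | h1
      · exact absurd (key hk hQ₁ hm₂ h1).symm hne
      · exact h1.symm
    · rcases cylinder_subset_or_disjoint (σ := ω₂) (τ := ω₁) hk with h1 | h1
      · exact absurd (key hk hQ₂ hm₁ h1) hne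
      · exact h1
  refine h.exists_frostmanMeasure_of_finset hτ0 hτ hD hδ.le hDδ hν hTfin.toFinset
    (by simpa using hTdisj) ?_ ?_
  · intro C hC
    obtain ⟨ω, hωK, k, hk, rfl, ⟨hk1, n, hn, ω', hω', q, hq, h1, h2⟩, -⟩ :=
      hTfin.mem_toFinset.1 hC
    refine ⟨(PiNat.cylinder_anti ω ((le_max_right _ _).trans hk1)).trans (hk₀ ω hωK), ω, k, rfl,
      ω', q, ?_, h1.trans (subset_biUnion_of_mem (u := V) hn), h2⟩
    rw [← PiNat.mem_cylinder_iff_eq.1 hω']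
    exact PiNat.cylinder_anti ω' hq
  · refine hL.trans_le ((measure_mono ?_).trans (measure_biUnion_finset_le hTfin.toFinset _))
    rintro ω ⟨⟨k, hk, hQ⟩, hωK⟩
    have hex : ∃ k, Q ω k := ⟨k, hQ⟩
    refine mem_biUnion (x := PiNat.cylinder ω (Nat.find hex)) ?_ (PiNat.self_mem_cylinder _ _)
    exact hTfin.mem_toFinset.2 ⟨ω, hωK, Nat.find hex, (Nat.find_min' hex hQ).trans hk, rfl,
      Nat.find_spec hex, fun j hj => Nat.find_min hex hj⟩

/-- A mass transference principle for limsup sets of codes. -/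
theorem hausdorffMeasure_eq_top (hosc : OpenSetCondition φ) {τ : ℝ} (hτ0 : 0 < τ) (hτ : τ < s)
    {V : ℕ → Set (ℕ → A)}
    (hV : ∀ᵐ ω ∂bernoulliMeasure m, ∀ δ > 0, ∀ n₀ : ℕ, ∃ k ≥ n₀, ∃ n ≥ n₀,
      ∃ ω' ∈ PiNat.cylinder ω k, ∃ q ≥ k, PiNat.cylinder ω' q ⊆ V n ∧
        prefixRatio r ω k ^ s ≤ δ * prefixRatio r ω' q ^ τ)
    {E : Set (EuclideanSpace ℝ (Fin d))} (hE : ∀ σ, (∃ᶠ n in atTop, σ ∈ V n) → π σ ∈ E) :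
    μH[τ] E = ∞ := by
  obtain ⟨N, hN⟩ := h.exists_le_mul_hausdorffMeasure hosc
  have key : ∀ R : ℕ, 0 < R → (R : ℝ≥0∞) / 2 ≤ N * μH[τ] E := by
    intro R hR
    have hR' : (0 : ℝ) < R := Nat.cast_pos.2 hR
    obtain ⟨η, hη, hηle⟩ := exists_rpow_le_mul_rpow hτ (δ := 1 / R) (by positivity)
    obtain ⟨m₀, hm₀⟩ := h.exists_prefixRatio_lt hη
    set P := bernoulliMeasure m with hP
    have hstart : FrostmanMeasure r P τ m₀ ((R : ℝ≥0∞) / 2) univ ((R : ℝ≥0∞) • P) := by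
      refine ⟨⟨0, fun _ _ => subset_univ _⟩, ⟨R, ENNReal.natCast_ne_top R, fun S => by simp⟩,
        by simp, ?_, ?_⟩
      · simpa using ENNReal.half_lt_self (Nat.cast_ne_zero.2 hR.ne') (ENNReal.natCast_ne_top R)
      · intro σ q hq
        rw [Measure.smul_apply, smul_eq_mul, hP, h.measure_cylinder, ← ENNReal.ofReal_natCast,
          ← ENNReal.ofReal_mul hR'.le]
        refine ENNReal.ofReal_le_ofReal ?_
        have := hηle _ (h.prefixRatio_pos σ q) (hm₀ q hq σ)
        rw [one_div, ← div_eq_inv_mul, le_div_iff₀ hR'] at this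
        linarith
    have step : ∀ (n₀ : ℕ) (S : {S : Set (ℕ → A) × Measure (ℕ → A) //
        FrostmanMeasure r P τ m₀ ((R : ℝ≥0∞) / 2) S.1 S.2}),
        ∃ S' : {S : Set (ℕ → A) × Measure (ℕ → A) //
          FrostmanMeasure r P τ m₀ ((R : ℝ≥0∞) / 2) S.1 S.2},
          S'.1.1 ⊆ S.1.1 ∧ S'.1.1 ⊆ ⋃ n ≥ n₀, V n := by
      rintro n₀ ⟨⟨K, ν⟩, hν⟩
      obtain ⟨K', ν', hν', h1, h2⟩ := h.exists_frostmanMeasure_subset hτ0 hτ hV hν n₀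
      exact ⟨⟨⟨K', ν'⟩, hν'⟩, h1, h2⟩
    choose next hnext₁ hnext₂ using step
    let S : ℕ → {S : Set (ℕ → A) × Measure (ℕ → A) //
        FrostmanMeasure r P τ m₀ ((R : ℝ≥0∞) / 2) S.1 S.2} :=
      fun j => Nat.rec ⟨⟨univ, (R : ℝ≥0∞) • P⟩, hstart⟩ next j
    have hSsucc : ∀ j, S (j + 1) = next j (S j) := fun _ => rfl
    refine hN τ hτ0 m₀ (fun j => (S j).1.1) ?_ (antitone_nat_of_succ_le fun j => ?_)
      (fun j => (S j).1.2) _ ?_ ?_ E ?_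
    · intro j
      obtain ⟨k, hk⟩ := (S j).2.exists_level
      rw [← isOpen_compl_iff, isOpen_iff_forall_mem_open]
      intro x hx
      refine ⟨PiNat.cylinder x k, fun y hy hyK => hx (hk y hyK ?_),
        PiNat.isOpen_cylinder (fun _ : ℕ => A) x k, PiNat.self_mem_cylinder x k⟩
      rw [PiNat.mem_cylinder_iff_eq.1 hy]
      exact PiNat.self_mem_cylinder x k
    · rw [hSsucc]
      exact hnext₁ _ _
    · intro j
      refine (S j).2.lt_mass.le.trans ?_
      rw [← union_compl_self (S j).1.1]
      exact (measure_union_le _ _).trans_eq (by rw [(S j).2.compl_null, add_zero])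
    · exact fun j σ q hq => (S j).2.frostman σ q hq
    · intro σ hσ
      refine hE σ (frequently_atTop.2 fun n₀ => ?_)
      have h1 : σ ∈ (S (n₀ + 1)).1.1 := mem_iInter.1 hσ (n₀ + 1)
      rw [hSsucc] at h1
      obtain ⟨n, hn, hσn⟩ := mem_iUnion₂.1 (hnext₂ _ _ h1)
      exact ⟨n, hn, hσn⟩
  by_contra htop
  have hfin : (N : ℝ≥0∞) * μH[τ] E ≠ ∞ := ENNReal.mul_ne_top (ENNReal.natCast_ne_top N) htop
  obtain ⟨R, hR⟩ := ENNReal.exists_nat_gt (r := N * μH[τ] E * 2)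
    (ENNReal.mul_ne_top hfin ENNReal.ofNat_ne_top)
  have hR0 : 0 < R := by
    rcases Nat.eq_zero_or_pos R with rfl | hpos
    · simp at hR
    · exact hpos
  have := key R hR0
  rw [ENNReal.div_le_iff (by simp) (by simp)] at this
  exact absurd this hR.not_ge

end CodedIFS

end CantorConstruction

section EventuallyPeriodic

namespace CodedIFS

variable {d : ℕ} {A : Type*} [Fintype A] [MeasurableSpace A] [MeasurableSingletonClass A]
  [TopologicalSpace A] [DiscreteTopology A]
  {φ : A → EuclideanSpace ℝ (Fin d) → EuclideanSpace ℝ (Fin d)} {r : A → ℝ}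
  {X : Set (EuclideanSpace ℝ (Fin d))} {π : (ℕ → A) → EuclideanSpace ℝ (Fin d)} {s : ℝ}
  {m : Measure A} [IsProbabilityMeasure m] (h : CodedIFS φ r X π s m)

include h

lemma limsupW_subset {g : ℕ → ℝ} (hg0 : ∀ n, 0 ≤ g n) (hanti : ∀ n, 1 ≤ n → g (n + 1) ≤ g n)
    {t : ℝ} (ht : 1 ≤ t) :
    limsupW π (fun n a => (Metric.diam (iterMap φ a '' X) * g n) ^ t) ⊆ X := by
  intro x hx
  have ht0 : 0 < t := by linarith
  rw [← h.isCompact.isClosed.closure_eq, Metric.mem_closure_iff]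
  intro ε hε
  set c : ℝ := Metric.diam X * g 1 with hc
  have hc0 : 0 ≤ c := mul_nonneg Metric.diam_nonneg (hg0 1)
  have hmono : ∀ n, 1 ≤ n → g n ≤ g 1 := by
    intro n hn
    induction n, hn using Nat.le_induction with
    | base => rfl
    | succ n hn ih => exact (hanti n hn).trans ih
  obtain ⟨N, hN⟩ := h.exists_prefixRatio_lt (ε := ε ^ (1 / t) / (c + 1)) (by positivity)
  obtain ⟨n, hn, a, l, hl, hlt⟩ := frequently_atTop.1 hx (max N 1)
  refine ⟨_, h.coding_mem (evp a l hl), ?_⟩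
  rw [dist_eq_norm]
  refine hlt.trans ?_
  obtain ⟨σ, rfl⟩ := h.exists_extension a
  have hR := h.prefixRatio_pos σ n
  have h1 := (lt_div_iff₀ (by positivity)).1 (hN n ((le_max_left _ _).trans hn) σ)
  have h2 : Metric.diam (iterMap φ (fun i : Fin n => σ i) '' X) * g n < ε ^ (1 / t) := by
    have : Metric.diam (iterMap φ (fun i : Fin n => σ i) '' X) = prefixRatio r σ n * diam X :=
      h.diam_prefixMap_image σ n
    rw [this, mul_assoc]
    calc prefixRatio r σ n * (diam X * g n) ≤ prefixRatio r σ n * c := by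
          gcongr
          exact mul_le_mul_of_nonneg_left (hmono n ((le_max_right _ _).trans hn)) Metric.diam_nonneg
      _ ≤ prefixRatio r σ n * (c + 1) := by gcongr; linarith
      _ < _ := h1
  calc _ < (ε ^ (1 / t)) ^ t :=
        Real.rpow_lt_rpow (mul_nonneg Metric.diam_nonneg (hg0 n)) h2 ht0
    _ = ε := by rw [← Real.rpow_mul hε.le, one_div_mul_cancel ht0.ne', Real.rpow_one]

theorem ae_coding_mem_limsupW {g : ℕ → ℝ} (hg0 : ∀ n, 0 ≤ g n)
    (hanti : ∀ n, 1 ≤ n → g (n + 1) ≤ g n) (hdiv : ¬ Summable fun n : ℕ => (n : ℝ) * g n ^ s) :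
    ∀ᵐ ω ∂bernoulliMeasure m,
      π ω ∈ limsupW π (fun n a => Metric.diam (iterMap φ a '' X) * g n) := by
  filter_upwards [h.ae_frequently_evp_mem_cylinder hg0 hanti hdiv] with ω hω
  refine (hω 1 one_pos).mono fun n ⟨l, hl, k, hmem, hlt⟩ => ⟨fun i : Fin n => ω i, l, hl, ?_⟩
  have : Metric.diam (iterMap φ (fun i : Fin n => ω i) '' X) = prefixRatio r ω n * diam X :=
    h.diam_prefixMap_image ω n
  beta_reduce
  rw [this]
  have := h.diam_pos
  calc _ ≤ prefixRatio r ω (n + k) * diam X := h.norm_coding_sub_le hmem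
    _ < prefixRatio r ω n * (1 * g n) * diam X := by gcongr
    _ = _ := by ring

/-- Almost every code has large subcylinders inside the preimages of the balls defining the
limsup set. -/
theorem ae_exists_cylinder_subset {g : ℕ → ℝ} (hg0 : ∀ n, 0 ≤ g n)
    (hanti : ∀ n, 1 ≤ n → g (n + 1) ≤ g n) (hdiv : ¬ Summable fun n : ℕ => (n : ℝ) * g n ^ s)
    {t : ℝ} (ht : 1 < t) :
    ∀ᵐ ω ∂bernoulliMeasure m, ∀ δ > 0, ∀ n₀ : ℕ, ∃ k ≥ n₀, ∃ n ≥ n₀,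
      ∃ ω' ∈ PiNat.cylinder ω k, ∃ q ≥ k,
        PiNat.cylinder ω' q ⊆ {σ | ∃ a : Fin n → A, ∃ l : ℕ, ∃ hl : l < n,
          ‖π σ - π (evp a l hl)‖ < (Metric.diam (iterMap φ a '' X) * g n) ^ t} ∧
        prefixRatio r ω k ^ s ≤ δ * prefixRatio r ω' q ^ (s / t) := by
  obtain ⟨r₀, r₁, hr0, hr1, hr⟩ := h.exists_ratio_bounds
  have hs := h.dim_pos
  have ht0 : 0 < t := by linarith
  have hD := h.diam_pos
  set D := Metric.diam X with hDdef
  filter_upwards [h.ae_frequently_evp_mem_cylinder hg0 hanti hdiv] with ω hω δ hδ n₀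
  obtain ⟨η, hη, hηle⟩ := exists_rpow_le_mul_rpow (div_lt_self hs ht) hδ
  obtain ⟨N, hN⟩ := h.exists_prefixRatio_lt hη
  set δ₁ : ℝ := δ ^ (1 / s) * (r₀ / D) ^ (1 / t) * D with hδ₁
  have hδ₁pos : 0 < δ₁ := by positivity
  obtain ⟨n, hn, l, hl, k, hmem, hlt⟩ := frequently_atTop.1 (hω δ₁ hδ₁pos) (max n₀ N)
  have hn₀ : n₀ ≤ n := (le_max_left _ _).trans hn
  have hRn := h.prefixRatio_pos ω n
  have hRk := h.prefixRatio_pos ω (n + k)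
  have hg : 0 < g n := by
    have := hRk.trans hlt
    rcases (hg0 n).eq_or_lt with h0 | h0
    · rw [← h0] at this
      simp at this
    · exact h0
  set e := evp (fun i : Fin n => ω i) l hl with he
  set z : ℝ := prefixRatio r ω n * D * g n with hz
  have hzpos : 0 < z := by positivity
  set y : ℝ := z ^ t / D with hy
  have hypos : 0 < y := by positivity
  have hex : ∃ q, n + k ≤ q ∧ prefixRatio r e q < y := by
    obtain ⟨M, hM⟩ := h.exists_prefixRatio_lt hypos
    exact ⟨max (n + k) M, le_max_left _ _, hM _ (le_max_right _ _) e⟩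
  classical
  obtain ⟨hq₁, hq₂⟩ := Nat.find_spec hex
  have hmin : ∀ j < Nat.find hex, ¬ (n + k ≤ j ∧ prefixRatio r e j < y) :=
    fun j hj => Nat.find_min hex hj
  generalize Nat.find hex = q at hq₁ hq₂ hmin
  refine ⟨n + k, by omega, n, hn₀, e, hmem, q, hq₁, fun σ hσ => ⟨fun i : Fin n => ω i, l, hl, ?_⟩, ?_⟩
  · have hdiam : Metric.diam (iterMap φ (fun i : Fin n => ω i) '' X) = prefixRatio r ω n * D :=
      h.diam_prefixMap_image ω n
    rw [hdiam, norm_sub_rev]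
    calc ‖π e - π σ‖ ≤ prefixRatio r e q * D := h.norm_coding_sub_le hσ
      _ < y * D := by gcongr
      _ = z ^ t := div_mul_cancel₀ _ hD.ne'
  · rcases hq₁.eq_or_lt with hq | hq
    · rw [← hq, prefixRatio_congr r hmem]
      exact hηle _ hRk (hN _ (by have := (le_max_right n₀ N).trans hn; omega) ω)
    · obtain ⟨j, rfl⟩ : ∃ j, q = j + 1 := ⟨q - 1, by omega⟩
      have hj : y ≤ prefixRatio r e j := by
        by_contra! hlt
        exact hmin j (by omega) ⟨by omega, hlt⟩
      have hlow : r₀ / D * z ^ t ≤ prefixRatio r e (j + 1) := by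
        rw [prefixRatio_succ]
        calc r₀ / D * z ^ t = y * r₀ := by rw [hy]; ring
          _ ≤ prefixRatio r e j * r (e j) :=
            mul_le_mul hj (hr _).1 hr0.le (h.prefixRatio_pos e j).le
      have hτ : 0 ≤ s / t := by positivity
      calc prefixRatio r ω (n + k) ^ s ≤ (prefixRatio r ω n * (δ₁ * g n)) ^ s :=
            Real.rpow_le_rpow hRk.le hlt.le hs.le
        _ = (δ ^ (1 / s) * ((r₀ / D) ^ (1 / t) * z)) ^ s := by
            rw [hδ₁, hz]
            ring_nf
        _ = δ * ((r₀ / D) ^ (s / t) * z ^ s) := by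
            have hw : 0 ≤ (r₀ / D) ^ (1 / t) := by positivity
            rw [Real.mul_rpow (by positivity) (mul_nonneg hw hzpos.le),
              Real.mul_rpow hw hzpos.le, ← Real.rpow_mul hδ.le,
              one_div_mul_cancel hs.ne', Real.rpow_one, ← Real.rpow_mul (by positivity),
              one_div_mul_eq_div]
        _ = δ * (r₀ / D * z ^ t) ^ (s / t) := by
            rw [Real.mul_rpow (div_pos hr0 hD).le (Real.rpow_nonneg hzpos.le _),
              ← Real.rpow_mul hzpos.le, mul_div_cancel₀ _ ht0.ne']
        _ ≤ δ * prefixRatio r e (j + 1) ^ (s / t) := by gcongr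

theorem hausdorffMeasure_limsupW (hosc : OpenSetCondition φ) {g : ℕ → ℝ} (hg0 : ∀ n, 0 ≤ g n)
    (hanti : ∀ n, 1 ≤ n → g (n + 1) ≤ g n) (hdiv : ¬ Summable fun n : ℕ => (n : ℝ) * g n ^ s)
    {t : ℝ} (ht : 1 ≤ t) :
    μH[s / t] (limsupW π (fun n a => (Metric.diam (iterMap φ a '' X) * g n) ^ t)) =
      μH[s / t] X := by
  have hsub := h.limsupW_subset hg0 hanti ht
  rcases ht.eq_or_lt with rfl | ht
  · rw [div_one]
    refine h.hausdorffMeasure_eq_of_ae hsub ?_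
    simpa only [Real.rpow_one] using h.ae_coding_mem_limsupW hg0 hanti hdiv
  · have htop := h.hausdorffMeasure_eq_top hosc (div_pos h.dim_pos (by linarith))
      (div_lt_self h.dim_pos ht) (h.ae_exists_cylinder_subset hg0 hanti hdiv ht)
      (E := limsupW π (fun n a => (Metric.diam (iterMap φ a '' X) * g n) ^ t)) fun σ hσ => hσ
    rw [htop]
    exact (top_le_iff.1 (htop ▸ measure_mono hsub)).symm

end CodedIFS

end EventuallyPeriodic

/-- Theorem 4.2(1) of the paper: for an IFS satisfying the open set
condition and the entropy condition, if `g` is non-increasing with divergent volume sum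
and `Ψ(a) = diam(X_a)·g(|a|)`, then for every `t ≥ 1`,
`ℋ^{dim_H(X)/t}(W_Φ(Ψ^t)) = ℋ^{dim_H(X)/t}(X)`. -/
theorem statement11 {d : ℕ} {A : Type*} [Fintype A]
    (hA : 2 ≤ Fintype.card A)
    (φ : A → EuclideanSpace ℝ (Fin d) → EuclideanSpace ℝ (Fin d))
    (r : A → ℝ) (hr : ∀ a, r a ∈ Set.Ioo (0 : ℝ) 1)
    (hsim : ∀ a x y, ‖φ a x - φ a y‖ = r a * ‖x - y‖)
    (X : Set (EuclideanSpace ℝ (Fin d)))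
    (hXne : X.Nonempty) (hXcomp : IsCompact X)
    (hXinv : X = ⋃ a, φ a '' X)
    (π : (ℕ → A) → EuclideanSpace ℝ (Fin d))
    (hπ : ∀ (σ : ℕ → A) (n : ℕ), π σ ∈ iterMap φ (fun i : Fin n => σ i) '' X)
    -- the open set condition
    (hosc : ∃ O : Set (EuclideanSpace ℝ (Fin d)), O.Nonempty ∧ IsOpen O ∧
      Bornology.IsBounded O ∧ (∀ a, φ a '' O ⊆ O) ∧
      ∀ a b, a ≠ b → Disjoint (φ a '' O) (φ b '' O))
    -- the similarity dimension
    (sdim : ℝ) (hsdim : 0 < sdim) (hsum1 : ∑ a : A, r a ^ sdim = 1)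
    -- the entropy condition `h_p < −2 log Σ p_a²` for `p_a = r_a ^ sdim`
    (hent : (-∑ a : A, r a ^ sdim * Real.log (r a ^ sdim)) <
      -2 * Real.log (∑ a : A, (r a ^ sdim) ^ 2))
    (g : ℕ → ℝ) (hg0 : ∀ n, 0 ≤ g n) (hganti : ∀ n, 1 ≤ n → g (n + 1) ≤ g n)
    (hdiv : ¬ Summable fun n : ℕ =>
      ∑ a : Fin n → A, (n : ℝ) * (Metric.diam (iterMap φ a '' X) * g n) ^ sdim)
    (t : ℝ) (ht : 1 ≤ t) :
    μH[(dimH X).toReal / t]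
        (limsupW π (fun n a => (Metric.diam (iterMap φ a '' X) * g n) ^ t)) =
      μH[(dimH X).toReal / t] X := by
  let _ : TopologicalSpace A := ⊥
  have : DiscreteTopology A := ⟨rfl⟩
  let _ : MeasurableSpace A := ⊤
  have : MeasurableSingletonClass A := ⟨fun _ => trivial⟩
  have hp : ∀ a, 0 ≤ r a ^ sdim := fun a => Real.rpow_nonneg (hr a).1.le _
  set m : Measure A := ∑ a, ENNReal.ofReal (r a ^ sdim) • Measure.dirac a with hm
  have hprob : IsProbabilityMeasure m := ⟨by
    simp [hm, Measure.finsetSum_apply, ← ENNReal.ofReal_sum_of_nonneg fun a _ => hp a, hsum1]⟩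
  have hsingle : ∀ a, m.real {a} = r a ^ sdim := by
    classical
    intro a
    rw [Measure.real, hm, Measure.finsetSum_apply, Finset.sum_eq_single a]
    · simp [hp a]
    · intro b _ hb
      simp [hb]
    · simp
  have hdiam : 0 < Metric.diam X := by
    refine Metric.diam_nonneg.lt_of_ne fun h0 => hdiv ?_
    have hX : X.Subsingleton := by
      rw [← Metric.ediam_eq_zero_iff]
      rw [Metric.diam, eq_comm, ENNReal.toReal_eq_zero_iff] at h0
      exact h0.resolve_right hXcomp.isBounded.ediam_ne_top
    have : ∀ (n : ℕ) (a : Fin n → A), Metric.diam (iterMap φ a '' X) = 0 := fun n a =>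
      Metric.diam_subsingleton (hX.image _)
    simp only [this, zero_mul, Real.zero_rpow hsdim.ne', mul_zero, Finset.sum_const_zero]
    exact summable_zero
  have h : CodedIFS φ r X π sdim m :=
    ⟨fun a => (hr a).1, fun a => (hr a).2, hsim, hXcomp, hXinv, hπ, hsdim, hsum1, hdiam, hsingle⟩
  rw [h.dimH_eq hosc]
  refine h.hausdorffMeasure_limsupW hosc hg0 hganti (fun hsum => hdiv ?_) ht
  simp only [h.sum_mul_diam_rpow (hg0 _)]
  exact hsum.mul_left _
end
end

section
/- Let A be a finite set with #A ≥ 2, let p = (p_a)_{a∈A} be a probability vector with p_a < 1 for every a (so Σ_{a∈A} p_a² < 1), and let 𝔪 be the Bernoulli product measure on A^ℕ with marginal p. For n ≥ 1 set k_n := ⌊(−log n)/log(Σ_{a∈A} p_a²)⌋ + 1, and let F_n := {a ∈ A^n : C_{k_n}(a) ≥ ⌊n/10⌋}, where C_t(a) is the number of distinct words of length t occurring as contiguous subwords of a. Then there exists N such that for all n ≥ N, 𝔪(⋃_{a∈F_n}[a]) ≥ 7/32. -/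
open MeasureTheory Filter Set
open scoped ENNReal

noncomputable section

/-- `k_n = ⌊(−log n)/log(Σ_{a∈A} p_a²)⌋ + 1`. -/
def knp {A : Type*} [Fintype A] (p : A → ℝ) (n : ℕ) : ℕ :=
  (⌊(-Real.log n) / Real.log (∑ a, p a ^ 2)⌋).toNat + 1

open ProbabilityTheory in
/-- Under independent coordinates, events determined by disjoint finite sets of coordinates are
independent. -/
theorem measure_inter_eq_mul_of_dependsOn {ι A : Type*} [Finite A] [MeasurableSpace A]
    [MeasurableSingletonClass A] {𝔪 : Measure (ι → A)}
    (hind : iIndepFun (fun (i : ι) (σ : ι → A) => σ i) 𝔪) {S T : Finset ι} (hST : Disjoint S T)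
    {E F : Set (ι → A)} (hE : DependsOn (· ∈ E) (S : Set ι)) (hF : DependsOn (· ∈ F) (T : Set ι)) :
    𝔪 (E ∩ F) = 𝔪 E * 𝔪 F := by
  have key : ∀ (R : Finset ι) (G : Set (ι → A)), DependsOn (· ∈ G) (R : Set ι) →
      G = (fun (σ : ι → A) (i : R) => σ i) ⁻¹' ((fun (σ : ι → A) (i : R) => σ i) '' G) := by
    intro R G hG
    refine subset_antisymm (subset_preimage_image _ _) ?_
    rintro σ ⟨τ, hτ, h⟩
    exact (hG fun i hi => congrFun h ⟨i, hi⟩).mp hτ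
  have h := (hind.indepFun_finset S T hST fun i => measurable_pi_apply i).measure_inter_preimage_eq_mul
    ((fun (σ : ι → A) (i : S) => σ i) '' E) ((fun (σ : ι → A) (i : T) => σ i) '' F)
    (.of_discrete) (.of_discrete)
  rwa [← key S E hE, ← key T F hF] at h

theorem measurableSet_eval_eq_eval {A : Type*} [Finite A] [MeasurableSpace A]
    [MeasurableSingletonClass A] (x y : ℕ) : MeasurableSet {σ : ℕ → A | σ x = σ y} :=
  measurableSet_eq_fun (measurable_pi_apply x) (measurable_pi_apply y)

open ProbabilityTheory in
/-- A measure giving cylinders the product masses is an infinite product measure. -/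
theorem exists_eq_infinitePi_of_cyl {A : Type*} [Fintype A] [MeasurableSpace A]
    [MeasurableSingletonClass A] {p : A → ℝ} (hp0 : ∀ a, 0 ≤ p a) (hpsum : ∑ a, p a = 1)
    {𝔪 : Measure (ℕ → A)}
    (h𝔪 : ∀ (n : ℕ) (a : Fin n → A), 𝔪 (cyl a) = ENNReal.ofReal (∏ i, p (a i))) :
    ∃ (μ : Measure A) (_ : IsProbabilityMeasure μ), (∀ a, μ {a} = ENNReal.ofReal (p a)) ∧
      𝔪 = Measure.infinitePi (fun _ : ℕ => μ) := by
  classical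
  let μ : Measure A := ∑ a, ENNReal.ofReal (p a) • Measure.dirac a
  have hμs : ∀ a, μ {a} = ENNReal.ofReal (p a) := by
    intro a
    simp [μ, Measure.finsetSum_apply, Set.indicator_apply]
  have hμ : IsProbabilityMeasure μ := by
    constructor
    simp [μ, Measure.finsetSum_apply, ← ENNReal.ofReal_sum_of_nonneg (fun a _ => hp0 a), hpsum]
  refine ⟨μ, hμ, hμs, ?_⟩
  have hmap : ∀ N : ℕ, 𝔪.map (fun σ (i : Fin N) => σ i) = Measure.pi (fun _ => μ) := by
    intro N
    refine Measure.ext_of_singleton fun a => ?_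
    rw [Measure.map_apply (by fun_prop) (measurableSet_singleton a), Measure.pi_singleton]
    have : (fun (σ : ℕ → A) (i : Fin N) => σ i) ⁻¹' {a} = cyl a := by
      ext σ
      simp [cyl, funext_iff]
    rw [this, h𝔪, ENNReal.ofReal_prod_of_nonneg fun i _ => hp0 _]
    simp [hμs]
  refine Measure.eq_infinitePi _ fun s t ht => ?_
  obtain ⟨N, hN⟩ : ∃ N, s ⊆ Finset.range N := s.exists_nat_subset_range
  have hpre : Set.pi (s : Set ℕ) t = (fun (σ : ℕ → A) (i : Fin N) => σ i) ⁻¹'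
      Set.pi Set.univ (fun i : Fin N => if (i : ℕ) ∈ s then t i else Set.univ) := by
    ext σ
    simp only [Set.mem_pi, Set.mem_preimage, Set.mem_univ, true_imp_iff, Finset.mem_coe]
    constructor
    · intro h i
      split_ifs with hi
      · exact h i hi
      · trivial
    · intro h i hi
      simpa [hi] using h ⟨i, Finset.mem_range.mp (hN hi)⟩
  rw [hpre, ← Measure.map_apply (by fun_prop) (.of_discrete), hmap, Measure.pi_pi,
    Fin.prod_univ_eq_prod_range (fun i => μ (if i ∈ s then t i else Set.univ)) N,
    ← Finset.prod_subset hN]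
  · exact Finset.prod_congr rfl fun i hi => by rw [if_pos hi]
  · intro i _ hi
    simp [hi]

/-- The event that the words of length `k` at positions `l'` and `l` coincide. -/
def matchEvent (A : Type*) (l' l k : ℕ) : Set (ℕ → A) := {σ | ∀ i < k, σ (l' + i) = σ (l + i)}

theorem matchEvent_zero (A : Type*) (l' l : ℕ) : matchEvent A l' l 0 = Set.univ := by
  simp [matchEvent]

theorem matchEvent_succ (A : Type*) (l' l k : ℕ) :
    matchEvent A l' l (k + 1) = matchEvent A l' l k ∩ {σ | σ (l' + k) = σ (l + k)} := by
  ext σ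
  simp only [matchEvent, Set.mem_ofPred_eq, Set.mem_inter_iff]
  exact Nat.forall_lt_succ_right

theorem measurableSet_matchEvent {A : Type*} [Finite A] [MeasurableSpace A]
    [MeasurableSingletonClass A] (l' l k : ℕ) : MeasurableSet (matchEvent A l' l k) := by
  induction k with
  | zero => simp [matchEvent_zero]
  | succ k ih =>
    rw [matchEvent_succ]
    exact ih.inter (measurableSet_eval_eq_eval _ _)

theorem dependsOn_matchEvent (A : Type*) (l' l k : ℕ) :
    DependsOn (· ∈ matchEvent A l' l k)
      ((Finset.Ico l' (l' + k) ∪ Finset.Ico l (l + k) : Finset ℕ) : Set ℕ) := by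
  intro σ τ h
  simp only [Finset.coe_union, Finset.coe_Ico, Set.mem_union, Set.mem_Ico] at h
  simp only [matchEvent, Set.mem_ofPred_eq, eq_iff_iff]
  refine forall₂_congr fun i hi => ?_
  rw [h (l' + i) (by omega), h (l + i) (by omega)]

open ProbabilityTheory in
/-- Two disjoint words of length `k` coincide with probability at most `(∑ p_a²)^k`. -/
theorem measure_matchEvent_le_of_disjoint {A : Type*} [Fintype A] [MeasurableSpace A]
    [MeasurableSingletonClass A] {p : A → ℝ} (hp0 : ∀ a, 0 ≤ p a) {𝔪 : Measure (ℕ → A)}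
    [IsProbabilityMeasure 𝔪] (hind : iIndepFun (fun (i : ℕ) (σ : ℕ → A) => σ i) 𝔪)
    (hone : ∀ i a, 𝔪 {σ | σ i = a} = ENNReal.ofReal (p a)) {l' l K : ℕ} (hl : l' + K ≤ l) :
    ∀ k ≤ K, 𝔪 (matchEvent A l' l k) ≤ ENNReal.ofReal (∑ a, p a ^ 2) ^ k := by
  intro k
  induction k with
  | zero => simp [matchEvent_zero]
  | succ k ih =>
    intro hk
    have hpair : 𝔪 {σ | σ (l' + k) = σ (l + k)} ≤ ENNReal.ofReal (∑ a, p a ^ 2) := by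
      calc 𝔪 {σ | σ (l' + k) = σ (l + k)}
          ≤ 𝔪 (⋃ a, {σ : ℕ → A | σ (l' + k) = a} ∩ {σ | σ (l + k) = a}) := by
            refine measure_mono fun σ hσ => ?_
            simp only [Set.mem_ofPred_eq] at hσ
            simp [hσ]
        _ ≤ ∑ a, 𝔪 ({σ : ℕ → A | σ (l' + k) = a} ∩ {σ | σ (l + k) = a}) :=
            measure_iUnion_fintype_le _ _
        _ = ENNReal.ofReal (∑ a, p a ^ 2) := by
            rw [ENNReal.ofReal_sum_of_nonneg fun a _ => sq_nonneg _]
            refine Finset.sum_congr rfl fun a _ => ?_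
            rw [measure_inter_eq_mul_of_dependsOn hind (S := {l' + k}) (T := {l + k})
              (by rw [Finset.disjoint_singleton]; omega) (fun σ τ h => by simp_all)
              (fun σ τ h => by simp_all), hone, hone, sq, ENNReal.ofReal_mul (hp0 a)]
    rw [matchEvent_succ, measure_inter_eq_mul_of_dependsOn hind (T := {l' + k, l + k}) ?_
      (dependsOn_matchEvent A l' l k) (fun σ τ h => by simp_all), pow_succ]
    · exact mul_le_mul' (ih (by omega)) hpair
    · rw [Finset.disjoint_left]
      intro x hx
      simp only [Finset.mem_union, Finset.mem_Ico] at hx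
      simp only [Finset.mem_insert, Finset.mem_singleton]
      omega

open ProbabilityTheory in
/-- Words of length `k` at distinct positions coincide with probability at most `(max p_a)^k`. -/
theorem measure_matchEvent_le_of_lt {A : Type*} [Fintype A] [MeasurableSpace A]
    [MeasurableSingletonClass A] {p : A → ℝ} {q : ℝ} (hpq : ∀ a, p a ≤ q) {𝔪 : Measure (ℕ → A)}
    [IsProbabilityMeasure 𝔪] (hind : iIndepFun (fun (i : ℕ) (σ : ℕ → A) => σ i) 𝔪)
    (hone : ∀ i a, 𝔪 {σ | σ i = a} = ENNReal.ofReal (p a)) {l' l : ℕ} (hl : l' < l) (k : ℕ) :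
    𝔪 (matchEvent A l' l k) ≤ ENNReal.ofReal q ^ k := by
  induction k with
  | zero => simp [matchEvent_zero]
  | succ k ih =>
    have hmeas : ∀ a, MeasurableSet (matchEvent A l' l k ∩ {σ | σ (l' + k) = a}) := fun a =>
      (measurableSet_matchEvent _ _ _).inter
        (measurableSet_eq_fun (measurable_pi_apply (l' + k)) measurable_const)
    calc 𝔪 (matchEvent A l' l (k + 1))
        ≤ 𝔪 (⋃ a, (matchEvent A l' l k ∩ {σ | σ (l' + k) = a}) ∩ {σ | σ (l + k) = a}) := by
          refine measure_mono fun σ hσ => ?_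
          rw [matchEvent_succ] at hσ
          simpa [hσ.1] using hσ.2.symm
      _ ≤ ∑ a, 𝔪 ((matchEvent A l' l k ∩ {σ | σ (l' + k) = a}) ∩ {σ | σ (l + k) = a}) :=
          measure_iUnion_fintype_le _ _
      _ ≤ ∑ a, 𝔪 (matchEvent A l' l k ∩ {σ | σ (l' + k) = a}) * ENNReal.ofReal q := by
          refine Finset.sum_le_sum fun a _ => ?_
          rw [measure_inter_eq_mul_of_dependsOn hind (S := Finset.range (l + k)) (T := {l + k})
            (by simp) ?_ (fun σ τ h => by simp_all), hone]
          · gcongr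
            exact hpq a
          · intro σ τ h
            have h1 := dependsOn_matchEvent A l' l k (x := σ) (y := τ) fun i hi => h i <| by
              simp only [Finset.coe_union, Finset.coe_Ico, Set.mem_union, Set.mem_Ico] at hi
              simp only [Finset.coe_range, Set.mem_Iio]
              omega
            have h2 := h (l' + k) (by simp; omega)
            simp only [Set.mem_inter_iff, Set.mem_ofPred_eq, h2]
            simp only at h1
            rw [h1]
      _ = 𝔪 (matchEvent A l' l k) * ENNReal.ofReal q := by
          rw [← Finset.sum_mul, ← measure_biUnion_finset _ fun a _ => hmeas a]
          · congr 2
            ext σ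
            simp
          · intro a _ b _ hab
            rw [Function.onFun, Set.disjoint_left]
            rintro σ ⟨_, h1⟩ ⟨_, h2⟩
            exact hab (h1.symm.trans h2)
      _ ≤ ENNReal.ofReal q ^ (k + 1) := by
          rw [pow_succ]
          gcongr

open Classical in
/-- The number of positions is at most the number of distinct words plus the number of pairs of
positions carrying the same word. -/
theorem card_positions_le_ncard_add_sum {A : Type*} [Finite A] (σ : ℕ → A) {m n k : ℕ}
    (hm : ∀ l < m, l + k ≤ n) :
    m ≤ Set.ncard {w : Fin k → A | ∃ l : ℕ, l + k ≤ n ∧ ∀ i : Fin k, w i = σ (l + i)} +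
      ∑ l ∈ Finset.range m, ∑ l' ∈ Finset.range l, if σ ∈ matchEvent A l' l k then 1 else 0 := by
  set P : ℕ → Prop := fun l => ∃ l' < l, σ ∈ matchEvent A l' l k
  have hcard := Finset.card_filter_add_card_filter_not (s := Finset.range m) P
  rw [Finset.card_range] at hcard
  have hbad : ((Finset.range m).filter P).card ≤
      ∑ l ∈ Finset.range m, ∑ l' ∈ Finset.range l,
        if σ ∈ matchEvent A l' l k then 1 else 0 := by
    rw [Finset.card_filter]
    refine Finset.sum_le_sum fun l _ => ?_
    split_ifs with h
    · obtain ⟨l', hl', hmatch⟩ := h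
      have := Finset.single_le_sum
        (f := fun l' => if σ ∈ matchEvent A l' l k then 1 else 0) (fun _ _ => Nat.zero_le _)
        (Finset.mem_range.mpr hl')
      simpa [hmatch] using this
    · exact Nat.zero_le _
  have hgood : ((Finset.range m).filter fun l => ¬ P l).card ≤
      Set.ncard {w : Fin k → A | ∃ l : ℕ, l + k ≤ n ∧ ∀ i : Fin k, w i = σ (l + i)} := by
    rw [← Set.ncard_coe_finset]
    refine Set.ncard_le_ncard_of_injOn (fun l (i : Fin k) => σ (l + i)) ?_ ?_ (Set.toFinite _)
    · intro l hl
      simp only [Finset.coe_filter, Finset.mem_range, Set.mem_ofPred_eq] at hl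
      exact ⟨l, hm l hl.1, fun i => rfl⟩
    · intro l hl r hr h
      simp only [Finset.coe_filter, Finset.mem_range, Set.mem_ofPred_eq] at hl hr
      by_contra hne
      rcases lt_or_gt_of_ne hne with hlt | hlt
      · exact hr.2 ⟨l, hlt, fun i hi => congrFun h ⟨i, hi⟩⟩
      · exact hl.2 ⟨r, hlt, fun i hi => (congrFun h ⟨i, hi⟩).symm⟩
  omega

/-- Expected number of coinciding pairs among the first `m` positions. -/
theorem sum_measure_matchEvent_le {A : Type*} [MeasurableSpace A] {𝔪 : Measure (ℕ → A)}
    {k : ℕ} {x y : ℝ} (hx : 0 ≤ x) (hy : 0 ≤ y)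
    (hfar : ∀ l' l, l' + k ≤ l → 𝔪 (matchEvent A l' l k) ≤ ENNReal.ofReal x)
    (hnear : ∀ l' l, l' < l → 𝔪 (matchEvent A l' l k) ≤ ENNReal.ofReal y) (m : ℕ) :
    ∑ l ∈ Finset.range m, ∑ l' ∈ Finset.range l, 𝔪 (matchEvent A l' l k) ≤
      ENNReal.ofReal (m ^ 2 / 2 * x + m * (k * y)) := by
  have hrow : ∀ l : ℕ, ∑ l' ∈ Finset.range l, 𝔪 (matchEvent A l' l k) ≤
      ENNReal.ofReal (l * x + k * y) := by
    intro l
    have hsplit : ∑ l' ∈ Finset.range l, 𝔪 (matchEvent A l' l k) ≤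
        ∑ l' ∈ Finset.range l, ENNReal.ofReal (x + if l < l' + k then y else 0) := by
      refine Finset.sum_le_sum fun l' hl' => ?_
      split_ifs with h
      · exact (hnear l' l (Finset.mem_range.mp hl')).trans
          (ENNReal.ofReal_le_ofReal (by linarith))
      · exact (hfar l' l (not_lt.mp h)).trans (ENNReal.ofReal_le_ofReal (by linarith))
    refine hsplit.trans ?_
    rw [← ENNReal.ofReal_sum_of_nonneg fun l' _ => by split_ifs <;> positivity]
    refine ENNReal.ofReal_le_ofReal ?_
    rw [Finset.sum_add_distrib, ← Finset.sum_filter, Finset.sum_const, Finset.sum_const,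
      Finset.card_range, nsmul_eq_mul, nsmul_eq_mul]
    have hc : ((Finset.range l).filter fun l' => l < l' + k).card ≤ k := by
      calc _ ≤ (Finset.Ico (l - k) l).card := by
            refine Finset.card_le_card fun l' hl' => ?_
            simp only [Finset.mem_filter, Finset.mem_range, Finset.mem_Ico] at hl' ⊢
            omega
        _ ≤ k := by rw [Nat.card_Ico]; omega
    gcongr
  refine (Finset.sum_le_sum fun l _ => hrow l).trans ?_
  rw [← ENNReal.ofReal_sum_of_nonneg fun l _ => by positivity]
  refine ENNReal.ofReal_le_ofReal ?_
  rw [Finset.sum_add_distrib, ← Finset.sum_mul, Finset.sum_const, Finset.card_range, nsmul_eq_mul]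
  have hg : ∑ l ∈ Finset.range m, (l : ℝ) ≤ m ^ 2 / 2 := by
    induction m with
    | zero => simp
    | succ m ih =>
      rw [Finset.sum_range_succ]
      push_cast
      nlinarith
  gcongr

theorem log_div_neg_log_le_knp {A : Type*} [Fintype A] (p : A → ℝ) (n : ℕ) :
    Real.log n / (-Real.log (∑ a, p a ^ 2)) ≤ knp p n := by
  have h1 := (Int.lt_floor_add_one ((-Real.log n) / Real.log (∑ a, p a ^ 2))).le
  rw [div_neg, ← neg_div, knp]
  refine h1.trans ?_
  push_cast
  gcongr
  exact_mod_cast Int.self_le_toNat _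

theorem pow_knp_le_one_div {A : Type*} [Fintype A] {p : A → ℝ}
    (hs0 : 0 < ∑ a, p a ^ 2) (hs1 : ∑ a, p a ^ 2 < 1) {n : ℕ} (hn : 1 ≤ n) :
    (∑ a, p a ^ 2) ^ knp p n ≤ 1 / n := by
  have hn' : (0 : ℝ) < n := by exact_mod_cast hn
  have hlog := Real.log_neg hs0 hs1
  rw [← Real.log_le_log_iff (by positivity) (by positivity), Real.log_pow, one_div, Real.log_inv]
  have h := log_div_neg_log_le_knp p n
  rw [div_le_iff₀ (neg_pos.mpr hlog)] at h
  linarith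

theorem knp_le {A : Type*} [Fintype A] {p : A → ℝ}
    (hs0 : 0 < ∑ a, p a ^ 2) (hs1 : ∑ a, p a ^ 2 < 1) (n : ℕ) :
    (knp p n : ℝ) ≤ Real.log n / (-Real.log (∑ a, p a ^ 2)) + 1 := by
  have hlog := Real.log_neg hs0 hs1
  have h0 : 0 ≤ (-Real.log n) / Real.log (∑ a, p a ^ 2) :=
    div_nonneg_of_nonpos (by simpa using Real.log_natCast_nonneg n) hlog.le
  have h1 := Int.floor_le ((-Real.log n) / Real.log (∑ a, p a ^ 2))
  rw [knp, div_neg, ← neg_div]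
  push_cast
  gcongr
  refine le_trans (le_of_eq ?_) h1
  exact_mod_cast Int.toNat_of_nonneg (Int.floor_nonneg.mpr h0)

theorem tendsto_knp_atTop {A : Type*} [Fintype A] {p : A → ℝ}
    (hs0 : 0 < ∑ a, p a ^ 2) (hs1 : ∑ a, p a ^ 2 < 1) : Tendsto (knp p) atTop atTop := by
  have hlog := Real.log_neg hs0 hs1
  rw [← tendsto_natCast_atTop_iff (R := ℝ)]
  have hlim : Tendsto (fun n : ℕ => Real.log n / (-Real.log (∑ a, p a ^ 2))) atTop atTop :=
    (Real.tendsto_log_atTop.comp tendsto_natCast_atTop_atTop).atTop_div_const (by linarith)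
  exact tendsto_atTop_mono (log_div_neg_log_le_knp p) hlim

theorem eventually_knp_le_div {A : Type*} [Fintype A] {p : A → ℝ}
    (hs0 : 0 < ∑ a, p a ^ 2) (hs1 : ∑ a, p a ^ 2 < 1) {ε : ℝ} (hε : 0 < ε) :
    ∀ᶠ n : ℕ in atTop, (knp p n : ℝ) ≤ ε * n := by
  have hlog : 0 < -Real.log (∑ a, p a ^ 2) := neg_pos.mpr (Real.log_neg hs0 hs1)
  set c := -Real.log (∑ a, p a ^ 2) with hc
  have h1 := (Real.isLittleO_log_id_atTop.def (c := ε / 2 * c) (by positivity)).natCast_atTop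
  have h2 : ∀ᶠ n : ℕ in atTop, 2 / ε ≤ (n : ℝ) :=
    tendsto_natCast_atTop_atTop.eventually_ge_atTop _
  filter_upwards [h1, h2] with n h1 h2
  refine (knp_le hs0 hs1 n).trans ?_
  rw [← hc]
  simp only [id, Real.norm_eq_abs, abs_of_nonneg (Real.log_natCast_nonneg n), Nat.abs_cast] at h1
  have h3 : Real.log n / c ≤ ε / 2 * n := by
    rw [div_le_iff₀ hlog]
    linarith
  rw [div_le_iff₀ hε] at h2
  linarith

/-- Lemma 3.1 of the paper: for all sufficiently large `n`, the union of
the cylinders `[a]` over words `a ∈ A^n` having at least `⌊n/10⌋` distinct contiguous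
subwords of length `k_n` has `𝔪`-measure at least `7/32`. -/
theorem statement13 {A : Type*} [Fintype A] [MeasurableSpace A] [MeasurableSingletonClass A]
    (hA : 2 ≤ Fintype.card A)
    (p : A → ℝ) (hp0 : ∀ a, 0 ≤ p a) (hp1 : ∀ a, p a < 1) (hpsum : ∑ a, p a = 1)
    (𝔪 : Measure (ℕ → A)) [IsProbabilityMeasure 𝔪]
    (h𝔪 : ∀ (n : ℕ) (a : Fin n → A), 𝔪 (cyl a) = ENNReal.ofReal (∏ i, p (a i))) :
    ∃ N : ℕ, ∀ n ≥ N,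
      (7 : ℝ≥0∞) / 32 ≤ 𝔪 {σ : ℕ → A |
        n / 10 ≤ Set.ncard {w : Fin (knp p n) → A |
          ∃ l : ℕ, l + knp p n ≤ n ∧ ∀ i : Fin (knp p n), w i = σ (l + i)}} := by
  classical
  obtain ⟨μ, hμ, hμp, rfl⟩ := exists_eq_infinitePi_of_cyl hp0 hpsum h𝔪
  set 𝔪 := Measure.infinitePi (fun _ : ℕ => μ)
  have hind : ProbabilityTheory.iIndepFun (fun (i : ℕ) (σ : ℕ → A) => σ i) 𝔪 :=
    ProbabilityTheory.iIndepFun_infinitePi (P := fun _ : ℕ => μ) (X := fun _ a => a)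
      fun _ => measurable_id
  have hone : ∀ i a, 𝔪 {σ | σ i = a} = ENNReal.ofReal (p a) := by
    intro i a
    rw [← hμp, ← Measure.infinitePi_map_eval (fun _ : ℕ => μ) i,
      Measure.map_apply (measurable_pi_apply i) (measurableSet_singleton a)]
    rfl
  have : Nonempty A := Fintype.card_pos_iff.mp (by omega)
  obtain ⟨b, hb⟩ := Finite.exists_max p
  have hq0 : 0 ≤ p b := hp0 b
  have hs1 : ∑ a, p a ^ 2 < 1 := by
    calc ∑ a, p a ^ 2 ≤ ∑ a, p b * p a :=
          Finset.sum_le_sum fun a _ => by nlinarith [hb a, hp0 a]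
      _ = p b := by rw [← Finset.mul_sum, hpsum, mul_one]
      _ < 1 := hp1 b
  have hs0 : 0 < ∑ a, p a ^ 2 := by
    obtain ⟨a, -, ha⟩ := Finset.exists_ne_zero_of_sum_ne_zero (hpsum.trans_ne one_ne_zero)
    exact Finset.sum_pos' (fun a _ => sq_nonneg _) ⟨a, Finset.mem_univ a, by positivity⟩
  have hkq : ∀ᶠ n : ℕ in atTop, (knp p n : ℝ) * p b ^ knp p n ≤ 1 / 10 :=
    ((tendsto_self_mul_const_pow_of_lt_one hq0 (hp1 b)).comp
      (tendsto_knp_atTop hs0 hs1)).eventually_le_const (by norm_num)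
  have hev := (hkq.and (eventually_knp_le_div hs0 hs1 (ε := 1 / 10) (by norm_num))).and
    (eventually_ge_atTop 1)
  obtain ⟨N, hN⟩ := eventually_atTop.mp hev
  refine ⟨N, fun n hn => ?_⟩
  obtain ⟨⟨hkq, hkn⟩, hn1⟩ := hN n hn
  have hpow := pow_knp_le_one_div hs0 hs1 hn1
  set k := knp p n
  have hn0 : (0 : ℝ) < n := by exact_mod_cast hn1
  have hmean := sum_measure_matchEvent_le (𝔪 := 𝔪) (k := k) (pow_nonneg hs0.le k)
    (pow_nonneg hq0 k)
    (fun l' l h => by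
      rw [ENNReal.ofReal_pow hs0.le]
      exact measure_matchEvent_le_of_disjoint hp0 hind hone h k le_rfl)
    (fun l' l h => by
      rw [ENNReal.ofReal_pow hq0]
      exact measure_matchEvent_le_of_lt hb hind hone h k) (n - k)
  have hmn : ((n - k : ℕ) : ℝ) ≤ n := by exact_mod_cast Nat.sub_le n k
  have hmean' : ∑ l ∈ Finset.range (n - k), ∑ l' ∈ Finset.range l, 𝔪 (matchEvent A l' l k) ≤
      ENNReal.ofReal (3 / 5 * n) := by
    refine hmean.trans (ENNReal.ofReal_le_ofReal ?_)
    calc ((n - k : ℕ) : ℝ) ^ 2 / 2 * (∑ a, p a ^ 2) ^ k + ((n - k : ℕ) : ℝ) * (k * p b ^ k)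
        ≤ (n : ℝ) ^ 2 / 2 * (1 / n) + n * (1 / 10) := by gcongr
      _ = 3 / 5 * (n : ℝ) := by field_simp; norm_num
  let X : (ℕ → A) → ℝ≥0∞ := fun σ => ∑ l ∈ Finset.range (n - k), ∑ l' ∈ Finset.range l,
    (matchEvent A l' l k).indicator 1 σ
  have hXm : Measurable X := by
    refine Finset.measurable_fun_sum _ fun l _ => Finset.measurable_fun_sum _ fun l' _ => ?_
    exact measurable_one.indicator (measurableSet_matchEvent l' l k)
  have hXint : ∫⁻ σ, X σ ∂𝔪 ≤ ENNReal.ofReal (3 / 5 * n) := by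
    refine le_trans (le_of_eq ?_) hmean'
    rw [lintegral_finsetSum _ fun l _ => Finset.measurable_fun_sum _ fun l' _ =>
      measurable_one.indicator (measurableSet_matchEvent l' l k)]
    refine Finset.sum_congr rfl fun l _ => ?_
    rw [lintegral_finsetSum _ fun l' _ =>
      measurable_one.indicator (measurableSet_matchEvent l' l k)]
    exact Finset.sum_congr rfl fun l' _ => lintegral_indicator_one (measurableSet_matchEvent l' l k)
  set G : Set (ℕ → A) := {σ | n / 10 ≤ Set.ncard {w : Fin k → A |
    ∃ l : ℕ, l + k ≤ n ∧ ∀ i : Fin k, w i = σ (l + i)}} with hG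
  have hsub : Gᶜ ⊆ {σ | ENNReal.ofReal (4 / 5 * n) ≤ X σ} := by
    intro σ hσ
    simp only [hG, Set.mem_compl_iff, Set.mem_ofPred_eq, not_le] at hσ
    have hcount := card_positions_le_ncard_add_sum σ (m := n - k) (n := n) (k := k)
      fun l hl => by omega
    set Y := ∑ l ∈ Finset.range (n - k), ∑ l' ∈ Finset.range l,
      if σ ∈ matchEvent A l' l k then 1 else 0 with hY
    have hXY : X σ = (Y : ℝ≥0∞) := by
      simp only [X, hY]
      push_cast
      simp only [Set.indicator_apply, Pi.one_apply]
    have hYn : 4 / 5 * (n : ℝ) ≤ Y := by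
      have h10 : 10 * k ≤ n := by
        have : 10 * (k : ℝ) ≤ n := by linarith
        exact_mod_cast this
      have : 4 * n ≤ 5 * Y := by omega
      have : 4 * (n : ℝ) ≤ 5 * Y := by exact_mod_cast this
      linarith
    simp only [Set.mem_ofPred_eq]
    rw [hXY, ← ENNReal.ofReal_natCast]
    exact ENNReal.ofReal_le_ofReal hYn
  have hcompl : 𝔪 Gᶜ ≤ 25 / 32 := by
    have hpos : 0 < 4 / 5 * (n : ℝ) := by positivity
    calc 𝔪 Gᶜ ≤ 𝔪 {σ | ENNReal.ofReal (4 / 5 * n) ≤ X σ} := measure_mono hsub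
      _ ≤ (∫⁻ σ, X σ ∂𝔪) / ENNReal.ofReal (4 / 5 * n) :=
          meas_ge_le_lintegral_div hXm.aemeasurable (by simpa using hn0) ENNReal.ofReal_ne_top
      _ ≤ ENNReal.ofReal (3 / 5 * n) / ENNReal.ofReal (4 / 5 * n) := by gcongr
      _ = ENNReal.ofReal (3 / 4) := by
          rw [← ENNReal.ofReal_div_of_pos hpos]
          congr 1
          field_simp
      _ ≤ ENNReal.ofReal (25 / 32) := ENNReal.ofReal_le_ofReal (by norm_num)
      _ = 25 / 32 := by
          rw [ENNReal.ofReal_div_of_pos (by norm_num)]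
          norm_num
  have htotal : (1 : ℝ≥0∞) ≤ 𝔪 G + 25 / 32 := by
    calc (1 : ℝ≥0∞) = 𝔪 (G ∪ Gᶜ) := by rw [Set.union_compl_self, measure_univ]
      _ ≤ 𝔪 G + 𝔪 Gᶜ := measure_union_le _ _
      _ ≤ 𝔪 G + 25 / 32 := by gcongr
  have hsum : (7 : ℝ≥0∞) / 32 + 25 / 32 = 1 := by
    rw [ENNReal.div_add_div_same]
    norm_num
    exact ENNReal.div_self (by norm_num) (by simp)
  rw [← hsum] at htotal
  exact (ENNReal.add_le_add_iff_right (ENNReal.div_ne_top (by norm_num) (by norm_num))).mp htotal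
end
end

section
/- Let A be a finite set with #A ≥ 2, let r : A → (0,1), let p = (p_a)_{a∈A} be a probability vector with p_a < 1 for every a, and let 𝔪 be the Bernoulli product measure on A^ℕ with marginal p. Set χ := −Σ_{a∈A} p_a log r_a, h_p := −Σ_{a∈A} p_a log p_a, and k_n := ⌊(−log n)/log(Σ_{a∈A} p_a²)⌋ + 1. For ε > 0 and a ∈ A^n, let Bad(a,ε) be the set of l ∈ {0,…,n−k_n} such that ∏_{i=1}^{k_n} r_{a_{l+i}} ∉ [e^{k_n(−χ−ε)}, e^{k_n(−χ+ε)}] or ∏_{i=1}^{k_n} p_{a_{l+i}} ∉ [e^{k_n(−h_p−ε)}, e^{k_n(−h_p+ε)}], and set Bad(n,ε) := {a ∈ A^n : #Bad(a,ε) ≥ ⌊n/20⌋}. Then for every ε > 0 there exist γ ∈ (0,1) and C > 0 such that for all n ≥ 1, 𝔪(⋃_{a∈Bad(n,ε)}[a]) ≤ C·γ^{k_n}. -/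
open MeasureTheory Filter Set
open scoped ENNReal

noncomputable section

/-- A function of the form `t ↦ ∑ a, p a * exp (t * Y a)` with `∑ a, p a * Y a < 0` drops below `1`
immediately to the right of `0`. -/
theorem exists_pos_sum_mul_exp_lt_one {A : Type*} [Fintype A] (p Y : A → ℝ)
    (hpsum : ∑ a, p a = 1) (hY : ∑ a, p a * Y a < 0) :
    ∃ t > 0, ∑ a, p a * Real.exp (t * Y a) < 1 := by
  have hd : HasDerivAt (fun t : ℝ => ∑ a, p a * Real.exp (t * Y a)) (∑ a, p a * Y a) 0 := by
    refine HasDerivAt.fun_sum fun a _ => ?_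
    have h := (((hasDerivAt_id (0 : ℝ)).mul_const (Y a)).exp).const_mul (p a)
    simpa using h
  have hs := (hasDerivAt_iff_tendsto_slope.1 hd).mono_left
    (nhdsWithin_mono (0 : ℝ) (fun x (hx : x ∈ Ioi 0) => ne_of_gt hx))
  obtain ⟨t, ht, ht0⟩ := ((hs.eventually (Iio_mem_nhds hY)).and self_mem_nhdsWithin).exists
  have ht0 : 0 < t := ht0
  refine ⟨t, ht0, ?_⟩
  simp only [slope_def_field, sub_zero, zero_mul, Real.exp_zero, mul_one, hpsum] at ht
  have := (div_neg_iff.1 ht).resolve_left (fun h => by linarith [h.2])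
  linarith [this.1]

theorem lintegral_prod_of_cyl {A : Type*} [Fintype A] [MeasurableSpace A]
    [MeasurableSingletonClass A] (p : A → ℝ) (hp0 : ∀ a, 0 ≤ p a) (𝔪 : Measure (ℕ → A))
    (h𝔪 : ∀ (n : ℕ) (a : Fin n → A), 𝔪 (cyl a) = ENNReal.ofReal (∏ i, p (a i)))
    (n : ℕ) (G : ℕ → A → ℝ≥0∞) :
    ∫⁻ σ, ∏ i ∈ Finset.range n, G i (σ i) ∂𝔪 =
      ∏ i ∈ Finset.range n, ∑ a, G i a * ENNReal.ofReal (p a) := by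
  classical
  let π : (ℕ → A) → Fin n → A := fun σ i => σ i
  have hπ : Measurable π := by fun_prop
  have h1 : ∫⁻ σ, ∏ i ∈ Finset.range n, G i (σ i) ∂𝔪 =
      ∫⁻ x, ∏ i : Fin n, G i (x i) ∂(𝔪.map π) := by
    rw [lintegral_map (Measurable.of_discrete) hπ]
    simp only [π, Finset.prod_range]
  have h2 (x : Fin n → A) : (𝔪.map π) {x} = ∏ i, ENNReal.ofReal (p (x i)) := by
    rw [Measure.map_apply hπ (measurableSet_singleton x),
      ← ENNReal.ofReal_prod_of_nonneg fun i _ => hp0 _, ← h𝔪]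
    congr 1
    ext σ
    simp [cyl, π, funext_iff]
  rw [h1, lintegral_fintype, Finset.prod_range, Finset.prod_univ_sum, Fintype.piFinset_univ]
  simp only [h2, Finset.prod_mul_distrib]

theorem lintegral_prod_window_of_cyl {A : Type*} [Fintype A] [MeasurableSpace A]
    [MeasurableSingletonClass A] (p : A → ℝ) (hp0 : ∀ a, 0 ≤ p a) (hpsum : ∑ a, p a = 1)
    (𝔪 : Measure (ℕ → A))
    (h𝔪 : ∀ (n : ℕ) (a : Fin n → A), 𝔪 (cyl a) = ENNReal.ofReal (∏ i, p (a i)))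
    (l k : ℕ) (g : A → ℝ≥0∞) :
    ∫⁻ σ, ∏ i ∈ Finset.range k, g (σ (l + i)) ∂𝔪 = (∑ a, g a * ENNReal.ofReal (p a)) ^ k := by
  have hone : ∑ a, ENNReal.ofReal (p a) = 1 := by
    rw [← ENNReal.ofReal_sum_of_nonneg fun a _ => hp0 a, hpsum, ENNReal.ofReal_one]
  have h := lintegral_prod_of_cyl p hp0 𝔪 h𝔪 (l + k) (fun i a => if i < l then 1 else g a)
  have hl (f : ℕ → ℝ≥0∞) (hf : ∀ i < l, f i = 1) : ∏ i ∈ Finset.range l, f i = 1 :=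
    Finset.prod_eq_one fun i hi => hf i (Finset.mem_range.1 hi)
  simp only [Finset.prod_range_add] at h
  rw [hl (fun i => ∑ a, (if i < l then 1 else g a) * ENNReal.ofReal (p a))
    (fun i hi => by simp [hi, hone])] at h
  have h3 (σ : ℕ → A) : ∏ i ∈ Finset.range l, (if i < l then 1 else g (σ i)) = 1 :=
    hl _ fun i hi => by simp [hi]
  simpa [h3] using h

/-- Chernoff bound for the upper tail of window sums. -/
theorem exists_measure_window_sum_gt_le {A : Type*} [Fintype A] [MeasurableSpace A]
    [MeasurableSingletonClass A] (p : A → ℝ) (hp0 : ∀ a, 0 ≤ p a) (hpsum : ∑ a, p a = 1)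
    (𝔪 : Measure (ℕ → A))
    (h𝔪 : ∀ (n : ℕ) (a : Fin n → A), 𝔪 (cyl a) = ENNReal.ofReal (∏ i, p (a i)))
    (X : A → ℝ) {ε : ℝ} (hε : 0 < ε) :
    ∃ γ ∈ Ioo (0 : ℝ) 1, ∀ l k : ℕ,
      𝔪 {σ | k * (∑ a, p a * X a + ε) < ∑ i ∈ Finset.range k, X (σ (l + i))} ≤
        ENNReal.ofReal (γ ^ k) := by
  set m := ∑ a, p a * X a with hm
  obtain ⟨t, ht, hlt⟩ := exists_pos_sum_mul_exp_lt_one p (fun a => X a - (m + ε)) hpsum (by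
    simp only [mul_sub, Finset.sum_sub_distrib, ← Finset.sum_mul, hpsum, ← hm]
    linarith)
  have hnn : ∀ a ∈ Finset.univ, 0 ≤ p a * Real.exp (t * (X a - (m + ε))) :=
    fun a _ => mul_nonneg (hp0 a) (Real.exp_pos _).le
  refine ⟨_, ⟨?_, hlt⟩, fun l k => ?_⟩
  · obtain ⟨a, ha, hpa⟩ := Finset.exists_ne_zero_of_sum_ne_zero (hpsum.trans_ne one_ne_zero)
    exact Finset.sum_pos' hnn
      ⟨a, ha, mul_pos (lt_of_le_of_ne (hp0 a) (Ne.symm hpa)) (Real.exp_pos _)⟩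
  have hint := lintegral_prod_window_of_cyl p hp0 hpsum 𝔪 h𝔪 l k
    (fun a => ENNReal.ofReal (Real.exp (t * (X a - (m + ε)))))
  have heq : ∑ a, ENNReal.ofReal (Real.exp (t * (X a - (m + ε)))) * ENNReal.ofReal (p a) =
      ENNReal.ofReal (∑ a, p a * Real.exp (t * (X a - (m + ε)))) := by
    rw [ENNReal.ofReal_sum_of_nonneg hnn]
    refine Finset.sum_congr rfl fun a _ => ?_
    rw [← ENNReal.ofReal_mul (Real.exp_pos _).le, mul_comm]
  rw [heq, ← ENNReal.ofReal_pow (Finset.sum_nonneg hnn)] at hint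
  rw [← hint]
  have hmeas : Measurable fun a => ENNReal.ofReal (Real.exp (t * (X a - (m + ε)))) :=
    Measurable.of_discrete
  have hmk := mul_meas_ge_le_lintegral (μ := 𝔪)
    (f := fun σ => ∏ i ∈ Finset.range k,
      ENNReal.ofReal (Real.exp (t * (X (σ (l + i)) - (m + ε)))))
    (Finset.measurable_fun_prod _ fun i _ => hmeas.comp (measurable_pi_apply (l + i))) 1
  rw [one_mul] at hmk
  refine (measure_mono fun σ hσ => ?_).trans hmk
  simp only [mem_ofPred_eq] at hσ ⊢
  rw [← ENNReal.ofReal_prod_of_nonneg fun i _ => (Real.exp_pos _).le, ← Real.exp_sum,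
    ← Finset.mul_sum, Finset.sum_sub_distrib, Finset.sum_const, Finset.card_range, nsmul_eq_mul]
  exact ENNReal.one_le_ofReal.2 (Real.one_le_exp (mul_nonneg ht.le (by linarith)))

/-- Large deviation bound for window products; `q` need only be positive where `p` charges. -/
theorem exists_measure_window_prod_notMem_le {A : Type*} [Fintype A] [MeasurableSpace A]
    [MeasurableSingletonClass A] (p : A → ℝ) (hp0 : ∀ a, 0 ≤ p a) (hpsum : ∑ a, p a = 1)
    (𝔪 : Measure (ℕ → A))
    (h𝔪 : ∀ (n : ℕ) (a : Fin n → A), 𝔪 (cyl a) = ENNReal.ofReal (∏ i, p (a i)))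
    (q : A → ℝ) (hq : ∀ a, p a ≠ 0 → 0 < q a) {ε : ℝ} (hε : 0 < ε) :
    ∃ γ ∈ Ioo (0 : ℝ) 1, ∀ l k : ℕ,
      𝔪 {σ | ∏ i ∈ Finset.range k, q (σ (l + i)) ∉
        Icc (Real.exp (k * (∑ a, p a * Real.log (q a) - ε)))
          (Real.exp (k * (∑ a, p a * Real.log (q a) + ε)))} ≤ ENNReal.ofReal (2 * γ ^ k) := by
  have hnull (j : ℕ) : 𝔪 {σ | p (σ j) = 0} = 0 := by
    have h := lintegral_prod_window_of_cyl p hp0 hpsum 𝔪 h𝔪 j 1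
      ({a | p a = 0}.indicator 1)
    have hz : ∑ a, ({a | p a = 0}.indicator 1 a : ℝ≥0∞) * ENNReal.ofReal (p a) = 0 :=
      Finset.sum_eq_zero fun a _ => by by_cases ha : p a = 0 <;> simp [ha]
    have hm : MeasurableSet {σ : ℕ → A | p (σ j) = 0} :=
      (Set.toFinite {a | p a = 0}).measurableSet.preimage (measurable_pi_apply j)
    rw [hz] at h
    simp only [Finset.prod_range_one, add_zero, pow_one] at h
    rw [← lintegral_indicator_one hm, ← h]
    rfl
  have hpos : ∀ᵐ σ ∂𝔪, ∀ j, 0 < q (σ j) := by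
    rw [ae_all_iff]
    intro j
    have hj : ∀ᵐ σ ∂𝔪, p (σ j) ≠ 0 := by simpa [ae_iff] using hnull j
    exact hj.mono fun σ hσ => hq _ hσ
  obtain ⟨γ₁, hγ₁, h₁⟩ :=
    exists_measure_window_sum_gt_le p hp0 hpsum 𝔪 h𝔪 (fun a => Real.log (q a)) hε
  obtain ⟨γ₂, hγ₂, h₂⟩ :=
    exists_measure_window_sum_gt_le p hp0 hpsum 𝔪 h𝔪 (fun a => -Real.log (q a)) hε
  refine ⟨max γ₁ γ₂, ⟨lt_max_of_lt_left hγ₁.1, max_lt hγ₁.2 hγ₂.2⟩, fun l k => ?_⟩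
  have hle₁ : γ₁ ^ k ≤ max γ₁ γ₂ ^ k := pow_le_pow_left₀ hγ₁.1.le (le_max_left _ _) k
  have hle₂ : γ₂ ^ k ≤ max γ₁ γ₂ ^ k := pow_le_pow_left₀ hγ₂.1.le (le_max_right _ _) k
  have hnn : 0 ≤ max γ₁ γ₂ ^ k := (pow_pos (lt_max_of_lt_left hγ₁.1) k).le
  rw [two_mul, ENNReal.ofReal_add hnn hnn]
  refine le_trans ?_ (add_le_add ((h₁ l k).trans (ENNReal.ofReal_le_ofReal hle₁))
    ((h₂ l k).trans (ENNReal.ofReal_le_ofReal hle₂)))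
  refine le_trans (measure_mono_ae ?_) (measure_union_le _ _)
  filter_upwards [hpos] with σ hσ hbad
  have hexp : ∏ i ∈ Finset.range k, q (σ (l + i)) =
      Real.exp (∑ i ∈ Finset.range k, Real.log (q (σ (l + i)))) := by
    rw [Real.exp_sum]
    exact Finset.prod_congr rfl fun i _ => (Real.exp_log (hσ _)).symm
  change ∏ i ∈ Finset.range k, q (σ (l + i)) ∉ Icc _ _ at hbad
  change σ ∈ (_ ∪ _ : Set (ℕ → A))
  rw [mem_union, mem_ofPred_eq, mem_ofPred_eq]
  rw [hexp, mem_Icc, Real.exp_le_exp, Real.exp_le_exp, not_and_or, not_le, not_le] at hbad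
  simp only [mul_neg, Finset.sum_neg_distrib]
  exact hbad.symm.imp_right fun h => by linarith

/-- Markov's inequality for the number of events `B l` with `l ∈ s` that occur. -/
theorem mul_measure_le_ncard_le {Ω : Type*} [MeasurableSpace Ω] (μ : Measure Ω)
    (B : ℕ → Set Ω) (hB : ∀ l, MeasurableSet (B l)) (s : Finset ℕ) (δ : ℝ≥0∞)
    (hδ : ∀ l, μ (B l) ≤ δ) (m : ℕ) :
    m * μ {ω | m ≤ Set.ncard {l | l ∈ s ∧ ω ∈ B l}} ≤ s.card * δ := by
  classical
  have hmk := mul_meas_ge_le_lintegral (μ := μ)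
    (f := fun ω => ∑ l ∈ s, (B l).indicator (1 : Ω → ℝ≥0∞) ω)
    (Finset.measurable_fun_sum _ fun l _ => measurable_one.indicator (hB l)) m
  rw [lintegral_finsetSum _ fun l _ => measurable_one.indicator (hB l)] at hmk
  simp only [lintegral_indicator_one (hB _)] at hmk
  calc _ ≤ _ := by
        gcongr with ω
        intro hω
        have hc : {l | l ∈ s ∧ ω ∈ B l} = (s.filter fun l => ω ∈ B l : Finset ℕ) := by
          ext; simp
        have : ∑ l ∈ s, (B l).indicator (1 : Ω → ℝ≥0∞) ω =
            ((s.filter fun l => ω ∈ B l).card : ℝ≥0∞) := by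
          simp [Set.indicator_apply]
        rw [hc, Set.ncard_coe_finset] at hω
        rw [this]
        exact_mod_cast hω
    _ ≤ _ := hmk
    _ ≤ _ := (Finset.sum_le_sum fun l _ => hδ l).trans (by simp)

/-- Lemma 3.2 of the paper: for every `ε > 0` there are `γ ∈ (0,1)` and
`C > 0` such that for all `n ≥ 1`, the `𝔪`-measure of the union of the cylinders `[a]` over
words `a ∈ Bad(n,ε)` (words having at least `⌊n/20⌋` positions `l` at which the length-`k_n`
window has abnormal `r`-product or `p`-product) is at most `C·γ^{k_n}`. -/
theorem statement14 {A : Type*} [Fintype A] [MeasurableSpace A] [MeasurableSingletonClass A]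
    (hA : 2 ≤ Fintype.card A)
    (r : A → ℝ) (hr : ∀ a, r a ∈ Set.Ioo (0 : ℝ) 1)
    (p : A → ℝ) (hp0 : ∀ a, 0 ≤ p a) (hp1 : ∀ a, p a < 1) (hpsum : ∑ a, p a = 1)
    (𝔪 : Measure (ℕ → A)) [IsProbabilityMeasure 𝔪]
    (h𝔪 : ∀ (n : ℕ) (a : Fin n → A), 𝔪 (cyl a) = ENNReal.ofReal (∏ i, p (a i))) :
    ∀ ε > (0 : ℝ), ∃ γ ∈ Set.Ioo (0 : ℝ) 1, ∃ C > (0 : ℝ), ∀ n ≥ 1,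
      𝔪 {σ : ℕ → A | n / 20 ≤ Set.ncard {l : ℕ | l + knp p n ≤ n ∧
          ((∏ i ∈ Finset.range (knp p n), r (σ (l + i))) ∉
            Set.Icc (Real.exp (knp p n * (-(-∑ a, p a * Real.log (r a)) - ε)))
                    (Real.exp (knp p n * (-(-∑ a, p a * Real.log (r a)) + ε))) ∨
           (∏ i ∈ Finset.range (knp p n), p (σ (l + i))) ∉
            Set.Icc (Real.exp (knp p n * (-(-∑ a, p a * Real.log (p a)) - ε)))
                    (Real.exp (knp p n * (-(-∑ a, p a * Real.log (p a)) + ε))))}}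
        ≤ ENNReal.ofReal (C * γ ^ knp p n) := by
  intro ε hε
  obtain ⟨γ₁, hγ₁, h₁⟩ := exists_measure_window_prod_notMem_le p hp0 hpsum 𝔪 h𝔪 r
    (fun a _ => (hr a).1) hε
  obtain ⟨γ₂, hγ₂, h₂⟩ := exists_measure_window_prod_notMem_le p hp0 hpsum 𝔪 h𝔪 p
    (fun a ha => lt_of_le_of_ne (hp0 a) (Ne.symm ha)) hε
  simp only [neg_neg]
  set γ := max γ₁ γ₂
  have hγ : γ ∈ Ioo (0 : ℝ) 1 := ⟨lt_max_of_lt_left hγ₁.1, max_lt hγ₁.2 hγ₂.2⟩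
  obtain ⟨K, hK⟩ : ∃ K, ∀ n < 20, knp p n ≤ K := ⟨∑ n ∈ Finset.range 20, knp p n, fun n hn =>
    Finset.single_le_sum (f := knp p) (fun _ _ => Nat.zero_le _) (Finset.mem_range.2 hn)⟩
  have hKpos : 0 < (γ ^ K)⁻¹ := inv_pos.2 (pow_pos hγ.1 K)
  refine ⟨γ, hγ, 160 + (γ ^ K)⁻¹, add_pos (by norm_num) hKpos, fun n _ => ?_⟩
  have hγk : 0 < γ ^ knp p n := pow_pos hγ.1 _
  rcases lt_or_ge n 20 with hn | hn
  · refine prob_le_one.trans (ENNReal.one_le_ofReal.2 ?_)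
    have h1 : (γ ^ K)⁻¹ * γ ^ K = 1 := inv_mul_cancel₀ (pow_pos hγ.1 K).ne'
    have h2 := mul_le_mul_of_nonneg_left (pow_le_pow_of_le_one hγ.1.le hγ.2.le (hK n hn)) hKpos.le
    linarith
  set k := knp p n with hk
  have hk1 : 1 ≤ k := Nat.le_add_left _ _
  set I : (A → ℝ) → Set ℝ := fun q => Icc (Real.exp (k * (∑ a, p a * Real.log (q a) - ε)))
    (Real.exp (k * (∑ a, p a * Real.log (q a) + ε)))
  have hmeas (q : A → ℝ) (l : ℕ) :
      MeasurableSet {σ : ℕ → A | ∏ i ∈ Finset.range k, q (σ (l + i)) ∉ I q} := by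
    have hq : Measurable q := Measurable.of_discrete
    have hprod : Measurable fun σ : ℕ → A => ∏ i ∈ Finset.range k, q (σ (l + i)) :=
      Finset.measurable_fun_prod _ fun i _ => hq.comp (measurable_pi_apply (l + i))
    exact hprod measurableSet_Icc.compl
  have hbound (l : ℕ) : 𝔪 ({σ | ∏ i ∈ Finset.range k, r (σ (l + i)) ∉ I r} ∪
      {σ | ∏ i ∈ Finset.range k, p (σ (l + i)) ∉ I p}) ≤ ENNReal.ofReal (4 * γ ^ k) := by
    have hle₁ : γ₁ ^ k ≤ γ ^ k := pow_le_pow_left₀ hγ₁.1.le (le_max_left _ _) k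
    have hle₂ : γ₂ ^ k ≤ γ ^ k := pow_le_pow_left₀ hγ₂.1.le (le_max_right _ _) k
    have h₁k := pow_pos hγ₁.1 k
    have h₂k := pow_pos hγ₂.1 k
    calc _ ≤ _ := measure_union_le _ _
      _ ≤ _ := add_le_add (h₁ l k) (h₂ l k)
      _ = _ := (ENNReal.ofReal_add (by positivity) (by positivity)).symm
      _ ≤ _ := ENNReal.ofReal_le_ofReal (by linarith)
  have hmk := mul_measure_le_ncard_le 𝔪 _ (fun l => (hmeas r l).union (hmeas p l))
    (Finset.range (n + 1 - k)) _ hbound (n / 20)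
  have hmem (l : ℕ) : l ∈ Finset.range (n + 1 - k) ↔ l + k ≤ n := by
    rw [Finset.mem_range]; omega
  simp only [hmem, Finset.card_range] at hmk
  have hcard : ((n + 1 - k : ℕ) : ℝ≥0∞) ≤ (n / 20 : ℕ) * 40 := by
    exact_mod_cast (show n + 1 - k ≤ n / 20 * 40 by omega)
  have hpos : ((n / 20 : ℕ) : ℝ≥0∞) ≠ 0 := by
    exact_mod_cast (show n / 20 ≠ 0 by omega)
  have hfin := hmk.trans (mul_le_mul_left hcard _)
  rw [mul_assoc, ENNReal.mul_le_mul_iff_right hpos (ENNReal.natCast_ne_top _)] at hfin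
  refine hfin.trans ?_
  rw [← ENNReal.ofReal_ofNat 40, ← ENNReal.ofReal_mul (by norm_num)]
  refine ENNReal.ofReal_le_ofReal ?_
  have := mul_pos hKpos hγk
  linarith
end
end
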